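/- If the cut polytope Cut□(G) of a graph G without K₅ minor is normal, then the cut polytope Cut□(G∖e₀) of the graph obtained by deleting any edge e₀ is also normal. -/

import Mathlib

open Finset

variable {V : Type} [DecidableEq V]

def cutFun (S : Finset V) : Sym2 V → ℤ :=
  Sym2.lift ⟨fun i j => |(if i ∈ S then (1 : ℤ) else 0) - (if j ∈ S then (1 : ℤ) else 0)|,
    fun i j => abs_sub_comm _ _⟩

def zSpan {ι : Type} (B : Set (ι → ℤ)) : Set (ι → ℤ) :=
  {x | ∃ (s : Finset (ι → ℤ)) (c : (ι → ℤ) → ℤ), ↑s ⊆ B ∧ x = ∑ b ∈ s, c b • b}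

def zPlus {ι : Type} (B : Set (ι → ℤ)) : Set (ι → ℤ) :=
  {x | ∃ (s : Finset (ι → ℤ)) (c : (ι → ℤ) → ℤ), ↑s ⊆ B ∧ (∀ b ∈ s, 0 ≤ c b) ∧
    x = ∑ b ∈ s, c b • b}

def toQ {ι : Type} (x : ι → ℤ) : ι → ℚ := fun i => (x i : ℚ)

def qPlus {ι : Type} (B : Set (ι → ℤ)) : Set (ι → ℚ) :=
  {x | ∃ (s : Finset (ι → ℤ)) (c : (ι → ℤ) → ℚ), ↑s ⊆ B ∧ (∀ b ∈ s, 0 ≤ c b) ∧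
    x = ∑ b ∈ s, c b • toQ b}

def AG (G : SimpleGraph V) : Set (↥G.edgeSet → ℤ) :=
  {x | ∃ S : Finset V, x = fun e => cutFun S e.1}

def XG (G : SimpleGraph V) : Set (Option ↥G.edgeSet → ℤ) :=
  {x | ∃ S : Finset V, x = fun o => Option.elim o 1 (fun e => cutFun S e.1)}

def IsNormal (G : SimpleGraph V) : Prop :=
  zPlus (XG G) = zSpan (XG G) ∩ toQ ⁻¹' qPlus (XG G)

def IsMinor {W : Type} (H : SimpleGraph W) (G : SimpleGraph V) : Prop :=
  ∃ f : W → Set V,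
    (∀ w, (G.induce (f w)).Connected) ∧
    (Pairwise fun w₁ w₂ => Disjoint (f w₁) (f w₂)) ∧
    (∀ w₁ w₂, H.Adj w₁ w₂ → ∃ a ∈ f w₁, ∃ b ∈ f w₂, G.Adj a b)

open Classical in
noncomputable def extZ {G : SimpleGraph V} (x : ↥G.edgeSet → ℤ) : Sym2 V → ℤ :=
  fun e => if h : e ∈ G.edgeSet then x ⟨e, h⟩ else 0

open Classical in
noncomputable def extQ {G : SimpleGraph V} (x : ↥G.edgeSet → ℚ) : Sym2 V → ℚ :=
  fun e => if h : e ∈ G.edgeSet then x ⟨e, h⟩ else 0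

set_option linter.unusedSectionVars false


set_option linter.unusedSectionVars false

section Lehman
variable {E : Type} [Fintype E] [DecidableEq E]

def lhDom (Bk : Set (Finset E)) (y : E → ℚ) : Prop :=
  ∃ l : Finset E → ℚ, (∀ B, 0 ≤ l B) ∧ (∀ B, l B ≠ 0 → B ∈ Bk) ∧ ∑ B, l B = 1 ∧
    ∀ f, ∑ B, l B * (if f ∈ B then 1 else 0) ≤ y f

def lhQ (A : Set (Finset E)) (y : E → ℚ) : Prop :=
  (∀ f, 0 ≤ y f) ∧ ∀ C ∈ A, 1 ≤ ∑ f ∈ C, y f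

def lhDel (A Bk : Set (Finset E)) (j : E) : Prop :=
  ∀ y : E → ℚ, (∀ f, 0 ≤ y f) → (∀ C ∈ A, j ∉ C → 1 ≤ ∑ f ∈ C, y f) →
    ∃ l : Finset E → ℚ, (∀ B, 0 ≤ l B) ∧ (∀ B, l B ≠ 0 → B ∈ Bk) ∧ ∑ B, l B = 1 ∧
    ∀ f, f ≠ j → ∑ B, l B * (if f ∈ B then 1 else 0) ≤ y f

def lhCon (A Bk : Set (Finset E)) (j : E) : Prop :=
  ∀ y : E → ℚ, lhQ A y → y j = 0 → lhDom Bk y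

theorem lhDom_mono {Bk : Set (Finset E)} {y y' : E → ℚ} (h : lhDom Bk y) (hh : ∀ f, y f ≤ y' f) :
    lhDom Bk y' := by
  obtain ⟨l, h1, h2, h3, h4⟩ := h
  exact ⟨l, h1, h2, h3, fun f => (h4 f).trans (hh f)⟩

theorem lhDom_convex {Bk : Set (Finset E)} {y y' : E → ℚ} (h : lhDom Bk y) (h' : lhDom Bk y')
    (a b : ℚ) (ha : 0 ≤ a) (hb : 0 ≤ b) (hab : a + b = 1) :
    lhDom Bk (a • y + b • y') := by
  obtain ⟨l, h1, h2, h3, h4⟩ := h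
  obtain ⟨l', h1', h2', h3', h4'⟩ := h'
  refine ⟨fun B => a * l B + b * l' B, fun B => ?_, fun B hB => ?_, ?_, fun f => ?_⟩
  · have := h1 B; have := h1' B; positivity
  · by_cases hl : l B = 0
    · by_cases hl' : l' B = 0
      · simp [hl, hl'] at hB
      · exact h2' B hl'
    · exact h2 B hl
  · rw [sum_add_distrib, ← mul_sum, ← mul_sum, h3, h3']; linarith
  · have e : ∑ B, (a * l B + b * l' B) * (if f ∈ B then (1:ℚ) else 0)
      = a * ∑ B, l B * (if f ∈ B then (1:ℚ) else 0) + b * ∑ B, l' B * (if f ∈ B then (1:ℚ) else 0) := by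
      rw [mul_sum, mul_sum, ← sum_add_distrib]
      exact sum_congr rfl fun B _ => by ring
    rw [e]
    simp only [Pi.add_apply, Pi.smul_apply, smul_eq_mul]
    have := mul_le_mul_of_nonneg_left (h4 f) ha
    have := mul_le_mul_of_nonneg_left (h4' f) hb
    linarith

theorem lhDom_single {Bk : Set (Finset E)} {B : Finset E} (hB : B ∈ Bk) {y : E → ℚ}
    (h : ∀ f, (if f ∈ B then 1 else 0) ≤ y f) : lhDom Bk y := by
  refine ⟨fun B' => if B' = B then 1 else 0, fun B' => by positivity, fun B' h' => ?_, by simp, fun f => ?_⟩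
  · by_cases e : B' = B
    · rwa [e]
    · simp [e] at h'
  · simpa only [ite_mul, one_mul, zero_mul, sum_ite_eq', mem_univ, if_true] using h f

/-- Ray shooting. -/
theorem lh_ray {κ M : Type} [Fintype κ] [AddCommGroup M] [Module ℚ M]
    (g : κ → (M →ₗ[ℚ] ℚ)) (β : κ → ℚ) (y d : M) (hy : ∀ k, β k ≤ g k y)
    (hd : ∀ k, g k y = β k → 0 ≤ g k d) (hn : ∃ k, g k d < 0) :
    ∃ t : ℚ, 0 < t ∧ (∀ k, β k ≤ g k (y + t • d)) ∧ ∃ k, g k (y + t • d) = β k ∧ g k d < 0 := by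
  classical
  obtain ⟨k0, hk0⟩ := hn
  obtain ⟨k, hk, hmin⟩ := exists_min_image (univ.filter fun k => g k d < 0)
    (fun k => (g k y - β k) / (- g k d)) ⟨k0, by simp [hk0]⟩
  simp only [mem_filter, mem_univ, true_and] at hk hmin
  have hpos : 0 < g k y - β k := by
    rcases (hy k).lt_or_eq with h | h
    · linarith
    · have := hd k h.symm; linarith
  refine ⟨(g k y - β k) / (- g k d), div_pos hpos (by linarith), fun k' => ?_, k, ?_, hk⟩
  · simp only [map_add, map_smul, smul_eq_mul]
    by_cases h : g k' d < 0
    · have := hmin k' h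
      rw [le_div_iff₀ (by linarith)] at this
      linarith
    · have h1 : 0 ≤ (g k y - β k) / (- g k d) := (div_pos hpos (by linarith)).le
      have := mul_nonneg h1 (not_lt.mp h)
      have := hy k'
      linarith
  · simp only [map_add, map_smul, smul_eq_mul]
    have : g k d ≠ 0 := by linarith
    field_simp
    ring

def lhG (A : Set (Finset E)) : E ⊕ {C // C ∈ A} → ((E → ℚ) →ₗ[ℚ] ℚ)
  | Sum.inl f => LinearMap.proj f
  | Sum.inr C => ∑ f ∈ C.1, LinearMap.proj f

def lhB (A : Set (Finset E)) : E ⊕ {C // C ∈ A} → ℚ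
  | Sum.inl _ => 0
  | Sum.inr _ => 1

@[simp] theorem lhG_inl (A : Set (Finset E)) (f : E) (y : E → ℚ) : lhG A (Sum.inl f) y = y f := rfl
@[simp] theorem lhG_inr (A : Set (Finset E)) (C : {C // C ∈ A}) (y : E → ℚ) :
    lhG A (Sum.inr C) y = ∑ f ∈ C.1, y f := by
  simp [lhG]
@[simp] theorem lhB_inl (A : Set (Finset E)) (f : E) : lhB A (Sum.inl f) = 0 := rfl
@[simp] theorem lhB_inr (A : Set (Finset E)) (C : {C // C ∈ A}) : lhB A (Sum.inr C) = 1 := rfl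

theorem lhQ_iff (A : Set (Finset E)) (y : E → ℚ) : lhQ A y ↔ ∀ k, lhB A k ≤ lhG A k y := by
  constructor
  · rintro ⟨h1, h2⟩ (f | C)
    · simpa using h1 f
    · simpa using h2 C.1 C.2
  · intro h
    exact ⟨fun f => by simpa using h (Sum.inl f), fun C hC => by simpa using h (Sum.inr ⟨C, hC⟩)⟩

/-- the tight constraints determine `y` -/
def lhVtx (A : Set (Finset E)) (y : E → ℚ) : Prop :=
  ∀ d : E → ℚ, (∀ k, lhG A k y = lhB A k → lhG A k d = 0) → d = 0

theorem lh_exists_vertex (A Bk : Set (Finset E)) (h : ∃ y, lhQ A y ∧ ¬ lhDom Bk y) :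
    ∃ y, lhQ A y ∧ ¬ lhDom Bk y ∧ lhVtx A y := by
  classical
  let tight : (E → ℚ) → Finset (E ⊕ {C // C ∈ A}) := fun y => univ.filter fun k => lhG A k y = lhB A k
  let P : ℕ → Prop := fun m => ∃ y, lhQ A y ∧ ¬ lhDom Bk y ∧ (tight y).card = m
  obtain ⟨y0, hy0, hy0'⟩ := h
  have hP : P (tight y0).card := ⟨y0, hy0, hy0', rfl⟩
  have hbd : ∀ y, (tight y).card ≤ Fintype.card (E ⊕ {C // C ∈ A}) := fun y => card_le_univ _
  obtain ⟨y, hyQ, hyD, hym⟩ := Nat.findGreatest_spec (P := P) (hbd y0) hP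
  have hmax : ∀ y', lhQ A y' → (tight y).card < (tight y').card → lhDom Bk y' := by
    intro y' hQ hlt
    by_contra hD
    have : P (tight y').card := ⟨y', hQ, hD, rfl⟩
    have := Nat.le_findGreatest (hbd y') this
    omega
  refine ⟨y, hyQ, hyD, fun d hd => ?_⟩
  have claim : ∀ d : E → ℚ, (∀ k, lhG A k y = lhB A k → lhG A k d = 0) → (∃ k, lhG A k d < 0) →
      ∃ t : ℚ, 0 < t ∧ lhDom Bk (y + t • d) := by
    intro d hd hn
    obtain ⟨t, ht, h1, k, h2, h3⟩ := lh_ray (lhG A) (lhB A) y d ((lhQ_iff A y).1 hyQ)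
      (fun k hk => (hd k hk).ge) hn
    refine ⟨t, ht, hmax _ ((lhQ_iff A _).2 h1) (card_lt_card ?_)⟩
    rw [Finset.ssubset_iff_of_subset]
    · refine ⟨k, by simpa [tight] using h2, ?_⟩
      simp only [tight, mem_filter, mem_univ, true_and]
      intro hk
      have := hd k hk
      linarith
    · intro k hk
      simp only [tight, mem_filter, mem_univ, true_and] at hk ⊢
      rw [map_add, map_smul, hd k hk, hk]; simp
  by_contra hd0
  have key : ∀ d : E → ℚ, d ≠ 0 → (∀ k, lhG A k y = lhB A k → lhG A k d = 0) →
      ¬ (∃ k, lhG A k d < 0) → False := by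
    intro d hd0 hd hnn
    push Not at hnn
    have hge : ∀ f, 0 ≤ d f := fun f => by simpa using hnn (Sum.inl f)
    obtain ⟨f, hf⟩ : ∃ f, d f ≠ 0 := by
      by_contra hh; push Not at hh; exact hd0 (funext hh)
    obtain ⟨t, ht, hD⟩ := claim (-d) (fun k hk => by rw [map_neg, hd k hk, neg_zero])
      ⟨Sum.inl f, by
        have := lt_of_le_of_ne (hge f) (Ne.symm hf)
        simpa using this⟩
    refine hyD (lhDom_mono hD fun f => ?_)
    have := mul_nonneg ht.le (hge f)
    simp; linarith
  by_cases h1 : ∃ k, lhG A k d < 0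
  · by_cases h2 : ∃ k, lhG A k (-d) < 0
    · obtain ⟨t, ht, hD⟩ := claim d hd h1
      obtain ⟨t', ht', hD'⟩ := claim (-d) (fun k hk => by rw [map_neg, hd k hk, neg_zero]) h2
      have := lhDom_convex hD hD' (t' / (t + t')) (t / (t + t')) (by positivity) (by positivity)
        (by field_simp; ring)
      apply hyD
      convert this using 1
      ext f
      simp
      field_simp
      ring
    · exact key (-d) (neg_ne_zero.2 hd0) (fun k hk => by rw [map_neg, hd k hk, neg_zero]) h2
  · exact key d hd0 hd h1

theorem lh_sum_ind (l : Finset E → ℚ) (C : Finset E) :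
    ∑ f ∈ C, ∑ B, l B * (if f ∈ B then (1:ℚ) else 0) = ∑ B, l B * ((C ∩ B).card : ℚ) := by
  rw [sum_comm]
  refine sum_congr rfl fun B _ => ?_
  rw [← mul_sum]; simp [Finset.sum_ite_mem]

/-- vertices in the dominant are integral -/
theorem lh_vtx_dom (A Bk : Set (Finset E)) (hodd : ∀ C ∈ A, ∀ B ∈ Bk, Odd (C ∩ B).card)
    (y : E → ℚ) (hD : lhDom Bk y) (hV : lhVtx A y) :
    ∃ B ∈ Bk, ∀ f, y f = if f ∈ B then 1 else 0 := by
  obtain ⟨l, h1, h2, h3, h4⟩ := hD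
  obtain ⟨B, hB⟩ : ∃ B, l B ≠ 0 := by
    by_contra hh; push Not at hh; simp [hh] at h3
  refine ⟨B, h2 B hB, ?_⟩
  have hlB : 0 < l B := lt_of_le_of_ne (h1 B) (Ne.symm hB)
  have hz := hV (fun f => y f - if f ∈ B then 1 else 0) ?_
  · intro f; have := congrFun hz f; simp only [Pi.zero_apply] at this; linarith
  rintro (f | C) hk
  · simp only [lhG_inl, lhB_inl] at hk ⊢
    have := h4 f
    rw [hk] at this ⊢
    have h5 := (sum_eq_zero_iff_of_nonneg (fun B _ => mul_nonneg (h1 B) (by positivity : (0:ℚ) ≤ if f ∈ B then 1 else 0))).1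
      (le_antisymm this (sum_nonneg fun B _ => mul_nonneg (h1 B) (by positivity))) B (mem_univ _)
    rcases mul_eq_zero.1 h5 with h | h
    · exact absurd h hB
    · rw [h]; simp
  · simp only [lhG_inr, lhB_inr] at hk ⊢
    have hle : ∑ B, l B * ((C.1 ∩ B).card : ℚ) ≤ 1 := by
      rw [← lh_sum_ind]; exact (sum_le_sum fun f _ => h4 f).trans hk.le
    have hge : ∀ B', l B' ≤ l B' * ((C.1 ∩ B').card : ℚ) := by
      intro B'
      by_cases h : l B' = 0
      · simp [h]
      · have := (hodd C.1 C.2 B' (h2 B' h)).pos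
        have : (1:ℚ) ≤ (C.1 ∩ B').card := by exact_mod_cast this
        nlinarith [h1 B']
    have heq := (sum_eq_sum_iff_of_le (fun B' (_ : B' ∈ univ) => hge B')).1
      (le_antisymm (sum_le_sum fun B' _ => hge B') (by rw [h3]; exact hle)) B (mem_univ _)
    have : ((C.1 ∩ B).card : ℚ) = 1 := by
      have := mul_left_cancel₀ hB (show l B * 1 = l B * ((C.1 ∩ B).card : ℚ) by rw [mul_one]; exact heq)
      exact this.symm
    rw [sum_sub_distrib, hk]
    simp only [Finset.sum_ite_mem, sum_const, nsmul_eq_mul, mul_one]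
    rw [this]; simp

end Lehman

set_option linter.unusedSectionVars false

section Lehman
variable {E : Type} [Fintype E] [DecidableEq E]

theorem lh_basis (T : Finset (Finset E)) (hT : ∀ d : E → ℚ, (∀ C ∈ T, ∑ f ∈ C, d f = 0) → d = 0) :
    ∃ R ⊆ T, (∀ d : E → ℚ, (∀ C ∈ R, ∑ f ∈ C, d f = 0) → d = 0) ∧ R.card = Fintype.card E := by
  classical
  obtain ⟨R, hR, hmin⟩ := exists_min_image
    (T.powerset.filter fun R => ∀ d : E → ℚ, (∀ C ∈ R, ∑ f ∈ C, d f = 0) → d = 0) card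
    ⟨T, by simp only [mem_filter, mem_powerset, Finset.Subset.refl, true_and]; exact hT⟩
  simp only [mem_filter, mem_powerset, and_imp] at hR hmin
  refine ⟨R, hR.1, hR.2, ?_⟩
  let Φ : (E → ℚ) →ₗ[ℚ] (R → ℚ) := LinearMap.pi fun C => ∑ f ∈ C.1, LinearMap.proj f
  have hΦ : ∀ d C, Φ d C = ∑ f ∈ C.1, d f := by intro d C; simp [Φ]
  have inj : Function.Injective Φ := by
    rw [injective_iff_map_eq_zero]
    intro d hd
    exact hR.2 d fun C hC => by rw [← hΦ d ⟨C, hC⟩, hd]; rfl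
  have dual : ∀ C : R, ∃ d, Φ d = Pi.single C 1 := by
    intro C
    have : ¬ ∀ d : E → ℚ, (∀ C' ∈ R.erase C.1, ∑ f ∈ C', d f = 0) → d = 0 := by
      intro h
      have h1 := hmin (R.erase C.1) ((erase_subset _ _).trans hR.1) h
      have := card_erase_lt_of_mem C.2
      omega
    push Not at this
    obtain ⟨d, hd, hd0⟩ := this
    have hne : ∑ f ∈ C.1, d f ≠ 0 := by
      intro h0
      apply hd0
      apply hR.2
      intro C' hC'
      by_cases e : C' = C.1
      · rw [e, h0]
      · exact hd C' (mem_erase.2 ⟨e, hC'⟩)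
    refine ⟨(∑ f ∈ C.1, d f)⁻¹ • d, ?_⟩
    ext C'
    rw [map_smul, Pi.smul_apply, hΦ]
    by_cases e : C' = C
    · subst e; simp [hne]
    · rw [hd C'.1 (mem_erase.2 ⟨fun h => e (Subtype.ext h), C'.2⟩)]
      simp [e]
  have surj : Function.Surjective Φ := by
    choose d hd using dual
    intro z
    refine ⟨∑ C, z C • d C, ?_⟩
    rw [map_sum]
    simp only [map_smul, hd]
    ext C
    simp [Finset.sum_apply, Pi.single_apply]
  have := (LinearEquiv.ofBijective Φ ⟨inj, surj⟩).finrank_eq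
  simp only [Module.finrank_fintype_fun_eq_card, Fintype.card_coe] at this
  exact this.symm

theorem lh_dual (R : Finset (Finset E))
    (hinj : ∀ d : E → ℚ, (∀ C ∈ R, ∑ f ∈ C, d f = 0) → d = 0) (hcard : R.card = Fintype.card E)
    (z : Finset E → ℚ) : ∃ d : E → ℚ, ∀ C ∈ R, ∑ f ∈ C, d f = z C := by
  let Φ : (E → ℚ) →ₗ[ℚ] (R → ℚ) := LinearMap.pi fun C => ∑ f ∈ C.1, LinearMap.proj f
  have hΦ : ∀ d C, Φ d C = ∑ f ∈ C.1, d f := by intro d C; simp [Φ]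
  have inj : Function.Injective Φ := by
    rw [injective_iff_map_eq_zero]
    intro d hd
    exact hinj d fun C hC => by rw [← hΦ d ⟨C, hC⟩, hd]; rfl
  have surj : Function.Surjective Φ :=
    (LinearMap.injective_iff_surjective_of_finrank_eq_finrank (by simp [hcard])).1 inj
  obtain ⟨d, hd⟩ := surj fun C => z C.1
  exact ⟨d, fun C hC => by rw [← hΦ d ⟨C, hC⟩, hd]⟩

theorem lh_rank (A Bk : Set (Finset E)) (hodd : ∀ C ∈ A, ∀ B ∈ Bk, Odd (C ∩ B).card)
    (hdel : ∀ j, lhDel A Bk j) (y : E → ℚ) (hQ : lhQ A y) (hpos : ∀ f, 0 < y f)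
    (R : Finset (Finset E)) (hR : ∀ C ∈ R, C ∈ A ∧ ∑ f ∈ C, y f = 1)
    (hinj : ∀ d : E → ℚ, (∀ C ∈ R, ∑ f ∈ C, d f = 0) → d = 0)
    (j : E) (C : Finset E) (hC : C ∈ R) (hj : j ∉ C) :
    C.card ≤ (R.filter fun C' => j ∈ C').card := by
  classical
  obtain ⟨l, h1, h2, h3, h4⟩ := hdel j y hQ.1 fun C hC _ => hQ.2 C hC
  have hge : ∀ C' ∈ R, ∀ B', l B' ≤ l B' * ((C' ∩ B').card : ℚ) := by
    intro C' hC' B'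
    by_cases h : l B' = 0
    · simp [h]
    · have := (hodd C' (hR C' hC').1 B' (h2 B' h)).pos
      have : (1:ℚ) ≤ (C' ∩ B').card := by exact_mod_cast this
      nlinarith [h1 B']
  have hle : ∀ C' ∈ R, j ∉ C' → ∑ f ∈ C', ∑ B, l B * (if f ∈ B then (1:ℚ) else 0) ≤ 1 := by
    intro C' hC' hj'
    refine le_of_le_of_eq ?_ (hR C' hC').2
    exact sum_le_sum fun f hf => h4 f fun e => hj' (e ▸ hf)
  have hone : ∀ C' ∈ R, j ∉ C' → ∀ B, l B ≠ 0 → (C' ∩ B).card = 1 := by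
    intro C' hC' hj' B hB
    have hle' := hle C' hC' hj'
    rw [lh_sum_ind] at hle'
    have heq := (sum_eq_sum_iff_of_le (fun B' (_ : B' ∈ univ) => hge C' hC' B')).1
      (le_antisymm (sum_le_sum fun B' _ => hge C' hC' B') (by rw [h3]; exact hle')) B (mem_univ _)
    have := mul_left_cancel₀ hB (show l B * 1 = l B * ((C' ∩ B).card : ℚ) by rw [mul_one]; exact heq)
    exact_mod_cast this.symm
  have hex : ∀ f : C, ∃ B, l B ≠ 0 ∧ f.1 ∈ B := by
    intro f
    by_contra hh
    push Not at hh
    have hz : ∑ B, l B * (if f.1 ∈ B then (1:ℚ) else 0) = 0 := by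
      refine sum_eq_zero fun B _ => ?_
      by_cases h : l B = 0
      · simp [h]
      · simp [hh B h]
    have hlt : ∑ f ∈ C, ∑ B, l B * (if f ∈ B then (1:ℚ) else 0) < 1 := by
      refine lt_of_lt_of_eq ?_ (hR C hC).2
      refine sum_lt_sum (fun f hf => h4 f fun e => hj (e ▸ hf)) ⟨f.1, f.2, ?_⟩
      rw [hz]; exact hpos _
    rw [lh_sum_ind] at hlt
    have : ∑ B, l B ≤ ∑ B, l B * ((C ∩ B).card : ℚ) := sum_le_sum fun B' _ => hge C hC B'
    linarith
  choose β hβ hβf using hex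
  -- combination map
  let v : Option C → E → ℚ := fun o => match o with
    | none => fun f => if f = j then 1 else 0
    | some g => fun f => if f ∈ β g then 1 else 0
  let L1 : (Option C → ℚ) →ₗ[ℚ] (E → ℚ) := Fintype.linearCombination ℚ v
  let S := R.filter fun C' => j ∈ C'
  let L2 : (E → ℚ) →ₗ[ℚ] (Option S → ℚ) := LinearMap.pi fun o => match o with
    | none => ∑ f ∈ C, LinearMap.proj f
    | some C' => ∑ f ∈ C'.1, LinearMap.proj f
  have hL2n : ∀ d, L2 d none = ∑ f ∈ C, d f := by intro d; simp [L2]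
  have hL2s : ∀ d C', L2 d (some C') = ∑ f ∈ C'.1, d f := by intro d C'; simp [L2]
  have hL1 : ∀ a f, L1 a f = a none * (if f = j then 1 else 0) + ∑ g : C, a (some g) * (if f ∈ β g then 1 else 0) := by
    intro a f
    simp only [L1, Fintype.linearCombination_apply, Finset.sum_apply, Pi.smul_apply, smul_eq_mul,
      Fintype.sum_option, v]
  have hsumC : ∀ C' ∈ R, j ∉ C' → ∀ a, ∑ f ∈ C', L1 a f = ∑ g : C, a (some g) := by
    intro C' hC' hj' a
    simp only [hL1]
    rw [sum_add_distrib, sum_comm]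
    have e1 : ∑ f ∈ C', a none * (if f = j then (1:ℚ) else 0) = 0 := by
      refine sum_eq_zero fun f hf => ?_
      have : f ≠ j := fun e => hj' (e ▸ hf)
      simp [this]
    rw [e1, zero_add]
    refine sum_congr rfl fun g _ => ?_
    rw [← mul_sum]
    simp only [Finset.sum_ite_mem, sum_const, nsmul_eq_mul, mul_one]
    rw [hone C' hC' hj' _ (hβ g)]; simp
  have hinj' : Function.Injective (L2 ∘ₗ L1) := by
    rw [injective_iff_map_eq_zero]
    intro a ha
    have ha' : ∀ o, L2 (L1 a) o = 0 := fun o => by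
      have := congrFun ha o; simpa using this
    have hz : L1 a = 0 := by
      apply hinj
      intro C' hC'
      by_cases hj' : j ∈ C'
      · have := ha' (some ⟨C', by simp [S, hC', hj']⟩)
        rwa [hL2s] at this
      · rw [hsumC C' hC' hj', ← hsumC C hC hj, ← hL2n]; exact ha' none
    have hg : ∀ g : C, a (some g) = 0 := by
      intro g
      have h5 := congrFun hz g.1
      rw [hL1] at h5
      have : g.1 ≠ j := fun e => hj (e ▸ g.2)
      simp only [this, if_false, mul_zero, zero_add, Pi.zero_apply] at h5
      rw [sum_eq_single g] at h5
      · simpa [hβf g] using h5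
      · intro g' _ hne
        have hc := hone C hC hj _ (hβ g')
        have : g.1 ∉ β g' := by
          intro hmem
          obtain ⟨w, hw⟩ := card_eq_one.1 hc
          have h6 : g.1 ∈ C ∩ β g' := mem_inter.2 ⟨g.2, hmem⟩
          have h7 : g'.1 ∈ C ∩ β g' := mem_inter.2 ⟨g'.2, hβf g'⟩
          rw [hw, mem_singleton] at h6 h7
          exact hne (Subtype.ext (h7.trans h6.symm))
        simp [this]
      · simp
    ext o
    cases o with
    | none =>
      have h5 := congrFun hz j
      rw [hL1] at h5
      simpa [hg] using h5
    | some g => exact hg g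
  have := LinearMap.finrank_le_finrank_of_injective hinj'
  simp only [Module.finrank_fintype_fun_eq_card, Fintype.card_option, Fintype.card_coe] at this
  simp only [S] at this
  omega

end Lehman

set_option linter.unusedSectionVars false

section Lehman
variable {E : Type} [Fintype E] [DecidableEq E]

theorem lh_regular (A Bk : Set (Finset E)) (hodd : ∀ C ∈ A, ∀ B ∈ Bk, Odd (C ∩ B).card)
    (hA3 : ∀ C₁ ∈ A, ∀ C₂ ∈ A, ∀ C₃ ∈ A, symmDiff (symmDiff C₁ C₂) C₃ ∈ A)
    (hBne : Bk.Nonempty)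
    (hdel : ∀ j, lhDel A Bk j) (y : E → ℚ) (hQ : lhQ A y) (hD : ¬ lhDom Bk y) (hpos : ∀ f, 0 < y f)
    (R : Finset (Finset E)) (hR : ∀ C ∈ R, C ∈ A ∧ ∑ f ∈ C, y f = 1)
    (hinj : ∀ d : E → ℚ, (∀ C ∈ R, ∑ f ∈ C, d f = 0) → d = 0) (hcard : R.card = Fintype.card E) :
    ∃ r : ℕ, 2 ≤ r ∧ (∀ C ∈ R, C.card = r) ∧ (∀ j, (R.filter fun C' => j ∈ C').card = r) ∧
      ∀ f, y f = 1 / r := by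
  classical
  set n := Fintype.card E with hn
  set ρ : E → ℕ := fun j => (R.filter fun C' => j ∈ C').card with hρ
  have hrank := lh_rank A Bk hodd hdel y hQ hpos R hR hinj
  -- containment of tight circuits
  have hsub : ∀ C ∈ R, ∀ C' ∈ A, C' ⊆ C → C' = C := by
    intro C hC C' hC' hs
    by_contra hne
    have hss : C' ⊂ C := hs.ssubset_of_ne hne
    obtain ⟨f, hf, hf'⟩ := exists_of_ssubset hss
    have := sum_lt_sum_of_subset hs hf hf' (hpos f) (fun j _ _ => (hpos j).le)
    have h1 := hQ.2 C' hC'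
    rw [(hR C hC).2] at this
    linarith
  have hρlt : ∀ j, ρ j < n := by
    intro j
    refine lt_of_le_of_ne ((card_filter_le _ _).trans hcard.le) ?_
    intro he
    have hall : ∀ C ∈ R, j ∈ C := by
      have : R.filter (fun C' => j ∈ C') = R := eq_of_subset_of_card_le (filter_subset _ _) (by
        rw [hcard, ← he])
      intro C hC
      rw [← this] at hC
      exact (mem_filter.1 hC).2
    have hy : ∀ f, y f = if f = j then 1 else 0 := by
      have := hinj (fun f => y f - if f = j then 1 else 0) (fun C hC => by
        rw [sum_sub_distrib, (hR C hC).2]; simp [hall C hC])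
      intro f; have := congrFun this f; simp only [Pi.zero_apply] at this; linarith
    have hallA : ∀ C ∈ A, j ∈ C := by
      intro C hC
      by_contra hjC
      have h1 := hQ.2 C hC
      have : ∑ f ∈ C, y f = 0 := sum_eq_zero fun f hf => by
        have hfj : f ≠ j := fun e => hjC (e ▸ hf)
        rw [hy f, if_neg hfj]
      linarith
    obtain ⟨l, h1, h2, h3, h4⟩ := hdel j (fun _ => 0) (fun _ => le_rfl)
      (fun C hC hjC => absurd (hallA C hC) hjC)
    apply hD
    refine ⟨l, h1, h2, h3, fun f => ?_⟩
    by_cases e : f = j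
    · rw [hy f, if_pos e]
      refine le_of_le_of_eq ?_ h3
      refine sum_le_sum fun B _ => ?_
      have := h1 B
      split_ifs <;> simp [this]
    · rw [hy f, if_neg e]; exact h4 f e
  have hEne : Nonempty E := by
    by_contra hne
    rw [not_nonempty_iff] at hne
    obtain ⟨B, hB⟩ := hBne
    exact hD (lhDom_single hB fun f => (hne.false f).elim)
  have hnpos : 0 < n := Fintype.card_pos
  have halt : ∀ C ∈ R, C.card < n := by
    intro C hC
    refine lt_of_le_of_ne (card_le_univ _) ?_
    intro he
    have hCu : C = univ := (card_eq_iff_eq_univ C).1 he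
    have hall : ∀ C' ∈ R, C' = C := fun C' hC' => hsub C hC C' (hR C' hC').1 (by rw [hCu]; exact subset_univ _)
    obtain ⟨j⟩ := hEne
    have : R.filter (fun C' => j ∈ C') = R := filter_true_of_mem fun C' hC' => by
      rw [hall C' hC', hCu]; exact mem_univ _
    have h2 := hρlt j
    simp only [hρ, this, hcard] at h2
    omega
  -- double counting
  have hterm : ∀ C ∈ R, ∀ j, j ∉ C → (C.card : ℚ) / (n - C.card) ≤ (ρ j : ℚ) / (n - ρ j) := by
    intro C hC j hj
    have h1 : (C.card : ℚ) < n := by exact_mod_cast halt C hC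
    have h2 : (ρ j : ℚ) < n := by exact_mod_cast hρlt j
    have h3 : (C.card : ℚ) ≤ ρ j := by exact_mod_cast hrank j C hC hj
    rw [div_le_div_iff₀ (by linarith) (by linarith)]
    nlinarith
  have hnc : ∀ C : Finset E, ((univ.filter fun j => j ∉ C).card : ℚ) = n - C.card := by
    intro C
    have : (univ.filter fun j => j ∉ C) = Cᶜ := by ext; simp
    rw [this, card_compl, Nat.cast_sub (card_le_univ C)]
  have hnr : ∀ j, ((R.filter fun C' => j ∉ C').card : ℚ) = n - ρ j := by
    intro j
    have := card_filter_add_card_filter_not (s := R) (fun C' => j ∈ C')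
    rw [hcard] at this
    have : (ρ j : ℚ) + ((R.filter fun C' => j ∉ C').card : ℚ) = n := by exact_mod_cast this
    linarith
  have hs1 : ∑ C ∈ R, ∑ j ∈ univ.filter (fun j => j ∉ C), (C.card : ℚ) / (n - C.card) = ∑ C ∈ R, (C.card : ℚ) := by
    refine sum_congr rfl fun C hC => ?_
    have h1 : (C.card : ℚ) < n := by exact_mod_cast halt C hC
    rw [sum_const, nsmul_eq_mul, hnc]
    field_simp [(by linarith : (n:ℚ) - C.card ≠ 0)]
  have hs2 : ∑ C ∈ R, ∑ j ∈ univ.filter (fun j => j ∉ C), (ρ j : ℚ) / (n - ρ j) = ∑ j, (ρ j : ℚ) := by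
    have : ∑ C ∈ R, ∑ j ∈ univ.filter (fun j => j ∉ C), (ρ j : ℚ) / (n - ρ j)
        = ∑ j, ∑ C ∈ R.filter (fun C => j ∉ C), (ρ j : ℚ) / (n - ρ j) := by
      simp only [sum_filter]; rw [sum_comm]
    rw [this]
    refine sum_congr rfl fun j _ => ?_
    have h1 : (ρ j : ℚ) < n := by exact_mod_cast hρlt j
    rw [sum_const, nsmul_eq_mul, hnr]
    field_simp [(by linarith : (n:ℚ) - ρ j ≠ 0)]
  have hs3 : ∑ C ∈ R, (C.card : ℚ) = ∑ j, (ρ j : ℚ) := by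
    have : ∑ C ∈ R, C.card = ∑ j, ρ j := by
      simp only [hρ, card_filter]
      rw [sum_comm]
      refine sum_congr rfl fun C _ => ?_
      simp
    exact_mod_cast this
  have hle : ∀ C ∈ R, ∑ j ∈ univ.filter (fun j => j ∉ C), (C.card : ℚ) / (n - C.card)
      ≤ ∑ j ∈ univ.filter (fun j => j ∉ C), (ρ j : ℚ) / (n - ρ j) := fun C hC =>
    sum_le_sum fun j hj => hterm C hC j (mem_filter.1 hj).2
  have heq : ∀ C ∈ R, ∀ j, j ∉ C → C.card = ρ j := by
    intro C hC j hj
    have h1 := (sum_eq_sum_iff_of_le hle).1 (by rw [hs1, hs2, hs3]) C hC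
    have h2 := (sum_eq_sum_iff_of_le (fun j hj => hterm C hC j (mem_filter.1 hj).2)).1 h1 j (by simp [hj])
    have h3 : (C.card : ℚ) < n := by exact_mod_cast halt C hC
    have h4 : (ρ j : ℚ) < n := by exact_mod_cast hρlt j
    rw [div_eq_div_iff (by linarith) (by linarith)] at h2
    have h5 : (n:ℚ) * C.card = n * ρ j := by linarith
    have h6 := mul_left_cancel₀ (by exact_mod_cast hnpos.ne') h5
    exact_mod_cast h6
  have hexj : ∀ C ∈ R, ∃ j, j ∉ C := by
    intro C hC
    by_contra hh
    push Not at hh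
    have : C = univ := by ext; simp [hh]
    have h2 := halt C hC
    rw [this, card_univ] at h2
    omega
  have hexC : ∀ j, ∃ C ∈ R, j ∉ C := by
    intro j
    by_contra hh
    push Not at hh
    have h2 := hρlt j
    simp only [hρ, filter_true_of_mem hh, hcard] at h2
    omega
  -- uniformity
  have huni : ∀ C ∈ R, ∀ C' ∈ R, C.card = C'.card := by
    by_contra hnot
    push Not at hnot
    obtain ⟨C, hC, C', hC', hne⟩ := hnot
    have hcov : ∀ C₁ ∈ R, ∀ C₂ ∈ R, C₁.card ≠ C₂.card → ∀ j, j ∉ C₂ → j ∈ C₁ := by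
      intro C₁ h1 C₂ h2 hne j hj
      by_contra hj1
      exact hne ((heq C₁ h1 j hj1).trans (heq C₂ h2 j hj).symm)
    have hsingle : ∀ C₁ ∈ R, ∀ C₂ ∈ R, C₁.card = C₂.card → C₁ = C₂ := by
      intro C₁ h1 C₂ h2 he
      obtain ⟨C₃, h3, h3n⟩ : ∃ C₃ ∈ R, C₁.card ≠ C₃.card := by
        by_cases h : C₁.card = C.card
        · exact ⟨C', hC', h ▸ hne⟩
        · exact ⟨C, hC, h⟩
      have hsd := hA3 C₁ (hR _ h1).1 C₂ (hR _ h2).1 C₃ (hR _ h3).1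
      have hsd' := hsub C₃ h3 _ hsd (by
        intro j hj
        by_contra hj3
        have ha := hcov C₁ h1 C₃ h3 h3n j hj3
        have hb := hcov C₂ h2 C₃ h3 (he ▸ h3n) j hj3
        simp [mem_symmDiff, ha, hb, hj3] at hj)
      have : symmDiff C₁ C₂ = ∅ := by
        have h5 : symmDiff (symmDiff C₁ C₂) C₃ = symmDiff ∅ C₃ := by
          rw [hsd']; ext; simp [mem_symmDiff]
        exact symmDiff_left_injective C₃ h5
      exact symmDiff_eq_bot.1 this
    have hρn : ∀ j, ρ j = n - 1 := by
      intro j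
      obtain ⟨D, hD1, hD2⟩ := hexC j
      have : R.filter (fun C' => j ∈ C') = R.erase D := by
        ext D'
        simp only [mem_filter, mem_erase]
        constructor
        · rintro ⟨a, b⟩; exact ⟨fun e => hD2 (e ▸ b), a⟩
        · rintro ⟨a, b⟩
          exact ⟨b, hcov D' b D hD1 (fun e => a (hsingle _ b _ hD1 e)) j hD2⟩
      simp only [hρ, this, card_erase_of_mem hD1, hcard]
    obtain ⟨j, hj⟩ := hexj C hC
    obtain ⟨j', hj'⟩ := hexj C' hC'
    apply hne
    rw [heq C hC j hj, heq C' hC' j' hj', hρn, hρn]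
  obtain ⟨j0⟩ := hEne
  obtain ⟨C0, hC0, hj0⟩ := hexC j0
  have hcr : ∀ C ∈ R, C.card = C0.card := fun C hC => huni C hC C0 hC0
  have hyr : ∀ f, y f = 1 / (C0.card : ℚ) := by
    have hC0p : (C0.card : ℚ) ≠ 0 := by
      intro h
      have : C0 = ∅ := by simpa using h
      have h2 := (hR C0 hC0).2
      rw [this] at h2; simp at h2
    have := hinj (fun f => y f - 1 / (C0.card : ℚ)) (fun C hC => by
      rw [sum_sub_distrib, (hR C hC).2, sum_const, nsmul_eq_mul, hcr C hC]
      field_simp; ring)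
    intro f; have := congrFun this f; simp only [Pi.zero_apply] at this; linarith
  refine ⟨C0.card, ?_, hcr, ?_, hyr⟩
  · by_contra hlt
    have h1 : 1 / (C0.card : ℚ) ≥ 1 := by
      have hp := hpos j0
      rw [hyr j0] at hp
      have : 0 < C0.card := by
        by_contra h0
        have : C0.card = 0 := by omega
        rw [this] at hp; simp at hp
      have : C0.card = 1 := by omega
      rw [this]; norm_num
    obtain ⟨B, hB⟩ := hBne
    refine hD (lhDom_single hB fun f => ?_)
    rw [hyr f]
    split_ifs <;> linarith
  · intro j
    obtain ⟨C, hC, hj⟩ := hexC j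
    rw [← hcr C hC, heq C hC j hj]

end Lehman

set_option linter.unusedSectionVars false

section Lehman
variable {E : Type} [Fintype E] [DecidableEq E]

theorem lh_vertex_unif (A Bk : Set (Finset E)) (hodd : ∀ C ∈ A, ∀ B ∈ Bk, Odd (C ∩ B).card)
    (hA3 : ∀ C₁ ∈ A, ∀ C₂ ∈ A, ∀ C₃ ∈ A, symmDiff (symmDiff C₁ C₂) C₃ ∈ A)
    (hBne : Bk.Nonempty)
    (hdel : ∀ j, lhDel A Bk j) (hcon : ∀ j, lhCon A Bk j)
    (y : E → ℚ) (hQ : lhQ A y) (hD : ¬ lhDom Bk y) (hV : lhVtx A y) :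
    ∃ (R : Finset (Finset E)) (r : ℕ), (∀ C ∈ R, C ∈ A) ∧
      (∀ d : E → ℚ, (∀ C ∈ R, ∑ f ∈ C, d f = 0) → d = 0) ∧ R.card = Fintype.card E ∧
      2 ≤ r ∧ (∀ C ∈ R, C.card = r) ∧ (∀ j, (R.filter fun C' => j ∈ C').card = r) ∧
      (∀ f, y f = 1 / r) := by
  classical
  have hpos : ∀ f, 0 < y f := fun f => lt_of_le_of_ne (hQ.1 f) fun h => hD (hcon f y hQ h.symm)
  obtain ⟨R, hRT, hinj, hcard⟩ := lh_basis (univ.filter fun C => C ∈ A ∧ ∑ f ∈ C, y f = 1) (by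
    intro d hd
    refine hV d ?_
    rintro (f | C) hk
    · simp only [lhG_inl, lhB_inl] at hk
      exact absurd hk (hpos f).ne'
    · simp only [lhG_inr, lhB_inr] at hk ⊢
      exact hd C.1 (by simp [hk, C.2]))
  have hR : ∀ C ∈ R, C ∈ A ∧ ∑ f ∈ C, y f = 1 := fun C hC => by simpa using hRT hC
  obtain ⟨r, h1, h2, h3, h4⟩ := lh_regular A Bk hodd hA3 hBne hdel y hQ hD hpos R hR hinj hcard
  exact ⟨R, r, fun C hC => (hR C hC).1, hinj, hcard, h1, h2, h3, h4⟩

theorem lh_simple (A Bk : Set (Finset E)) (hodd : ∀ C ∈ A, ∀ B ∈ Bk, Odd (C ∩ B).card)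
    (hA3 : ∀ C₁ ∈ A, ∀ C₂ ∈ A, ∀ C₃ ∈ A, symmDiff (symmDiff C₁ C₂) C₃ ∈ A)
    (hBne : Bk.Nonempty) (hdel : ∀ j, lhDel A Bk j)
    (y : E → ℚ) (hQ : lhQ A y) (hD : ¬ lhDom Bk y)
    (R : Finset (Finset E)) (r : ℕ) (hRA : ∀ C ∈ R, C ∈ A)
    (hinj : ∀ d : E → ℚ, (∀ C ∈ R, ∑ f ∈ C, d f = 0) → d = 0) (hcard : R.card = Fintype.card E)
    (hr : 2 ≤ r) (hrow : ∀ C ∈ R, C.card = r) (hcol : ∀ j, (R.filter fun C' => j ∈ C').card = r)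
    (hy : ∀ f, y f = 1 / r) (C : Finset E) (hC : C ∈ A) (hCr : C.card = r) : C ∈ R := by
  classical
  by_contra hCR
  have hr0 : (r : ℚ) ≠ 0 := by positivity
  have hsz : ∀ C : Finset E, C.card = r → ∑ f ∈ C, y f = 1 := by
    intro C hC; simp [hy, hC, hr0]
  have hdual : ∀ C' : Finset E, ∃ d : E → ℚ, ∀ C'' ∈ R, ∑ f ∈ C'', d f = if C'' = C' then 1 else 0 :=
    fun C' => lh_dual R hinj hcard _
  choose d hd using hdual
  have hsum : y = fun f => ∑ C' ∈ R, d C' f := by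
    have := hinj (fun f => y f - ∑ C' ∈ R, d C' f) (fun C'' hC'' => by
      rw [sum_sub_distrib, hsz _ (hrow _ hC''), sum_comm, sum_congr rfl (fun C' _ => hd C' C'' hC'')]
      simp [hC''])
    funext f; have := congrFun this f; simp only [Pi.zero_apply] at this; linarith
  obtain ⟨C', hC', hne⟩ : ∃ C' ∈ R, ∑ f ∈ C, d C' f ≠ 0 := by
    by_contra hh
    push Not at hh
    have h1 := hsz C hCr
    rw [hsum, sum_comm, sum_eq_zero hh] at h1
    exact zero_ne_one h1
  have hinj' : ∀ w : E → ℚ, (∀ D ∈ insert C (R.erase C'), ∑ f ∈ D, w f = 0) → w = 0 := by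
    intro w hw
    have h1 := hinj (fun f => w f - (∑ g ∈ C', w g) * d C' f) (fun D hD => by
      rw [sum_sub_distrib, ← mul_sum, hd C' D hD]
      by_cases e : D = C'
      · simp [e]
      · rw [hw D (by simp [e, hD])]; simp [e])
    have h2 : ∀ f, w f = (∑ g ∈ C', w g) * d C' f := by
      intro f; have := congrFun h1 f; simp only [Pi.zero_apply] at this; linarith
    have h3 := hw C (mem_insert_self _ _)
    rw [sum_congr rfl (fun f _ => h2 f), ← mul_sum] at h3
    have h4 := (mul_eq_zero.1 h3).resolve_right hne
    funext f
    rw [h2 f, h4]; simp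
  have hCe : C ∉ R.erase C' := fun h => hCR (mem_of_mem_erase h)
  have hcard' : (insert C (R.erase C')).card = Fintype.card E := by
    rw [card_insert_of_notMem hCe, card_erase_of_mem hC', hcard]
    have : 0 < R.card := card_pos.2 ⟨_, hC'⟩
    omega
  have hpos : ∀ f, 0 < y f := fun f => by rw [hy f]; positivity
  obtain ⟨r', h1, h2, h3, h4⟩ := lh_regular A Bk hodd hA3 hBne hdel y hQ hD hpos
    (insert C (R.erase C')) (by
      intro D hD
      rcases mem_insert.1 hD with rfl | hD
      · exact ⟨hC, hsz _ hCr⟩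
      · have := mem_of_mem_erase hD
        exact ⟨hRA _ this, hsz _ (hrow _ this)⟩) hinj' hcard'
  have hrr : r' = r := (h2 C (mem_insert_self _ _)).symm.trans hCr
  have : C = C' := by
    ext j
    have a := h3 j
    have b := hcol j
    rw [← insert_erase hC'] at b
    rw [filter_insert] at a b
    have n1 : C ∉ (R.erase C').filter fun D => j ∈ D := fun h => hCe (mem_filter.1 h).1
    have n2 : C' ∉ (R.erase C').filter fun D => j ∈ D := fun h => notMem_erase _ _ (mem_filter.1 h).1
    by_cases c1 : j ∈ C <;> by_cases c2 : j ∈ C' <;>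
      simp only [c1, c2, if_true, if_false, card_insert_of_notMem n1, card_insert_of_notMem n2] at a b ⊢ <;> omega
  exact hCR (this ▸ hC')

theorem lh_neighbor (A Bk : Set (Finset E)) (hodd : ∀ C ∈ A, ∀ B ∈ Bk, Odd (C ∩ B).card)
    (y : E → ℚ) (hQ : lhQ A y)
    (huniq : ∀ y', lhQ A y' → lhVtx A y' → y' ≠ y → lhDom Bk y')
    (R : Finset (Finset E)) (r : ℕ) (hRA : ∀ C ∈ R, C ∈ A)
    (hsimp : ∀ C ∈ A, C.card = r → C ∈ R)
    (hinj : ∀ d : E → ℚ, (∀ C ∈ R, ∑ f ∈ C, d f = 0) → d = 0) (hcard : R.card = Fintype.card E)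
    (hr : 2 ≤ r) (hrow : ∀ C ∈ R, C.card = r) (hcol : ∀ j, (R.filter fun C' => j ∈ C').card = r)
    (hy : ∀ f, y f = 1 / r) (C : Finset E) (hC : C ∈ R) :
    ∃ b ∈ Bk, (∀ C' ∈ R, C' ≠ C → (C' ∩ b).card = 1) ∧ 2 ≤ (C ∩ b).card := by
  classical
  have hr0 : (r : ℚ) ≠ 0 := by positivity
  have hr1 : (0:ℚ) < r := by positivity
  have hsz : ∀ C : Finset E, C.card = r → ∑ f ∈ C, y f = 1 := by
    intro C hC; simp [hy, hC, hr0]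
  obtain ⟨d, hd⟩ := lh_dual R hinj hcard (fun C'' => if C'' = C then 1 else 0)
  have hneg : ∃ f, d f < 0 := by
    by_contra hh
    push Not at hh
    have : d = 0 := by
      funext f
      have hlt : 1 < (R.filter fun C' => f ∈ C').card := by rw [hcol f]; omega
      obtain ⟨D, hD, hDne⟩ := exists_mem_ne hlt C
      obtain ⟨hD1, hD2⟩ := mem_filter.1 hD
      have h1 := hd D hD1
      rw [if_neg hDne] at h1
      exact (sum_eq_zero_iff_of_nonneg fun g _ => hh g).1 h1 f hD2
    have h1 := hd C hC
    simp [this] at h1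
  obtain ⟨f0, hf0⟩ := hneg
  obtain ⟨t, ht, hfeas, k, hk1, hk2⟩ := lh_ray (lhG A) (lhB A) y d ((lhQ_iff A y).1 hQ) (by
    rintro (f | D) hk
    · simp only [lhG_inl, lhB_inl, hy f] at hk
      exact absurd hk (by positivity)
    · simp only [lhG_inr, lhB_inr] at hk ⊢
      have hDr : D.1.card = r := by
        simp only [hy, sum_const, nsmul_eq_mul] at hk
        field_simp at hk
        exact_mod_cast hk
      rw [hd _ (hsimp _ D.2 hDr)]
      positivity) ⟨Sum.inl f0, by simpa using hf0⟩
  set y' := y + t • d with hy'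
  have hsum' : ∀ D ∈ R, ∑ f ∈ D, y' f = 1 + t * (if D = C then 1 else 0) := by
    intro D hD
    simp only [hy', Pi.add_apply, Pi.smul_apply, smul_eq_mul]
    rw [sum_add_distrib, ← mul_sum, hsz _ (hrow _ hD), hd _ hD]
  have hQ' : lhQ A y' := (lhQ_iff A y').2 hfeas
  have hV' : lhVtx A y' := by
    intro w hw
    have h1 := hinj (fun f => w f - (∑ g ∈ C, w g) * d f) (fun D hD => by
      rw [sum_sub_distrib, ← mul_sum, hd D hD]
      by_cases e : D = C
      · simp [e]
      · have := hw (Sum.inr ⟨D, hRA D hD⟩) (by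
          simp only [lhG_inr, lhB_inr]; rw [hsum' D hD]; simp [e])
        simp only [lhG_inr] at this
        rw [this]; simp [e])
    have h2 : w = (∑ g ∈ C, w g) • d := by
      funext f; have := congrFun h1 f; simp only [Pi.zero_apply] at this
      simp only [Pi.smul_apply, smul_eq_mul]; linarith
    have h3 := hw k hk1
    rw [h2, map_smul, smul_eq_mul] at h3
    have h4 := (mul_eq_zero.1 h3).resolve_right hk2.ne
    rw [h2, h4, zero_smul]
  have hne : y' ≠ y := by
    intro e
    have := hsum' C hC
    rw [e, hsz _ (hrow _ hC)] at this
    simp at this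
    exact ht.ne' this
  obtain ⟨b, hb, hyb⟩ := lh_vtx_dom A Bk hodd y' (huniq y' hQ' hV' hne) hV'
  have hintd : ∀ D ∈ R, ((D ∩ b).card : ℚ) = 1 + t * (if D = C then 1 else 0) := by
    intro D hD
    rw [← hsum' D hD, sum_congr rfl fun f _ => hyb f]
    simp [Finset.sum_ite_mem]
  refine ⟨b, hb, fun D hD hDC => ?_, ?_⟩
  · have := hintd D hD
    rw [if_neg hDC] at this
    have : ((D ∩ b).card : ℚ) = 1 := by linarith
    exact_mod_cast this
  · have := hintd C hC
    rw [if_pos rfl] at this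
    have : (1:ℚ) < (C ∩ b).card := by linarith
    exact_mod_cast this

end Lehman

set_option linter.unusedSectionVars false

section Lehman
variable {E : Type} [Fintype E] [DecidableEq E]

/-- the configuration around one element of a minimally nonideal pair -/
def lhConf (A Bk : Set (Finset E)) (e : E) (C b : Fin 3 → Finset E) : Prop :=
  (∀ i, C i ∈ A) ∧ (∀ i, b i ∈ Bk) ∧ (∀ i, e ∈ C i) ∧ (∀ i, e ∈ b i) ∧
  (∀ i k, i ≠ k → ∀ f, f ∈ C i → f ∈ C k → f = e) ∧
  (∀ i k, i ≠ k → ∀ f, f ∈ b i → f ∈ b k → f = e) ∧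
  (∀ i k, i ≠ k → ∀ f, f ∈ C i → f ∈ b k → f = e) ∧
  (∀ i, ∃ f, f ≠ e ∧ f ∈ C i ∧ f ∈ b i) ∧ (∀ i, 3 ≤ (C i).card) ∧
  (∀ i k, i ≠ k → ∀ D ∈ A, D ⊆ C i ∪ C k → D = C i ∨ D = C k) ∧
  (∀ i k, i ≠ k → ∀ D ∈ Bk, D ⊆ b i ∪ b k → D = b i ∨ D = b k)

theorem lh_card_sum (D S : Finset E) : ((D ∩ S).card : ℤ) = ∑ x ∈ S, if x ∈ D then 1 else 0 := by
  rw [inter_comm]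
  simp [Finset.sum_ite_mem]

/-- exchanging inside the union of two sets meeting in at most ... -/
theorem lh_exchange (C₁ C₂ D : Finset E) (m : ℕ) (h : D ⊆ C₁ ∪ C₂)
    (h1 : C₁.card = m) (h2 : C₂.card = m) (h3 : m ≤ D.card)
    (h4 : m ≤ (symmDiff (symmDiff C₁ C₂) D).card) :
    D.card = m ∧ (symmDiff (symmDiff C₁ C₂) D).card = m ∧
    ∀ S, (D ∩ S).card + (symmDiff (symmDiff C₁ C₂) D ∩ S).card = (C₁ ∩ S).card + (C₂ ∩ S).card := by
  set D' := symmDiff (symmDiff C₁ C₂) D with hD'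
  have hpt : ∀ x : E, ((if x ∈ D then 1 else 0) + (if x ∈ D' then 1 else 0) : ℤ) ≤
      (if x ∈ C₁ then 1 else 0) + (if x ∈ C₂ then 1 else 0) := by
    intro x
    have hx : x ∈ D → x ∈ C₁ ∨ x ∈ C₂ := fun hx => mem_union.1 (h hx)
    by_cases a : x ∈ C₁ <;> by_cases b : x ∈ C₂ <;> by_cases c : x ∈ D <;>
      simp_all [mem_symmDiff]
  have hall : ∀ S : Finset E, ((D ∩ S).card + (D' ∩ S).card : ℤ) =
      ∑ x ∈ S, ((if x ∈ D then 1 else 0) + (if x ∈ D' then 1 else 0) : ℤ) := by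
    intro S; rw [sum_add_distrib, lh_card_sum, lh_card_sum]
  have hall' : ∀ S : Finset E, ((C₁ ∩ S).card + (C₂ ∩ S).card : ℤ) =
      ∑ x ∈ S, ((if x ∈ C₁ then 1 else 0) + (if x ∈ C₂ then 1 else 0) : ℤ) := by
    intro S; rw [sum_add_distrib, lh_card_sum, lh_card_sum]
  have hu := hall univ
  have hu' := hall' univ
  have hle := sum_le_sum (s := univ) (fun x _ => hpt x)
  rw [← hu, ← hu'] at hle
  simp only [inter_univ] at hle hu hu'
  have hle' : D.card + D'.card ≤ C₁.card + C₂.card := by exact_mod_cast hle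
  refine ⟨by omega, by omega, fun S => ?_⟩
  have heq := (sum_eq_sum_iff_of_le (fun x _ => hpt x)).1 (by
    rw [← hu, ← hu']
    have : D.card + D'.card = C₁.card + C₂.card := by omega
    exact_mod_cast this)
  have h5 := hall S
  rw [sum_congr rfl (fun x _ => heq x (mem_univ x)), ← hall' S] at h5
  exact_mod_cast h5

theorem lh_structure (A Bk : Set (Finset E)) (hodd : ∀ C ∈ A, ∀ B ∈ Bk, Odd (C ∩ B).card)
    (hA3 : ∀ C₁ ∈ A, ∀ C₂ ∈ A, ∀ C₃ ∈ A, symmDiff (symmDiff C₁ C₂) C₃ ∈ A)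
    (hB3 : ∀ C₁ ∈ Bk, ∀ C₂ ∈ Bk, ∀ C₃ ∈ Bk, symmDiff (symmDiff C₁ C₂) C₃ ∈ Bk)
    (hBne : Bk.Nonempty)
    (hdel : ∀ j, lhDel A Bk j) (hcon : ∀ j, lhCon A Bk j)
    (h : ∃ y, lhQ A y ∧ ¬ lhDom Bk y) : ∃ e C b, lhConf A Bk e C b := by
  classical
  obtain ⟨y, hQ, hD, hV⟩ := lh_exists_vertex A Bk h
  obtain ⟨R, r, hRA, hinj, hcard, hr, hrow, hcol, hy⟩ :=
    lh_vertex_unif A Bk hodd hA3 hBne hdel hcon y hQ hD hV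
  have hr0 : (r : ℚ) ≠ 0 := by positivity
  have hr1 : (0:ℚ) < r := by positivity
  have hminA : ∀ (y' : E → ℚ) (r' : ℕ), 2 ≤ r' → lhQ A y' → (∀ f, y' f = 1 / r') → ∀ C ∈ A, r' ≤ C.card := by
    intro y' r' hr' hq hh C hC
    have := hq.2 C hC
    simp only [hh, sum_const, nsmul_eq_mul] at this
    have hp : (0:ℚ) < r' := by positivity
    rw [mul_one_div, le_div_iff₀ hp] at this
    have : (r':ℚ) ≤ C.card := by linarith
    exact_mod_cast this
  have hmin := hminA y r hr hQ hy
  have hEne : Nonempty E := by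
    by_contra hne
    rw [not_nonempty_iff] at hne
    obtain ⟨B, hB⟩ := hBne
    exact hD (lhDom_single hB fun f => (hne.false f).elim)
  obtain ⟨e0⟩ := hEne
  have hcolne : ∀ (R : Finset (Finset E)) (r : ℕ), 2 ≤ r → (∀ j, (R.filter fun C' => j ∈ C').card = r) → ∃ C, C ∈ R := by
    intro R r hr hcol
    have : 0 < (R.filter fun C' => e0 ∈ C').card := by rw [hcol]; omega
    obtain ⟨C, hC⟩ := card_pos.1 this
    exact ⟨C, (mem_filter.1 hC).1⟩
  have huniq : ∀ y', lhQ A y' → lhVtx A y' → y' ≠ y → lhDom Bk y' := by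
    intro y' hQ' hV' hne
    by_contra hD'
    obtain ⟨R', r', hRA', hinj', hcard', hr', hrow', hcol', hy'⟩ :=
      lh_vertex_unif A Bk hodd hA3 hBne hdel hcon y' hQ' hD' hV'
    have hmin' := hminA y' r' hr' hQ' hy'
    obtain ⟨C, hC⟩ := hcolne R r hr hcol
    obtain ⟨C', hC'⟩ := hcolne R' r' hr' hcol'
    have a := hmin' C (hRA C hC)
    have b := hmin C' (hRA' C' hC')
    rw [hrow C hC] at a
    rw [hrow' C' hC'] at b
    have : r = r' := le_antisymm b a
    apply hne
    funext f
    rw [hy, hy', this]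
  have hsimp := lh_simple A Bk hodd hA3 hBne hdel y hQ hD R r hRA hinj hcard hr hrow hcol hy
  have hnb := lh_neighbor A Bk hodd y hQ huniq R r hRA hsimp hinj hcard hr hrow hcol hy
  choose! b hbB hb1 hb2 using hnb
  -- counting
  have hcnt : ∀ B : Finset E, ∑ C ∈ R, (C ∩ B).card = r * B.card := by
    intro B
    have : ∑ C ∈ R, (C ∩ B).card = ∑ f ∈ B, (R.filter fun C' => f ∈ C').card := by
      simp only [card_filter]
      rw [sum_comm]
      refine sum_congr rfl fun C _ => ?_
      rw [inter_comm]; simp [Finset.sum_ite_mem]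
    rw [this]; simp [hcol, mul_comm]
  set n := Fintype.card E with hn
  have hcb : ∀ C ∈ R, r * (b C).card + 1 = n + (C ∩ b C).card := by
    intro C hC
    rw [← hcnt, ← add_sum_erase R _ hC, sum_congr rfl (fun D hD => hb1 C hC D (mem_of_mem_erase hD) (ne_of_mem_erase hD)),
      sum_const, card_erase_of_mem hC, hcard]
    have : 0 < R.card := card_pos.2 ⟨C, hC⟩
    simp only [smul_eq_mul, mul_one]
    omega
  have hmr : ∀ C ∈ R, (C ∩ b C).card ≤ r := fun C hC => (card_le_card inter_subset_left).trans (hrow C hC).le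
  obtain ⟨C0, hC0⟩ := hcolne R r hr hcol
  obtain ⟨m, hm⟩ : ∃ m, m = (C0 ∩ b C0).card := ⟨_, rfl⟩
  obtain ⟨s, hs⟩ : ∃ s, s = (b C0).card := ⟨_, rfl⟩
  have hcb0 := hcb C0 hC0
  rw [← hm, ← hs] at hcb0
  have hsb : ∀ C ∈ R, (b C).card = s := by
    intro C hC
    have h1 := hcb C hC
    have h2 := hcb0
    have h3 := hb2 C hC
    have h4 := hb2 C0 hC0
    have h5 := hmr C hC
    have h6 := hmr C0 hC0
    rcases lt_trichotomy (b C).card s with h | h | h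
    · have : r * ((b C).card + 1) ≤ r * s := Nat.mul_le_mul_left _ h
      rw [mul_add] at this; omega
    · exact h
    · have : r * (s + 1) ≤ r * (b C).card := Nat.mul_le_mul_left _ h
      rw [mul_add] at this; omega
  have hmb : ∀ C ∈ R, (C ∩ b C).card = m := by
    intro C hC
    have h1 := hcb C hC
    have h2 := hcb0
    rw [hsb C hC] at h1
    omega
  have hm3 : 3 ≤ m := by
    have h1 := hb2 C0 hC0
    have h2 := hodd C0 (hRA _ hC0) (b C0) (hbB _ hC0)
    obtain ⟨k, hk⟩ := h2
    omega
  have hr3 : 3 ≤ r := hm3.trans (hm ▸ hmr C0 hC0)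
  have hintd : ∀ C ∈ R, ∀ D ∈ R, ((D ∩ b C).card : ℚ) = 1 + (m - 1) * if D = C then 1 else 0 := by
    intro C hC D hD
    by_cases e : D = C
    · rw [e, hmb C hC]; simp
    · rw [hb1 C hC D hD e]; simp [e]
  -- double family identity
  have hfam : ∀ f e, ((R.filter fun C => f ∈ C ∧ e ∈ b C).card : ℚ) = 1 + (m - 1) * if e = f then 1 else 0 := by
    intro f
    have := hinj (fun e => ((R.filter fun C => f ∈ C ∧ e ∈ b C).card : ℚ) - (1 + (m - 1) * if e = f then 1 else 0)) (by
      intro D hD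
      have e1 : ∑ e ∈ D, ((R.filter fun C => f ∈ C ∧ e ∈ b C).card : ℚ) = ∑ C ∈ R.filter (fun C => f ∈ C), ((D ∩ b C).card : ℚ) := by
        have : ∑ e ∈ D, (R.filter fun C => f ∈ C ∧ e ∈ b C).card = ∑ C ∈ R.filter (fun C => f ∈ C), (D ∩ b C).card := by
          simp only [← filter_filter, card_filter _ (R.filter _)]
          rw [sum_comm]
          refine sum_congr rfl fun C _ => ?_
          simp [Finset.sum_ite_mem]
        exact_mod_cast this
      rw [sum_sub_distrib, e1, sum_congr rfl (fun C hC => hintd C (mem_filter.1 hC).1 D hD), sum_add_distrib, sum_add_distrib,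
        ← mul_sum, ← mul_sum]
      simp [hcol, hrow D hD, hD])
    intro e; have := congrFun this e; simp only [Pi.zero_apply] at this; linarith
  -- three indices
  have hc3 : 2 < (R.filter fun C => e0 ∈ C ∧ e0 ∈ b C).card := by
    have := hfam e0 e0
    simp only [if_true, mul_one] at this
    have : ((R.filter fun C => e0 ∈ C ∧ e0 ∈ b C).card : ℚ) = m := by rw [this]; ring
    have : (R.filter fun C => e0 ∈ C ∧ e0 ∈ b C).card = m := by exact_mod_cast this
    omega
  obtain ⟨T, hTsub, hTcard⟩ := exists_subset_card_eq (show 3 ≤ _ from hc3)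
  let c : Fin 3 → Finset E := fun i => (T.equivFin.symm (Fin.cast hTcard.symm i)).1
  have hcT : ∀ i, c i ∈ T := fun i => (T.equivFin.symm (Fin.cast hTcard.symm i)).2
  have hcinj : ∀ i k, i ≠ k → c i ≠ c k := by
    intro i k hik heq
    apply hik
    have := T.equivFin.symm.injective (Subtype.ext heq)
    exact Fin.cast_injective _ this
  have hcR : ∀ i, c i ∈ R := fun i => (mem_filter.1 (hTsub (hcT i))).1
  have hec : ∀ i, e0 ∈ c i := fun i => (mem_filter.1 (hTsub (hcT i))).2.1
  have heb : ∀ i, e0 ∈ b (c i) := fun i => (mem_filter.1 (hTsub (hcT i))).2.2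
  have hone : ∀ f e, e ≠ f → ∀ C ∈ R, ∀ D ∈ R, f ∈ C → e ∈ b C → f ∈ D → e ∈ b D → C = D := by
    intro f e hne C hC D hD h1 h2 h3 h4
    have := hfam f e
    rw [if_neg hne, mul_zero, add_zero] at this
    have : (R.filter fun C => f ∈ C ∧ e ∈ b C).card = 1 := by exact_mod_cast this
    exact card_le_one.1 this.le C (by simp [hC, h1, h2]) D (by simp [hD, h3, h4])
  -- minimum size of B
  have hBmin : ∀ B ∈ Bk, s ≤ B.card := by
    intro B hB
    have hge : ∀ C ∈ R, 1 ≤ (C ∩ B).card := fun C hC => (hodd C (hRA C hC) B hB).pos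
    have h1 : R.card * 1 ≤ ∑ C ∈ R, (C ∩ B).card := by
      simpa using card_nsmul_le_sum R _ 1 hge
    rw [hcnt, hcard, mul_one] at h1
    have h2 : n ≠ r * B.card := by
      intro he
      have h3 : ∀ C ∈ R, 1 = (C ∩ B).card := (sum_eq_sum_iff_of_le hge).1 (by
        rw [hcnt, ← he]; simp [hcard])
      have h4 := hinj (fun f => y f - if f ∈ B then 1 else 0) (by
        intro C hC
        rw [sum_sub_distrib]
        simp only [Finset.sum_ite_mem, sum_const, nsmul_eq_mul, ← h3 C hC, hy, hrow C hC]
        field_simp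
        simp)
      have h5 := congrFun h4 e0
      simp only [hy, Pi.zero_apply] at h5
      have h6 : (2:ℚ) ≤ r := by exact_mod_cast hr
      have h7 : 1 / (r:ℚ) < 1 := by rw [div_lt_one hr1]; linarith
      have h8 : 0 < 1 / (r:ℚ) := by positivity
      split_ifs at h5 <;> linarith
    have h4 := hcb0
    have h5 := hmr C0 hC0
    by_contra hlt
    push Not at hlt
    have : r * (B.card + 1) ≤ r * s := Nat.mul_le_mul_left _ hlt
    rw [mul_add] at this
    omega
  have hBmem : ∀ B ∈ Bk, B.card = s → ∃ C ∈ R, B = b C := by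
    intro B hB hBs
    have hm1 : (m:ℚ) - 1 ≠ 0 := by
      have : (3:ℚ) ≤ m := by exact_mod_cast hm3
      linarith
    have hge : ∀ C ∈ R, 1 ≤ (C ∩ B).card := fun C hC => (hodd C (hRA C hC) B hB).pos
    have hz : ∑ C ∈ R, (((C ∩ B).card : ℚ) - 1) = m - 1 := by
      have h1 := hcnt B
      have h4 := hcb0
      rw [hBs] at h1
      rw [sum_sub_distrib, ← Nat.cast_sum, h1, sum_const, hcard]
      have : ((r * s : ℕ) : ℚ) + 1 = n + m := by exact_mod_cast h4
      rw [nsmul_eq_mul, mul_one]; linarith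
    have h1 := hinj (fun f => (m - 1) * (if f ∈ B then 1 else 0) - ∑ C ∈ R, (((C ∩ B).card : ℚ) - 1) * (if f ∈ b C then 1 else 0)) (by
      intro D hD
      rw [sum_sub_distrib, sum_comm, ← mul_sum]
      have : ∀ C ∈ R, ∑ f ∈ D, (((C ∩ B).card : ℚ) - 1) * (if f ∈ b C then 1 else 0) = (((C ∩ B).card : ℚ) - 1) + (m-1) * ((((C ∩ B).card : ℚ) - 1) * if D = C then 1 else 0) := by
        intro C hC
        rw [← mul_sum]
        have : ∑ f ∈ D, (if f ∈ b C then (1:ℚ) else 0) = (D ∩ b C).card := by simp [Finset.sum_ite_mem]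
        rw [this, hintd C hC D hD]; ring
      rw [sum_congr rfl this, sum_add_distrib, hz, ← mul_sum]
      simp [Finset.sum_ite_mem, hD]
      ring)
    obtain ⟨C, hC, hCz⟩ : ∃ C ∈ R, (0:ℚ) < ((C ∩ B).card : ℚ) - 1 := by
      by_contra hh
      push Not at hh
      have := sum_nonpos hh
      rw [hz] at this
      have : (3:ℚ) ≤ m := by exact_mod_cast hm3
      linarith
    refine ⟨C, hC, (eq_of_subset_of_card_le ?_ ?_).symm⟩
    · intro f hf
      by_contra hfB
      have h2 := congrFun h1 f
      simp only [hfB, if_false, mul_zero, zero_sub, Pi.zero_apply, neg_eq_zero] at h2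
      have h3 := (sum_eq_zero_iff_of_nonneg (fun D hD => mul_nonneg (by
        have : (1:ℚ) ≤ (D ∩ B).card := by exact_mod_cast hge D hD
        linarith) (by positivity : (0:ℚ) ≤ if f ∈ b D then 1 else 0))).1 h2 C hC
      simp only [hf, if_true, mul_one] at h3
      linarith
    · rw [hBs, hsb C hC]
  refine ⟨e0, c, fun i => b (c i), fun i => hRA _ (hcR i), fun i => hbB _ (hcR i), hec, heb, ?_, ?_, ?_, ?_, ?_, ?_, ?_⟩
  · intro i k hik f hfi hfk
    by_contra hne
    exact hcinj i k hik (hone f e0 (Ne.symm hne) _ (hcR i) _ (hcR k) hfi (heb i) hfk (heb k))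
  · intro i k hik f hfi hfk
    by_contra hne
    exact hcinj i k hik (hone e0 f hne _ (hcR i) _ (hcR k) (hec i) hfi (hec k) hfk)
  · intro i k hik f hfi hfk
    have := hb1 (c k) (hcR k) (c i) (hcR i) (hcinj i k hik)
    exact card_le_one.1 this.le f (mem_inter.2 ⟨hfi, hfk⟩) e0 (mem_inter.2 ⟨hec i, heb k⟩)
  · intro i
    have : 1 < (c i ∩ b (c i)).card := by rw [hmb _ (hcR i)]; omega
    obtain ⟨f, hf, hne⟩ := exists_mem_ne this e0
    exact ⟨f, hne, mem_inter.1 hf⟩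
  · intro i; rw [hrow _ (hcR i)]; exact hr3
  · intro i k hik D hDA hDs
    have hD'A := hA3 _ (hRA _ (hcR i)) _ (hRA _ (hcR k)) D hDA
    obtain ⟨e1, e2, e3⟩ := lh_exchange (c i) (c k) D r hDs (hrow _ (hcR i)) (hrow _ (hcR k)) (hmin D hDA) (hmin _ hD'A)
    have hDR := hsimp D hDA e1
    have hD'R := hsimp _ hD'A e2
    have h5 := e3 (b (c i))
    rw [hmb _ (hcR i), hb1 _ (hcR i) _ (hcR k) (hcinj i k hik).symm] at h5
    by_cases hDi : D = c i
    · exact Or.inl hDi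
    · by_cases hDi' : symmDiff (symmDiff (c i) (c k)) D = c i
      · right
        rw [symmDiff_assoc] at hDi'
        have : symmDiff (c k) D = ∅ := by simpa using hDi'
        exact (symmDiff_eq_bot.1 this).symm
      · rw [hb1 _ (hcR i) _ hDR hDi, hb1 _ (hcR i) _ hD'R hDi'] at h5
        omega
  · intro i k hik D hDB hDs
    have hD'B := hB3 _ (hbB _ (hcR i)) _ (hbB _ (hcR k)) D hDB
    obtain ⟨e1, e2, e3⟩ := lh_exchange (b (c i)) (b (c k)) D s hDs (hsb _ (hcR i)) (hsb _ (hcR k)) (hBmin D hDB) (hBmin _ hD'B)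
    obtain ⟨X, hX, hXe⟩ := hBmem D hDB e1
    obtain ⟨X', hX', hXe'⟩ := hBmem _ hD'B e2
    have h5 := e3 (c i)
    rw [hXe', hXe, inter_comm _ (c i), inter_comm _ (c i), inter_comm _ (c i), inter_comm _ (c i), hmb _ (hcR i),
      hb1 _ (hcR k) _ (hcR i) (hcinj i k hik)] at h5
    by_cases hDi : c i = X
    · left; rw [hXe]; simp only [hDi]
    · by_cases hDi' : c i = X'
      · right
        have h6 : symmDiff (symmDiff (b (c i)) (b (c k))) D = b (c i) := by rw [hXe', hDi']
        rw [symmDiff_assoc] at h6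
        have : symmDiff (b (c k)) D = ∅ := by simpa using h6
        exact (symmDiff_eq_bot.1 this).symm
      · rw [hb1 _ hX _ (hcR i) hDi, hb1 _ hX' _ (hcR i) hDi'] at h5
        omega

end Lehman

set_option linter.unusedSectionVars false

section Conn
variable {W : Type}

def cnConn (r : W → W → Prop) (X : Set W) : Prop :=
  X.Nonempty ∧ ∀ P ⊆ X, P.Nonempty → (X \ P).Nonempty → ∃ x ∈ P, ∃ y ∈ X \ P, r x y

def cnComp (r : W → W → Prop) (X I : Set W) : Set W :=
  {x | ∃ Y, cnConn r Y ∧ I ⊆ Y ∧ Y ⊆ X ∧ x ∈ Y}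

theorem cnConn_singleton (r : W → W → Prop) (x : W) : cnConn r {x} := by
  refine ⟨⟨x, rfl⟩, fun P hP hne ⟨y, hy, hyP⟩ => ?_⟩
  obtain ⟨p, hp⟩ := hne
  have h1 : p = x := hP hp
  have h2 : y = x := hy
  exact absurd (h2 ▸ h1 ▸ hp) hyP

theorem cnConn_union {r : W → W → Prop} (hs : ∀ x y, r x y → r y x) {X Y : Set W} (hX : cnConn r X)
    (hY : cnConn r Y) (h : ∃ x ∈ X, ∃ y ∈ Y, x = y ∨ r x y) : cnConn r (X ∪ Y) := by
  refine ⟨hX.1.mono Set.subset_union_left, fun P hP hne hne' => ?_⟩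
  by_cases h1 : (X ∩ P).Nonempty ∧ (X \ P).Nonempty
  · obtain ⟨x, hx, y, hy, hr⟩ := hX.2 (X ∩ P) Set.inter_subset_left h1.1 (by
      obtain ⟨z, hz⟩ := h1.2; exact ⟨z, hz.1, fun hh => hz.2 hh.2⟩)
    exact ⟨x, hx.2, y, ⟨Or.inl hy.1, fun hh => hy.2 ⟨hy.1, hh⟩⟩, hr⟩
  by_cases h2 : (Y ∩ P).Nonempty ∧ (Y \ P).Nonempty
  · obtain ⟨x, hx, y, hy, hr⟩ := hY.2 (Y ∩ P) Set.inter_subset_left h2.1 (by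
      obtain ⟨z, hz⟩ := h2.2; exact ⟨z, hz.1, fun hh => hz.2 hh.2⟩)
    exact ⟨x, hx.2, y, ⟨Or.inr hy.1, fun hh => hy.2 ⟨hy.1, hh⟩⟩, hr⟩
  have h1' : (∀ x ∈ X, x ∉ P) ∨ (∀ x ∈ X, x ∈ P) := by
    by_contra hh; push Not at hh
    obtain ⟨⟨x, a, b⟩, ⟨y, c, d⟩⟩ := hh
    exact h1 ⟨⟨x, a, b⟩, ⟨y, c, d⟩⟩
  have h2' : (∀ x ∈ Y, x ∉ P) ∨ (∀ x ∈ Y, x ∈ P) := by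
    by_contra hh; push Not at hh
    obtain ⟨⟨x, a, b⟩, ⟨y, c, d⟩⟩ := hh
    exact h2 ⟨⟨x, a, b⟩, ⟨y, c, d⟩⟩
  obtain ⟨x, hx, y, hy, hxy⟩ := h
  obtain ⟨p, hp⟩ := hne
  obtain ⟨q, hq, hqP⟩ := hne'
  rcases h1' with h1' | h1' <;> rcases h2' with h2' | h2'
  · rcases hP hp with h | h
    · exact absurd hp (h1' p h)
    · exact absurd hp (h2' p h)
  · refine ⟨y, h2' y hy, x, ⟨Or.inl hx, h1' x hx⟩, ?_⟩
    rcases hxy with rfl | hxy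
    · exact absurd (h2' x hy) (h1' x hx)
    · exact hs _ _ hxy
  · refine ⟨x, h1' x hx, y, ⟨Or.inr hy, h2' y hy⟩, ?_⟩
    rcases hxy with rfl | hxy
    · exact absurd (h1' x hx) (h2' x hy)
    · exact hxy
  · rcases hq with h | h
    · exact absurd (h1' q h) hqP
    · exact absurd (h2' q h) hqP

theorem cnComp_sub (r : W → W → Prop) (X I : Set W) : cnComp r X I ⊆ X :=
  fun _ ⟨_, _, _, h, hx⟩ => h hx

theorem cnComp_self {r : W → W → Prop} {X I : Set W} (hI : cnConn r I) (h : I ⊆ X) : I ⊆ cnComp r X I :=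
  fun _ hx => ⟨I, hI, subset_rfl, h, hx⟩

theorem cnComp_conn {r : W → W → Prop} (hs : ∀ x y, r x y → r y x) {X I : Set W} (hI : cnConn r I) (h : I ⊆ X) :
    cnConn r (cnComp r X I) := by
  refine ⟨hI.1.mono (cnComp_self hI h), ?_⟩
  rintro P hP ⟨p, hp⟩ ⟨q, hq, hqP⟩
  obtain ⟨Y, hY1, hY2, hY3, hY4⟩ := hP hp
  obtain ⟨Z, hZ1, hZ2, hZ3, hZ4⟩ := hq
  obtain ⟨i, hi⟩ := hI.1
  have hu := cnConn_union hs hY1 hZ1 ⟨i, hY2 hi, i, hZ2 hi, Or.inl rfl⟩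
  have hsub : Y ∪ Z ⊆ cnComp r X I := by
    rintro z (hz | hz)
    · exact ⟨Y, hY1, hY2, hY3, hz⟩
    · exact ⟨Z, hZ1, hZ2, hZ3, hz⟩
  obtain ⟨x, hx, y, hy, hr⟩ := hu.2 (P ∩ (Y ∪ Z)) Set.inter_subset_right ⟨p, hp, Or.inl hY4⟩
    ⟨q, Or.inr hZ4, fun hh => hqP hh.1⟩
  exact ⟨x, hx.1, y, ⟨hsub hy.1, fun hh => hy.2 ⟨hh, hy.1⟩⟩, hr⟩

theorem cnComp_max {r : W → W → Prop} (hs : ∀ x y, r x y → r y x) {X I K : Set W} (hK : cnConn r K) (hKX : K ⊆ X)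
    (h : ∃ x ∈ cnComp r X I, ∃ y ∈ K, x = y ∨ r x y) : K ⊆ cnComp r X I := by
  obtain ⟨x, ⟨Y, hY1, hY2, hY3, hY4⟩, y, hy, hr⟩ := h
  intro z hz
  exact ⟨Y ∪ K, cnConn_union hs hY1 hK ⟨x, hY4, y, hy, hr⟩, hY2.trans Set.subset_union_left,
    Set.union_subset hY3 hKX, Or.inr hz⟩

theorem cnComp_max' {r : W → W → Prop} (hs : ∀ x y, r x y → r y x) {X I : Set W} {x y : W}
    (hx : x ∈ cnComp r X I) (hy : y ∈ X) (h : r x y) : y ∈ cnComp r X I :=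
  cnComp_max hs (cnConn_singleton r y) (by simpa using hy) ⟨x, hx, y, rfl, Or.inr h⟩ rfl

/-- removing a component of the complement of a connected set leaves a connected set -/
theorem cnConn_cut {r : W → W → Prop} (hs : ∀ x y, r x y → r y x) {R K I : Set W} (hR : cnConn r R)
    (hK : cnConn r K) (hKR : K ⊆ R) : cnConn r (R \ cnComp r (R \ K) I) := by
  set X := cnComp r (R \ K) I with hX
  have hKX : K ⊆ R \ X := fun z hz => ⟨hKR hz, fun hh => (cnComp_sub _ _ _ hh).2 hz⟩
  -- pieces avoiding `K` are attached
  have key : ∀ P ⊆ R \ X, P.Nonempty → (∀ z ∈ K, z ∉ P) → ∃ x ∈ P, ∃ y ∈ (R \ X) \ P, r x y := by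
    intro P hP hne hKP
    obtain ⟨k, hk⟩ := hK.1
    obtain ⟨x, hx, y, hy, hr⟩ := hR.2 P (fun z hz => (hP hz).1) hne ⟨k, hKR hk, hKP k hk⟩
    refine ⟨x, hx, y, ⟨⟨hy.1, fun hyX => ?_⟩, hy.2⟩, hr⟩
    exact (hP hx).2 (cnComp_max' hs hyX ⟨(hP hx).1, fun hh => hKP x hh hx⟩ (hs _ _ hr))
  refine ⟨hK.1.mono hKX, fun P hP hne hne' => ?_⟩
  by_cases h1 : ∀ z ∈ K, z ∉ P
  · exact key P hP hne h1
  by_cases h2 : ∀ z ∈ K, z ∈ P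
  · obtain ⟨x, hx, y, hy, hr⟩ := key ((R \ X) \ P) Set.sdiff_subset hne' (fun z hz hh => hh.2 (h2 z hz))
    refine ⟨y, ?_, x, hx, hs _ _ hr⟩
    by_contra hyP
    exact hy.2 ⟨hy.1, hyP⟩
  push Not at h1 h2
  obtain ⟨z, hz, hzP⟩ := h1
  obtain ⟨w, hw, hwP⟩ := h2
  obtain ⟨x, hx, y, hy, hr⟩ := hK.2 (K ∩ P) Set.inter_subset_left ⟨z, hz, hzP⟩ ⟨w, hw, fun hh => hwP hh.2⟩
  exact ⟨x, hx.2, y, ⟨hKX hy.1, fun hh => hy.2 ⟨hy.1, hh⟩⟩, hr⟩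

theorem cn_split {r : W → W → Prop} (hs : ∀ x y, r x y → r y x) {I₁ I₂ Q : Set W} {w w' : W}
    (h1 : cnConn r I₁) (h2 : cnConn r I₂) (h12 : Disjoint I₁ I₂) (hQ1 : Disjoint Q I₁) (hQ2 : Disjoint Q I₂)
    (hR : cnConn r (I₁ ∪ Q ∪ I₂))
    (hmin : ∀ Q', Q' ⊂ Q → ¬ cnConn r (I₁ ∪ Q' ∪ I₂))
    (hw : w ∈ I₁ ∪ Q) (hw' : w' ∈ Q ∪ I₂) (hne : w ≠ w') :
    ∃ X₁ X₂, cnConn r X₁ ∧ cnConn r X₂ ∧ Disjoint X₁ X₂ ∧ I₁ ⊆ X₁ ∧ I₂ ⊆ X₂ ∧ X₁ ∪ X₂ = I₁ ∪ Q ∪ I₂ ∧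
      ((w ∈ X₁ ∧ w' ∈ X₂) ∨ (w' ∈ X₁ ∧ w ∈ X₂)) := by
  rw [Set.disjoint_left] at h12 hQ1 hQ2
  set R := I₁ ∪ Q ∪ I₂ with hRdef
  have hI1R : I₁ ⊆ R := fun z hz => Or.inl (Or.inl hz)
  have hI2R : I₂ ⊆ R := fun z hz => Or.inr hz
  have hQR : Q ⊆ R := fun z hz => Or.inl (Or.inr hz)
  -- the cut at a vertex of Q
  have hcut : ∀ q ∈ Q, I₁ ⊆ cnComp r (R \ {q}) I₁ ∧ I₂ ⊆ R \ cnComp r (R \ {q}) I₁ ∧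
      cnConn r (cnComp r (R \ {q}) I₁) ∧ cnConn r (R \ cnComp r (R \ {q}) I₁) := by
    intro q hq
    have a1 : I₁ ⊆ R \ {q} := fun z hz => ⟨hI1R hz, fun e => hQ1 hq ((show z = q from e) ▸ hz)⟩
    have a2 : I₂ ⊆ R \ {q} := fun z hz => ⟨hI2R hz, fun e => hQ2 hq ((show z = q from e) ▸ hz)⟩
    have c1 := cnComp_conn hs h1 a1
    refine ⟨cnComp_self h1 a1, fun z hz => ⟨hI2R hz, fun hzX => ?_⟩, c1, cnConn_cut hs hR (cnConn_singleton r q) (by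
      simpa using hQR hq)⟩
    have hsub := cnComp_max hs h2 a2 ⟨z, hzX, z, hz, Or.inl rfl⟩
    set X := cnComp r (R \ {q}) I₁ with hX
    refine hmin (Q ∩ X) ?_ ?_
    · refine ⟨Set.inter_subset_left, fun hh => ?_⟩
      exact (cnComp_sub _ _ _ (hh hq).2).2 rfl
    · have : I₁ ∪ (Q ∩ X) ∪ I₂ = X := by
        ext z
        constructor
        · rintro ((hz | hz) | hz)
          · exact cnComp_self h1 a1 hz
          · exact hz.2
          · exact hsub hz
        · intro hz
          rcases (cnComp_sub _ _ _ hz).1 with (h | h) | h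
          · exact Or.inl (Or.inl h)
          · exact Or.inl (Or.inr ⟨h, hz⟩)
          · exact Or.inr h
      rw [this]; exact c1
  have hfin : ∀ q ∈ Q, ∀ p ∈ cnComp r (R \ {q}) I₁, ∃ X₁ X₂, cnConn r X₁ ∧ cnConn r X₂ ∧ Disjoint X₁ X₂ ∧ I₁ ⊆ X₁ ∧ I₂ ⊆ X₂ ∧ X₁ ∪ X₂ = R ∧
      (p ∈ X₁ ∧ q ∈ X₂) := by
    intro q hq p hp
    obtain ⟨b1, b2, b3, b4⟩ := hcut q hq
    refine ⟨_, _, b3, b4, Set.disjoint_sdiff_right, b1, b2, ?_, hp, hQR hq, fun hh => (cnComp_sub _ _ _ hh).2 rfl⟩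
    exact Set.union_sdiff_cancel fun z hz => (cnComp_sub _ _ _ hz).1
  rcases hw' with hw' | hw'
  · by_cases hwX : w ∈ cnComp r (R \ {w'}) I₁
    · obtain ⟨X₁, X₂, c1, c2, c3, c4, c5, c6, c7⟩ := hfin w' hw' w hwX
      exact ⟨X₁, X₂, c1, c2, c3, c4, c5, c6, Or.inl c7⟩
    · obtain ⟨b1, b2, b3, b4⟩ := hcut w' hw'
      have hwQ : w ∈ Q := by
        rcases hw with h | h
        · exact absurd (b1 h) hwX
        · exact h
      set X := cnComp r (R \ {w'}) I₁ with hX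
      have hXR : X ⊆ R := fun z hz => (cnComp_sub _ _ _ hz).1
      obtain ⟨x, hx, y, hy, hr⟩ := hR.2 X hXR b3.1 b4.1
      have hyw : y = w' := by
        by_contra hne
        exact hy.2 (cnComp_max' hs hx ⟨hy.1, hne⟩ hr)
      have hX' : cnConn r (X ∪ {w'}) := cnConn_union hs b3 (cnConn_singleton r w') ⟨x, hx, w', rfl, Or.inr (hyw ▸ hr)⟩
      have : w' ∈ cnComp r (R \ {w}) I₁ := by
        refine ⟨X ∪ {w'}, hX', b1.trans Set.subset_union_left, ?_, Or.inr rfl⟩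
        rintro z (hz | hz)
        · exact ⟨hXR hz, fun e => hwX ((show z = w from e) ▸ hz)⟩
        · have e1 : z = w' := hz
          exact ⟨e1 ▸ hQR hw', fun e => hne ((show z = w from e) ▸ e1)⟩
      obtain ⟨X₁, X₂, c1, c2, c3, c4, c5, c6, c7⟩ := hfin w hwQ w' this
      exact ⟨X₁, X₂, c1, c2, c3, c4, c5, c6, Or.inr c7⟩
  · have a1 : I₁ ⊆ R \ I₂ := fun z hz => ⟨hI1R hz, h12 hz⟩
    have c1 := cnComp_conn hs h1 a1
    have hXR : cnComp r (R \ I₂) I₁ ⊆ R := fun z hz => (cnComp_sub _ _ _ hz).1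
    have hi2 : I₂ ⊆ R \ cnComp r (R \ I₂) I₁ := fun z hz => ⟨hI2R hz, fun hh => (cnComp_sub _ _ _ hh).2 hz⟩
    set X := cnComp r (R \ I₂) I₁ with hX
    have hQX : Q ⊆ X := by
      by_contra hQX
      obtain ⟨x, hx, y, hy, hr⟩ := hR.2 X hXR c1.1 (h2.1.mono hi2)
      have hyI : y ∈ I₂ := by
        by_contra hyI
        exact hy.2 (cnComp_max' hs hx ⟨hy.1, hyI⟩ hr)
      refine hmin (Q ∩ X) ⟨Set.inter_subset_left, fun hh => hQX fun z hz => (hh hz).2⟩ ?_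
      have : I₁ ∪ (Q ∩ X) ∪ I₂ = X ∪ I₂ := by
        ext z
        constructor
        · rintro ((hz | hz) | hz)
          · exact Or.inl (cnComp_self h1 a1 hz)
          · exact Or.inl hz.2
          · exact Or.inr hz
        · rintro (hz | hz)
          · rcases (cnComp_sub _ _ _ hz).1 with (h | h) | h
            · exact Or.inl (Or.inl h)
            · exact Or.inl (Or.inr ⟨h, hz⟩)
            · exact Or.inr h
          · exact Or.inr hz
      rw [this]
      exact cnConn_union hs c1 h2 ⟨x, hx, y, hyI, Or.inr hr⟩
    refine ⟨X, R \ X, c1, cnConn_cut hs hR h2 hI2R, Set.disjoint_sdiff_right, cnComp_self h1 a1, hi2,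
      Set.union_sdiff_cancel hXR, Or.inl ⟨?_, hi2 hw'⟩⟩
    rcases hw with h | h
    · exact cnComp_self h1 a1 h
    · exact hQX h

/-- rooted triangle minor -/
theorem cn_rooted [Finite W] {r : W → W → Prop} (hs : ∀ x y, r x y → r y x) {Z I₁ I₂ I₃ L₁ L₂ L₃ : Set W}
    (h1 : cnConn r I₁) (h2 : cnConn r I₂) (h3 : cnConn r I₃)
    (h12 : Disjoint I₁ I₂) (h13 : Disjoint I₁ I₃) (h23 : Disjoint I₂ I₃)
    (l1 : cnConn r L₁) (l2 : cnConn r L₂) (l3 : cnConn r L₃)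
    (d1 : Disjoint L₁ I₁) (d2 : Disjoint L₂ I₂) (d3 : Disjoint L₃ I₃)
    (hL : ∀ x, x ∈ L₁ → x ∈ L₂ → x ∈ L₃ → False)
    (m12 : (L₁ ∩ I₂).Nonempty) (m13 : (L₁ ∩ I₃).Nonempty) (m21 : (L₂ ∩ I₁).Nonempty) (m23 : (L₂ ∩ I₃).Nonempty)
    (m31 : (L₃ ∩ I₁).Nonempty) (m32 : (L₃ ∩ I₂).Nonempty)
    (z1 : I₁ ⊆ Z) (z2 : I₂ ⊆ Z) (z3 : I₃ ⊆ Z) (zl1 : L₁ ⊆ Z) (zl2 : L₂ ⊆ Z) (zl3 : L₃ ⊆ Z) :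
    ∃ X₁ X₂ X₃, cnConn r X₁ ∧ cnConn r X₂ ∧ cnConn r X₃ ∧ Disjoint X₁ X₂ ∧ Disjoint X₁ X₃ ∧ Disjoint X₂ X₃ ∧
      I₁ ⊆ X₁ ∧ I₂ ⊆ X₂ ∧ I₃ ⊆ X₃ ∧ X₁ ⊆ Z ∧ X₂ ⊆ Z ∧ X₃ ⊆ Z ∧
      (∃ x ∈ X₁, ∃ y ∈ X₂, r x y) ∧ (∃ x ∈ X₁, ∃ y ∈ X₃, r x y) ∧ (∃ x ∈ X₂, ∃ y ∈ X₃, r x y) := by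
  have hex : {Q : Set W | Q ⊆ L₃ \ (I₁ ∪ I₂) ∧ cnConn r (I₁ ∪ Q ∪ I₂)}.Nonempty := by
    refine ⟨L₃ \ (I₁ ∪ I₂), subset_rfl, ?_⟩
    have : I₁ ∪ (L₃ \ (I₁ ∪ I₂)) ∪ I₂ = (I₁ ∪ L₃) ∪ I₂ := by
      ext z; simp only [Set.mem_union, Set.mem_sdiff]; tauto
    rw [this]
    obtain ⟨p, hp⟩ := m31
    obtain ⟨q, hq⟩ := m32
    exact cnConn_union hs (cnConn_union hs h1 l3 ⟨p, hp.2, p, hp.1, Or.inl rfl⟩) h2 ⟨q, Or.inr hq.1, q, hq.2, Or.inl rfl⟩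
  obtain ⟨Q, ⟨hQL, hR⟩, hQmin⟩ := (wellFounded_lt (α := Set W)).has_min _ hex
  have hmin : ∀ Q', Q' ⊂ Q → ¬ cnConn r (I₁ ∪ Q' ∪ I₂) := fun Q' hQ' hc =>
    hQmin Q' ⟨hQ'.1.trans hQL, hc⟩ hQ'
  have hRZ : I₁ ∪ Q ∪ I₂ ⊆ Z := Set.union_subset (Set.union_subset z1 fun z hz => zl3 (hQL hz).1) z2
  rw [Set.disjoint_left] at h12 h13 h23 d1 d2 d3
  have hI3 : I₃ ⊆ Z \ (I₁ ∪ Q ∪ I₂) := by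
    intro z hz
    refine ⟨z3 hz, ?_⟩
    rintro ((h | h) | h)
    · exact h13 h hz
    · exact d3 (hQL h).1 hz
    · exact h23 h hz
  set X₃ := cnComp r (Z \ (I₁ ∪ Q ∪ I₂)) I₃ with hX3
  have hI3X : I₃ ⊆ X₃ := cnComp_self h3 hI3
  have hX3R : ∀ z ∈ X₃, z ∉ I₁ ∪ Q ∪ I₂ := fun z hz => (cnComp_sub _ _ _ hz).2
  have hreach : ∀ L : Set W, cnConn r L → L ⊆ Z → (L ∩ I₃).Nonempty → (∃ z ∈ L, z ∈ I₁ ∪ Q ∪ I₂) →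
      ∃ w ∈ L, w ∈ I₁ ∪ Q ∪ I₂ ∧ ∃ x ∈ X₃, r x w := by
    rintro L hL hLZ ⟨p, hp⟩ ⟨z, hz, hzR⟩
    obtain ⟨x, hx, y, hy, hr⟩ := hL.2 (L ∩ X₃) Set.inter_subset_left ⟨p, hp.1, hI3X hp.2⟩ ⟨z, hz, fun hh => hX3R z hh.2 hzR⟩
    refine ⟨y, hy.1, ?_, x, hx.2, hr⟩
    by_contra hyR
    exact hy.2 ⟨hy.1, cnComp_max' hs hx.2 ⟨hLZ hy.1, hyR⟩ hr⟩
  obtain ⟨w, hwL, hwR, x, hx, hxw⟩ := hreach L₂ l2 zl2 m23 (by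
    obtain ⟨p, hp⟩ := m21; exact ⟨p, hp.1, Or.inl (Or.inl hp.2)⟩)
  obtain ⟨w', hwL', hwR', x', hx', hxw'⟩ := hreach L₁ l1 zl1 m13 (by
    obtain ⟨p, hp⟩ := m12; exact ⟨p, hp.1, Or.inr hp.2⟩)
  have hw : w ∈ I₁ ∪ Q := hwR.resolve_right (d2 hwL)
  have hw' : w' ∈ Q ∪ I₂ := by
    rcases hwR' with (h | h) | h
    · exact absurd h (d1 hwL')
    · exact Or.inl h
    · exact Or.inr h
  have hne : w ≠ w' := by
    rintro rfl
    rcases hw with h | h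
    · exact d1 hwL' h
    · exact hL w hwL' hwL (hQL h).1
  obtain ⟨X₁, X₂, c1, c2, c3, c4, c5, c6, c7⟩ := cn_split hs h1 h2 (Set.disjoint_left.2 h12)
    (Set.disjoint_left.2 fun z hz hz1 => (hQL hz).2 (Or.inl hz1)) (Set.disjoint_left.2 fun z hz hz1 => (hQL hz).2 (Or.inr hz1))
    hR hmin hw hw' hne
  have x1R : X₁ ⊆ I₁ ∪ Q ∪ I₂ := c6 ▸ Set.subset_union_left
  have x2R : X₂ ⊆ I₁ ∪ Q ∪ I₂ := c6 ▸ Set.subset_union_right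
  refine ⟨X₁, X₂, X₃, c1, c2, cnComp_conn hs h3 hI3, c3, Set.disjoint_left.2 fun z hz hz3 => hX3R z hz3 (x1R hz),
    Set.disjoint_left.2 fun z hz hz3 => hX3R z hz3 (x2R hz), c4, c5, hI3X, x1R.trans hRZ, x2R.trans hRZ,
    fun z hz => (cnComp_sub _ _ _ hz).1, ?_, ?_, ?_⟩
  · rw [Set.disjoint_left] at c3
    obtain ⟨p, hp⟩ := c2.1
    obtain ⟨a, ha, b, hb, hr⟩ := hR.2 X₁ x1R c1.1 ⟨p, x2R hp, fun h => c3 h hp⟩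
    have : b ∈ X₁ ∪ X₂ := c6 ▸ hb.1
    exact ⟨a, ha, b, this.resolve_left hb.2, hr⟩
  · rcases c7 with c7 | c7
    · exact ⟨w, c7.1, x, hx, hs _ _ hxw⟩
    · exact ⟨w', c7.1, x', hx', hs _ _ hxw'⟩
  · rcases c7 with c7 | c7
    · exact ⟨w', c7.2, x', hx', hs _ _ hxw'⟩
    · exact ⟨w, c7.2, x, hx, hs _ _ hxw⟩

end Conn

set_option linter.unusedSectionVars false

section Multi
variable {W E : Type} [Fintype E] [DecidableEq E]

def mgR (a b : E → W) (x y : W) : Prop := ∃ f, (a f = x ∧ b f = y) ∨ (a f = y ∧ b f = x)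

theorem mgR_symm (a b : E → W) (x y : W) (h : mgR a b x y) : mgR a b y x := by
  obtain ⟨f, h⟩ := h; exact ⟨f, h.symm⟩

def cnK5 (r : W → W → Prop) : Prop :=
  ∃ X : Fin 5 → Set W, (∀ i, cnConn r (X i)) ∧ (∀ i j, i ≠ j → Disjoint (X i) (X j)) ∧
    (∀ i j, i ≠ j → ∃ x ∈ X i, ∃ y ∈ X j, r x y)

def mgCd (a b : E → W) (s : W → ZMod 2) (f : E) : ZMod 2 := s (a f) + s (b f)

def mgCyc (a b : E → W) (C : Finset E) : Prop := ∀ s, ∑ f ∈ C, mgCd a b s f = 0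

def mgA (a b : E → W) (σ : E → ZMod 2) : Set (Finset E) := {C | mgCyc a b C ∧ ∑ f ∈ C, σ f = 1}

def mgB (a b : E → W) (σ : E → ZMod 2) : Set (Finset E) := {B | ∃ s, ∀ f, f ∈ B ↔ σ f + mgCd a b s f = 1}

theorem z2_cases (z : ZMod 2) : z = 0 ∨ z = 1 := by revert z; decide
theorem z2_add_self (z : ZMod 2) : z + z = 0 := by revert z; decide
theorem z2_add_eq_zero {x y : ZMod 2} : x + y = 0 ↔ x = y := by revert x y; decide
theorem z2_add_eq_one {x y : ZMod 2} : x + y = 1 ↔ x ≠ y := by revert x y; decide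
theorem z2_ne_zero {x : ZMod 2} : x ≠ 0 ↔ x = 1 := by revert x; decide
theorem z2_ne_one {x : ZMod 2} : x ≠ 1 ↔ x = 0 := by revert x; decide

theorem mgCd_add (a b : E → W) (s t : W → ZMod 2) (f : E) :
    mgCd a b (fun x => s x + t x) f = mgCd a b s f + mgCd a b t f := by
  simp only [mgCd]; ring

theorem z2_sum_symmDiff (g : E → ZMod 2) (S T : Finset E) :
    ∑ f ∈ symmDiff S T, g f = ∑ f ∈ S, g f + ∑ f ∈ T, g f := by
  have h : ∀ S : Finset E, ∑ f ∈ S, g f = ∑ f, if f ∈ S then g f else 0 := by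
    intro S; simp
  rw [h, h S, h T, ← sum_add_distrib]
  refine sum_congr rfl fun f _ => ?_
  by_cases h1 : f ∈ S <;> by_cases h2 : f ∈ T <;> simp [mem_symmDiff, h1, h2, z2_add_self]

theorem mgCyc_symmDiff {a b : E → W} {S T : Finset E} (hS : mgCyc a b S) (hT : mgCyc a b T) :
    mgCyc a b (symmDiff S T) := by
  intro s; rw [z2_sum_symmDiff, hS s, hT s, add_zero]

theorem mgA3 (a b : E → W) (σ : E → ZMod 2) : ∀ C₁ ∈ mgA a b σ, ∀ C₂ ∈ mgA a b σ, ∀ C₃ ∈ mgA a b σ,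
    symmDiff (symmDiff C₁ C₂) C₃ ∈ mgA a b σ := by
  rintro C₁ ⟨h1, h1'⟩ C₂ ⟨h2, h2'⟩ C₃ ⟨h3, h3'⟩
  refine ⟨mgCyc_symmDiff (mgCyc_symmDiff h1 h2) h3, ?_⟩
  rw [z2_sum_symmDiff, z2_sum_symmDiff, h1', h2', h3']; decide

theorem mgB3 (a b : E → W) (σ : E → ZMod 2) : ∀ C₁ ∈ mgB a b σ, ∀ C₂ ∈ mgB a b σ, ∀ C₃ ∈ mgB a b σ,
    symmDiff (symmDiff C₁ C₂) C₃ ∈ mgB a b σ := by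
  rintro C₁ ⟨s1, h1⟩ C₂ ⟨s2, h2⟩ C₃ ⟨s3, h3⟩
  refine ⟨fun x => (s1 x + s2 x) + s3 x, fun f => ?_⟩
  rw [mgCd_add, mgCd_add]
  simp only [mem_symmDiff, h1, h2, h3]
  generalize mgCd a b s1 f = x
  generalize mgCd a b s2 f = y
  generalize mgCd a b s3 f = z
  generalize σ f = w
  revert x y z w; decide

theorem mgB_nonempty (a b : E → W) (σ : E → ZMod 2) : (mgB a b σ).Nonempty :=
  ⟨univ.filter fun f => σ f + mgCd a b (fun _ => 0) f = 1, fun _ => 0, fun f => by simp⟩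

theorem mg_odd (a b : E → W) (σ : E → ZMod 2) : ∀ C ∈ mgA a b σ, ∀ B ∈ mgB a b σ, Odd (C ∩ B).card := by
  rintro C ⟨h1, h2⟩ B ⟨s, hs⟩
  rw [← ZMod.natCast_eq_one_iff_odd]
  have : ((C ∩ B).card : ZMod 2) = ∑ f ∈ C, (σ f + mgCd a b s f) := by
    rw [card_eq_sum_ones, Nat.cast_sum, ← sum_ite_mem]
    refine sum_congr rfl fun f _ => ?_
    by_cases hf : f ∈ B
    · simp [hf, (hs f).1 hf]
    · have : σ f + mgCd a b s f = 0 := by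
        rcases z2_cases (σ f + mgCd a b s f) with h | h
        · exact h
        · exact absurd ((hs f).2 h) hf
      simp [hf, this]
  rw [this, sum_add_distrib, h1 s, h2]; decide

theorem cnK5_of {r : W → W → Prop} (hs : ∀ x y, r x y → r y x) {X₀ X₁ X₂ X₃ X₄ : Set W}
    (c0 : cnConn r X₀) (c1 : cnConn r X₁) (c2 : cnConn r X₂) (c3 : cnConn r X₃) (c4 : cnConn r X₄)
    (d01 : Disjoint X₀ X₁) (d02 : Disjoint X₀ X₂) (d03 : Disjoint X₀ X₃) (d04 : Disjoint X₀ X₄)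
    (d12 : Disjoint X₁ X₂) (d13 : Disjoint X₁ X₃) (d14 : Disjoint X₁ X₄)
    (d23 : Disjoint X₂ X₃) (d24 : Disjoint X₂ X₄) (d34 : Disjoint X₃ X₄)
    (a01 : ∃ x ∈ X₀, ∃ y ∈ X₁, r x y) (a02 : ∃ x ∈ X₀, ∃ y ∈ X₂, r x y)
    (a03 : ∃ x ∈ X₀, ∃ y ∈ X₃, r x y) (a04 : ∃ x ∈ X₀, ∃ y ∈ X₄, r x y)
    (a12 : ∃ x ∈ X₁, ∃ y ∈ X₂, r x y) (a13 : ∃ x ∈ X₁, ∃ y ∈ X₃, r x y)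
    (a14 : ∃ x ∈ X₁, ∃ y ∈ X₄, r x y) (a23 : ∃ x ∈ X₂, ∃ y ∈ X₃, r x y)
    (a24 : ∃ x ∈ X₂, ∃ y ∈ X₄, r x y) (a34 : ∃ x ∈ X₃, ∃ y ∈ X₄, r x y) : cnK5 r := by
  have sw : ∀ {X Y : Set W}, (∃ x ∈ X, ∃ y ∈ Y, r x y) → ∃ x ∈ Y, ∃ y ∈ X, r x y := by
    rintro X Y ⟨x, hx, y, hy, h⟩; exact ⟨y, hy, x, hx, hs _ _ h⟩
  refine ⟨![X₀, X₁, X₂, X₃, X₄], ?_, ?_, ?_⟩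
  · intro i; fin_cases i <;> assumption
  · intro i j hij
    fin_cases i <;> fin_cases j <;> first | exact absurd rfl hij | assumption | (apply Disjoint.symm; assumption)
  · intro i j hij
    fin_cases i <;> fin_cases j <;> first | exact absurd rfl hij | assumption | (apply sw; assumption)

end Multi

set_option linter.unusedSectionVars false

section Multi
variable {W E : Type} [Fintype E] [DecidableEq E]

def mgPath (a b : E → W) (u v : W) (P : Finset E) : Prop :=
  (∀ s, ∑ f ∈ P, mgCd a b s f = s u + s v) ∧
  (∀ D ⊆ P, (∀ s, ∑ f ∈ D, mgCd a b s f = 0) → D = ∅) ∧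
  (∀ D ⊆ P, (∀ s, ∑ f ∈ D, mgCd a b s f = s u + s v) → D = P) ∧
  2 ≤ P.card ∧ u ≠ v

def mgI (a b : E → W) (u v : W) (P : Finset E) : Set W :=
  {x | x ≠ u ∧ x ≠ v ∧ ∃ f ∈ P, a f = x ∨ b f = x}

theorem mgPath_L0 {a b : E → W} {u v : W} {P : Finset E} (h : mgPath a b u v P) (X : Set W)
    (hu : u ∉ X) (hv : v ∉ X)
    (hX : ∀ f ∈ P, (a f ∈ X ∨ b f ∈ X) → (a f ∈ X ∨ a f = u ∨ a f = v) ∧ (b f ∈ X ∨ b f = u ∨ b f = v)) :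
    (∀ f ∈ P, ¬ (a f ∈ X ∨ b f ∈ X)) ∨ (∀ f ∈ P, a f ∈ X ∨ b f ∈ X) := by
  classical
  obtain ⟨p1, p2, p3, p4, p5⟩ := h
  set F := P.filter fun f => a f ∈ X ∨ b f ∈ X with hF
  have hFP : F ⊆ P := filter_subset _ _
  have key : ∀ s : W → ZMod 2, (∀ x, x ∉ X → s x = 0) → ∑ f ∈ F, mgCd a b s f = 0 := by
    intro s hs
    have h1 := p1 s
    rw [hs u hu, hs v hv, add_zero] at h1
    rw [← h1]
    refine sum_subset hFP fun f hf hf' => ?_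
    have : ¬ (a f ∈ X ∨ b f ∈ X) := fun hh => hf' (mem_filter.2 ⟨hf, hh⟩)
    push Not at this
    simp [mgCd, hs _ this.1, hs _ this.2]
  set α := ∑ f ∈ F, mgCd a b (fun x => if x = u then 1 else 0) f with hα
  set β := ∑ f ∈ F, mgCd a b (fun x => if x = v then 1 else 0) f with hβ
  have hall : ∀ s : W → ZMod 2, ∑ f ∈ F, mgCd a b s f = s u * α + s v * β := by
    intro s
    have h1 : ∀ f ∈ F, mgCd a b s f = mgCd a b (fun x => if x ∈ X then s x else 0) f +
        (s u * mgCd a b (fun x => if x = u then 1 else 0) f + s v * mgCd a b (fun x => if x = v then 1 else 0) f) := by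
      intro f hf
      obtain ⟨hf1, hf2⟩ := mem_filter.1 hf
      have hend : ∀ x, (x ∈ X ∨ x = u ∨ x = v) → s x = (if x ∈ X then s x else 0) +
          (s u * (if x = u then 1 else 0) + s v * (if x = v then 1 else 0)) := by
        rintro x (hx | rfl | rfl)
        · have : x ≠ u := fun e => hu (e ▸ hx)
          have : x ≠ v := fun e => hv (e ▸ hx)
          simp [*]
        · simp [hu, p5]
        · simp [hv, Ne.symm p5]
      have e1 := hend _ (hX f hf1 hf2).1
      have e2 := hend _ (hX f hf1 hf2).2
      simp only [mgCd]
      conv_lhs => rw [e1, e2]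
      ring
    rw [sum_congr rfl h1, sum_add_distrib, sum_add_distrib, ← mul_sum, ← mul_sum, key _ (fun x hx => by simp [hx]), zero_add]
  have hαβ : α = β := by
    have := hall (fun _ => 1)
    simp only [mgCd, z2_add_self, sum_const_zero, one_mul] at this
    exact z2_add_eq_zero.1 this.symm
  rcases z2_cases α with h0 | h0
  · left
    have := p2 F hFP (fun s => by rw [hall, ← hαβ, h0]; ring)
    intro f hf hh
    have hfF : f ∈ F := mem_filter.2 ⟨hf, hh⟩
    rw [this] at hfF
    exact notMem_empty f hfF
  · right
    have := p3 F hFP (fun s => by rw [hall, ← hαβ, h0]; ring)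
    intro f hf
    rw [← this] at hf
    exact (mem_filter.1 hf).2

theorem mgPath_inner {a b : E → W} {u v : W} {P : Finset E} (h : mgPath a b u v P) (f : E) (hf : f ∈ P) :
    ¬ ((a f = u ∨ a f = v) ∧ (b f = u ∨ b f = v)) := by
  obtain ⟨p1, p2, p3, p4, p5⟩ := h
  have hs : ({f} : Finset E) ⊆ P := by simpa using hf
  have hloop : a f ≠ b f := by
    intro e
    have := p2 {f} hs (fun s => by simp [mgCd, e, z2_add_self])
    simp at this
  have huv : ¬ ∀ s : W → ZMod 2, s (a f) + s (b f) = s u + s v := by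
    intro hh
    have := p3 {f} hs (fun s => by simpa [mgCd] using hh s)
    rw [← this] at p4
    simp at p4
  rintro ⟨h1 | h1, h2 | h2⟩
  · exact hloop (h1.trans h2.symm)
  · exact huv fun s => by rw [h1, h2]
  · exact huv fun s => by rw [h1, h2, add_comm]
  · exact hloop (h1.trans h2.symm)

theorem mgPath_end {a b : E → W} {u v : W} {P : Finset E} (h : mgPath a b u v P) (w : W) (hw : w = u ∨ w = v) :
    ∃ f ∈ P, ∃ x ∈ mgI a b u v P, (a f = w ∧ b f = x) ∨ (a f = x ∧ b f = w) := by
  classical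
  have hin := mgPath_inner h
  obtain ⟨p1, p2, p3, p4, p5⟩ := h
  have h1 := p1 (fun x => if x = w then 1 else 0)
  have h2 : ((if u = w then 1 else 0) + (if v = w then 1 else 0) : ZMod 2) = 1 := by
    rcases hw with rfl | rfl
    · simp [Ne.symm p5]
    · simp [p5]
  rw [h2] at h1
  obtain ⟨f, hf, hne⟩ := exists_ne_zero_of_sum_ne_zero (by rw [h1]; exact one_ne_zero : ∑ f ∈ P, mgCd a b (fun x => if x = w then (1 : ZMod 2) else 0) f ≠ 0)
  refine ⟨f, hf, ?_⟩
  have := hin f hf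
  simp only [mgCd] at hne
  by_cases c1 : a f = w
  · have c2 : b f ≠ w := by
      intro c2; apply hne; simp [c1, c2]; decide
    refine ⟨b f, ⟨?_, ?_, f, hf, Or.inr rfl⟩, Or.inl ⟨c1, rfl⟩⟩ <;> (intro e; apply this; constructor)
    · rw [c1]; exact hw
    · exact Or.inl e
    · rw [c1]; exact hw
    · exact Or.inr e
  · have c2 : b f = w := by
      by_contra c2; apply hne; simp [c1, c2]
    refine ⟨a f, ⟨?_, ?_, f, hf, Or.inl rfl⟩, Or.inr ⟨rfl, c2⟩⟩ <;> (intro e; apply this; constructor)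
    · exact Or.inl e
    · rw [c2]; exact hw
    · exact Or.inr e
    · rw [c2]; exact hw

theorem mgPath_L1 {a b : E → W} {u v : W} {P : Finset E} (h : mgPath a b u v P) (X : Set W)
    (hu : u ∉ X) (hv : v ∉ X) (hX : ∀ f ∈ P, a f ∈ X ↔ b f ∈ X) : ∀ x ∈ mgI a b u v P, x ∉ X := by
  rcases mgPath_L0 h X hu hv (fun f hf hh => by have := hX f hf; tauto) with h1 | h1
  · rintro x ⟨_, _, f, hf, hx⟩ hxX
    apply h1 f hf
    rcases hx with rfl | rfl
    · exact Or.inl hxX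
    · exact Or.inr hxX
  · obtain ⟨f, hf, x, hx, hh⟩ := mgPath_end h u (Or.inl rfl)
    have h2 := h1 f hf
    have h3 := hX f hf
    rcases hh with ⟨e1, e2⟩ | ⟨e1, e2⟩ <;> rw [e1, e2] at h2 h3 <;> tauto

theorem mgI_mem {a b : E → W} {u v : W} {P : Finset E} {f : E} (hf : f ∈ P) :
    (a f ∈ mgI a b u v P ∨ a f = u ∨ a f = v) ∧ (b f ∈ mgI a b u v P ∨ b f = u ∨ b f = v) := by
  constructor
  · by_cases h1 : a f = u
    · exact Or.inr (Or.inl h1)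
    by_cases h2 : a f = v
    · exact Or.inr (Or.inr h2)
    exact Or.inl ⟨h1, h2, f, hf, Or.inl rfl⟩
  · by_cases h1 : b f = u
    · exact Or.inr (Or.inl h1)
    by_cases h2 : b f = v
    · exact Or.inr (Or.inr h2)
    exact Or.inl ⟨h1, h2, f, hf, Or.inr rfl⟩

theorem mgPath_conn {a b : E → W} {u v : W} {P : Finset E} (h : mgPath a b u v P) :
    cnConn (mgR a b) (mgI a b u v P) := by
  refine ⟨?_, fun X hX hne hne' => ?_⟩
  · obtain ⟨f, hf, x, hx, _⟩ := mgPath_end h u (Or.inl rfl)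
    exact ⟨x, hx⟩
  by_contra hcon
  push Not at hcon
  have hnr : ∀ x ∈ X, ∀ y ∈ mgI a b u v P, mgR a b x y → y ∈ X := by
    intro x hx y hy hr
    by_contra hyX
    exact hcon x hx y ⟨hy, hyX⟩ hr
  have hnr' : ∀ x ∈ X, ∀ y ∈ mgI a b u v P, mgR a b y x → y ∈ X := fun x hx y hy hr =>
    hnr x hx y hy (mgR_symm _ _ _ _ hr)
  have hfr : ∀ f, mgR a b (a f) (b f) := fun f => ⟨f, Or.inl ⟨rfl, rfl⟩⟩
  have hall : ∀ Y ⊆ mgI a b u v P, Y.Nonempty → (∀ x ∈ Y, ∀ y ∈ mgI a b u v P, mgR a b x y → y ∈ Y) →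
      ∀ f ∈ P, a f ∈ Y ∨ b f ∈ Y := by
    rintro Y hY ⟨x, hx⟩ hcl
    refine (mgPath_L0 h Y (fun hu => (hY hu).1 rfl) (fun hv => (hY hv).2.1 rfl) ?_).resolve_left ?_
    · intro f hf hh
      obtain ⟨m1, m2⟩ := mgI_mem (a := a) (b := b) (u := u) (v := v) hf
      refine ⟨m1.imp_left fun m1 => ?_, m2.imp_left fun m2 => ?_⟩
      · rcases hh with hh | hh
        · exact hh
        · exact hcl _ hh _ m1 (mgR_symm _ _ _ _ (hfr f))
      · rcases hh with hh | hh
        · exact hcl _ hh _ m2 (hfr f)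
        · exact hh
    · intro hno
      obtain ⟨_, _, f, hf, e⟩ := hY hx
      apply hno f hf
      rcases e with e | e
      · left; rwa [e]
      · right; rwa [e]
  have A1 := hall X hX hne hnr
  have A2 := hall (mgI a b u v P \ X) Set.sdiff_subset hne' (fun x hx y hy hr => ⟨hy, fun hyX =>
    hx.2 (hnr' y hyX x hx.1 hr)⟩)
  obtain ⟨f, hf, _⟩ := mgPath_end h u (Or.inl rfl)
  rcases A1 f hf with h1 | h1 <;> rcases A2 f hf with h2 | h2
  · exact h2.2 h1
  · exact h2.2 (hnr _ h1 _ h2.1 (hfr f))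
  · exact h2.2 (hnr' _ h1 _ h2.1 (hfr f))
  · exact h2.2 h1

theorem mgPath_sub {a b : E → W} {u v : W} {P : Finset E} (h : mgPath a b u v P) (x : W) (hx : x ∈ mgI a b u v P) :
    ∃ F ⊆ P, ∀ s, ∑ f ∈ F, mgCd a b s f = s u + s x := by
  by_contra hno
  let S : Set W := {x | ∃ F ⊆ P, ∀ s : W → ZMod 2, ∑ f ∈ F, mgCd a b s f = s u + s x}
  have huS : u ∈ S := ⟨∅, by simp, fun s => by simp [z2_add_self]⟩
  have hvS : v ∈ S := ⟨P, subset_rfl, h.1⟩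
  have hstep : ∀ f ∈ P, a f ∈ S ↔ b f ∈ S := by
    intro f hf
    constructor
    · rintro ⟨F, hF, hs⟩
      refine ⟨symmDiff F {f}, ?_, fun s => ?_⟩
      · intro g hg
        rcases mem_symmDiff.1 hg with h | h
        · exact hF h.1
        · have : g = f := by simpa using h.1
          exact this ▸ hf
      · rw [z2_sum_symmDiff, hs, sum_singleton, mgCd]
        have := z2_add_self (s (a f))
        linear_combination this
    · rintro ⟨F, hF, hs⟩
      refine ⟨symmDiff F {f}, ?_, fun s => ?_⟩
      · intro g hg
        rcases mem_symmDiff.1 hg with h | h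
        · exact hF h.1
        · have : g = f := by simpa using h.1
          exact this ▸ hf
      · rw [z2_sum_symmDiff, hs, sum_singleton, mgCd]
        have := z2_add_self (s (b f))
        linear_combination this
  exact mgPath_L1 h Sᶜ (fun hh => hh huS) (fun hh => hh hvS) (fun f hf => not_congr (hstep f hf)) x hx hno

end Multi

set_option linter.unusedSectionVars false

section Multi
variable {W E : Type} [Fintype E] [DecidableEq E]

theorem fin3_other (i : Fin 3) : ∃ k, i ≠ k := by revert i; decide

theorem mg_conf_K5 [Finite W] (a b : E → W) (σ : E → ZMod 2) (e : E) (C B : Fin 3 → Finset E)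
    (h : lhConf (mgA a b σ) (mgB a b σ) e C B) : cnK5 (mgR a b) := by
  classical
  obtain ⟨hCA, hBB, heC, heB, hCC, hbb, hCB, hf4, hcard, h5, h6⟩ := h
  have hCcyc : ∀ i, mgCyc a b (C i) := fun i => (hCA i).1
  have hCnot : ∀ i k, i ≠ k → ¬ C k ⊆ C i := by
    intro i k hik hs
    have : C k ⊆ {e} := fun f hf => by simpa using hCC i k hik f (hs hf) hf
    have := card_le_card this
    have := hcard k
    simp at *
    omega
  have K2 : ∀ i k, i ≠ k → ∀ D, mgCyc a b D → D ⊆ C i ∪ C k → D = ∅ ∨ D = C i ∨ D = C k ∨ D = symmDiff (C i) (C k) := by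
    intro i k hik D hD hs
    rcases z2_cases (∑ f ∈ D, σ f) with h0 | h0
    · have hD' : symmDiff D (C i) ∈ mgA a b σ := ⟨mgCyc_symmDiff hD (hCcyc i), by
        rw [z2_sum_symmDiff, h0, (hCA i).2, zero_add]⟩
      rcases h5 i k hik _ hD' (by
        intro f hf
        rcases mem_symmDiff.1 hf with hf | hf
        · exact hs hf.1
        · exact mem_union_left _ hf.1) with h | h
      · left
        simpa using h
      · right; right; right
        rw [← h]
        ext f
        simp only [mem_symmDiff]
        tauto
    · rcases h5 i k hik D ⟨hD, h0⟩ hs with h | h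
      · exact Or.inr (Or.inl h)
      · exact Or.inr (Or.inr (Or.inl h))
  have K1 : ∀ i D, mgCyc a b D → D ⊆ C i → D = ∅ ∨ D = C i := by
    intro i D hD hs
    obtain ⟨k, hik⟩ := fin3_other i
    rcases K2 i k hik D hD (hs.trans subset_union_left) with h | h | h | h
    · exact Or.inl h
    · exact Or.inr h
    · exact absurd (h ▸ hs) (hCnot i k hik)
    · exfalso
      apply hCnot i k hik
      intro f hf
      by_contra hfi
      exact hfi (hs (h ▸ mem_symmDiff.2 (Or.inr ⟨hf, hfi⟩)))
  obtain ⟨u, hu⟩ : ∃ u, u = a e := ⟨_, rfl⟩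
  obtain ⟨v, hv⟩ : ∃ v, v = b e := ⟨_, rfl⟩
  have hcde : ∀ s : W → ZMod 2, mgCd a b s e = s u + s v := fun s => by rw [hu, hv]; rfl
  have huv : u ≠ v := by
    intro heq
    have hcyc : mgCyc a b {e} := fun s => by rw [sum_singleton, hcde, heq, z2_add_self]
    rcases K1 0 {e} hcyc (by simpa using heC 0) with h | h
    · simp at h
    · have := hcard 0
      rw [← h] at this
      simp at this
  set P : Fin 3 → Finset E := fun i => (C i).erase e with hP
  have hPC : ∀ i, P i ⊆ C i := fun i => erase_subset _ _
  have hPe : ∀ i f, f ∈ P i → f ≠ e := fun i f hf => ne_of_mem_erase hf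
  have hpath : ∀ i, mgPath a b u v (P i) := by
    intro i
    refine ⟨fun s => ?_, fun D hD hs => ?_, fun D hD hs => ?_, ?_, huv⟩
    · have h1 := hCcyc i s
      rw [← add_sum_erase _ _ (heC i), hcde] at h1
      exact (z2_add_eq_zero.1 h1).symm
    · rcases K1 i D hs (hD.trans (hPC i)) with h | h
      · exact h
      · exact absurd rfl (hPe i e (hD (h ▸ heC i)))
    · have heD : e ∉ D := fun hh => hPe i e (hD hh) rfl
      rcases K1 i (insert e D) (fun s => by rw [sum_insert heD, hs, hcde, z2_add_self]) (by
        intro f hf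
        rcases mem_insert.1 hf with rfl | hf
        · exact heC i
        · exact hPC i (hD hf)) with h | h
      · simp at h
      · simp only [hP, ← h, erase_insert heD]
    · have := hcard i
      simp only [hP, card_erase_of_mem (heC i)]; omega
  have hIdis : ∀ i k, i ≠ k → Disjoint (mgI a b u v (P i)) (mgI a b u v (P k)) := by
    intro i k hik
    rw [Set.disjoint_left]
    intro x hxi hxk
    obtain ⟨F, hF, hFs⟩ := mgPath_sub (hpath i) x hxi
    obtain ⟨F', hF', hFs'⟩ := mgPath_sub (hpath k) x hxk
    have hcyc : mgCyc a b (symmDiff F F') := fun s => by rw [z2_sum_symmDiff, hFs, hFs', z2_add_self]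
    have hs : symmDiff F F' ⊆ C i ∪ C k := by
      intro f hf
      rcases mem_symmDiff.1 hf with hf | hf
      · exact mem_union_left _ (hPC i (hF hf.1))
      · exact mem_union_right _ (hPC k (hF' hf.1))
    have hne : e ∉ symmDiff F F' := by
      intro hf
      rcases mem_symmDiff.1 hf with hf | hf
      · exact hPe i e (hF hf.1) rfl
      · exact hPe k e (hF' hf.1) rfl
    have hsep : ∀ w, w ≠ x → ¬ ∀ s : W → ZMod 2, s w + s x = 0 := by
      intro w hw hh
      have := hh (fun z => if z = w then 1 else 0)
      simp [Ne.symm hw] at this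
    rcases K2 i k hik _ hcyc hs with h | h | h | h
    · have hFF : F = F' := symmDiff_eq_bot.1 h
      have hF0 : F = ∅ := by
        rw [eq_empty_iff_forall_notMem]
        intro f hf
        exact hPe i f (hF hf) (hCC i k hik f (hPC i (hF hf)) (hPC k (hF' (hFF ▸ hf))))
      apply hsep u (Ne.symm hxi.1)
      intro s
      rw [← hFs s, hF0, sum_empty]
    · exact hne (h ▸ heC i)
    · exact hne (h ▸ heC k)
    · have hFP : F = P i := by
        refine Subset.antisymm hF fun f hf => ?_
        have hfk : f ∉ C k := fun hh => hPe i f hf (hCC i k hik f (hPC i hf) hh)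
        have : f ∈ symmDiff F F' := h ▸ mem_symmDiff.2 (Or.inl ⟨hPC i hf, hfk⟩)
        rcases mem_symmDiff.1 this with h | h
        · exact h.1
        · exact absurd (hPC k (hF' h.1)) hfk
      apply hsep v (Ne.symm hxi.2.1)
      intro s
      have e1 := hFs s
      rw [hFP, (hpath i).1 s] at e1
      rw [add_left_cancel e1, z2_add_self]
  -- potentials
  choose t ht using hBB
  have hte : ∀ i, t i u + t i v = σ e + 1 := by
    intro i
    have := (ht i e).1 (heB i)
    rw [hcde] at this
    generalize t i u = p at *
    generalize t i v = q at *
    generalize σ e = z at *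
    revert p q z; decide
  let S : Fin 3 → Fin 3 → W → ZMod 2 := fun i k x => (t i x + t k x) + (t i u + t k u)
  have hSu : ∀ i k, S i k u = 0 := fun i k => z2_add_self _
  have hSv : ∀ i k, S i k v = 0 := by
    intro i k
    have h1 := hte i
    have h2 := hte k
    have : S i k v = (t i u + t i v) + (t k u + t k v) := by simp only [S]; ring
    rw [this, h1, h2, z2_add_self]
  have hScd : ∀ i k f, mgCd a b (S i k) f = 1 ↔ ¬ (f ∈ B i ↔ f ∈ B k) := by
    intro i k f
    rw [ht i f, ht k f]
    simp only [mgCd, S]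
    generalize t i (a f) = x1
    generalize t i (b f) = x2
    generalize t k (a f) = x3
    generalize t k (b f) = x4
    generalize t i u + t k u = x5
    generalize σ f = x6
    revert x1 x2 x3 x4 x5 x6; decide
  have hS3 : ∀ i j k x, S i k x + S j k x = S i j x := by
    intro i j k x
    simp only [S]
    have e1 := z2_add_self (t k x)
    have e2 := z2_add_self (t k u)
    linear_combination e1 + e2
  have hcr : ∀ (s : W → ZMod 2) f, mgCd a b s f ≠ 1 → (s (a f) = 1 ↔ s (b f) = 1) := by
    intro s f
    simp only [mgCd]
    generalize s (a f) = x1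
    generalize s (b f) = x2
    revert x1 x2; decide
  have hSI : ∀ i j k, i ≠ j → i ≠ k → ∀ x ∈ mgI a b u v (P i), S j k x = 0 := by
    intro i j k hij hik x hx
    have := mgPath_L1 (hpath i) {x | S j k x = 1} (by simp [hSu]) (by simp [hSv]) (by
      intro f hf
      apply hcr
      rw [Ne, hScd, not_not]
      have n1 : f ∉ B j := fun hh => hPe i f hf (hCB i j hij f (hPC i hf) hh)
      have n2 : f ∉ B k := fun hh => hPe i f hf (hCB i k hik f (hPC i hf) hh)
      tauto) x hx
    exact z2_ne_one.1 this
  have hmeet : ∀ i j k, i ≠ j → i ≠ k → ∃ x ∈ mgI a b u v (P i), S i j x = 1 ∧ S i k x = 1 := by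
    intro i j k hij hik
    obtain ⟨f, hfe, hfC, hfB⟩ := hf4 i
    have hfP : f ∈ P i := mem_erase.2 ⟨hfe, hfC⟩
    have hnk : f ∉ B k := fun hh => hfe (hbb i k hik f hfB hh)
    have h1 : mgCd a b (S i k) f = 1 := (hScd i k f).2 (by tauto)
    have heq : ∀ x ∈ mgI a b u v (P i), S i j x = S i k x := by
      intro x hx
      rw [← hS3 i j k x, hSI i j k hij hik x hx, add_zero]
    obtain ⟨m1, m2⟩ := mgI_mem (a := a) (b := b) (u := u) (v := v) hfP
    have hend : ∀ x, (x ∈ mgI a b u v (P i) ∨ x = u ∨ x = v) → S i k x = 1 → ∃ x ∈ mgI a b u v (P i), S i j x = 1 ∧ S i k x = 1 := by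
      rintro x (hx | rfl | rfl) h
      · exact ⟨x, hx, (heq x hx).trans h, h⟩
      · rw [hSu] at h; exact absurd h (by decide)
      · rw [hSv] at h; exact absurd h (by decide)
    have h2 : S i k (a f) = 1 ∨ S i k (b f) = 1 := by
      simp only [mgCd] at h1
      generalize S i k (a f) = x at *
      generalize S i k (b f) = y at *
      revert x y; decide
    rcases h2 with h2 | h2
    · exact hend _ m1 h2
    · exact hend _ m2 h2
  have hlink : ∀ i k, i ≠ k → ∀ x ∈ mgI a b u v (P i), S i k x = 1 → ∀ y ∈ mgI a b u v (P k), S i k y = 1 →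
      ∃ L : Set W, cnConn (mgR a b) L ∧ (∀ z ∈ L, S i k z = 1) ∧ x ∈ L ∧ y ∈ L := by
    intro i k hik x hx hxS y hy hyS
    have hsx : ({x} : Set W) ⊆ {z | S i k z = 1} := by simpa using hxS
    have hLc := cnComp_conn (mgR_symm a b) (cnConn_singleton (mgR a b) x) hsx
    have hxL := cnComp_self (cnConn_singleton (mgR a b) x) hsx rfl
    have hLS : ∀ z ∈ cnComp (mgR a b) {z | S i k z = 1} {x}, S i k z = 1 := fun z hz => by
      have hz2 : z ∈ {z | S i k z = 1} := cnComp_sub _ _ _ hz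
      exact hz2
    have hmax : ∀ z ∈ cnComp (mgR a b) {z | S i k z = 1} {x}, ∀ w, S i k w = 1 → mgR a b z w →
      w ∈ cnComp (mgR a b) {z | S i k z = 1} {x} := fun z hz w hw hr => cnComp_max' (mgR_symm a b) hz hw hr
    set L := cnComp (mgR a b) {z | S i k z = 1} {x} with hL
    refine ⟨L, hLc, hLS, hxL, ?_⟩
    by_contra hyL
    let l : W → ZMod 2 := fun z => if z ∈ L then 1 else 0
    have hl : ∀ z, l z = 1 ↔ z ∈ L := by intro z; by_cases hz : z ∈ L <;> simp [l, hz]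
    have huL : u ∉ L := fun hh => by have := hLS u hh; rw [hSu] at this; exact absurd this (by decide)
    have hvL : v ∉ L := fun hh => by have := hLS v hh; rw [hSv] at this; exact absurd this (by decide)
    have hfr : ∀ f, mgR a b (a f) (b f) := fun f => ⟨f, Or.inl ⟨rfl, rfl⟩⟩
    have hsub : ∀ f, mgCd a b l f = 1 → mgCd a b (S i k) f = 1 := by
      intro f hf
      have m1 := hl (a f)
      have m2 := hl (b f)
      have q1 := hLS (a f)
      have q2 := hLS (b f)
      have q3 := fun h1 h2 => hmax (a f) h1 (b f) h2 (hfr f)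
      have q4 := fun h1 h2 => hmax (b f) h1 (a f) h2 (mgR_symm _ _ _ _ (hfr f))
      rw [← m1] at q1 q3 q4
      rw [← m2] at q2 q3 q4
      clear m1 m2
      simp only [mgCd] at *
      generalize l (a f) = x1 at *
      generalize l (b f) = x2 at *
      generalize S i k (a f) = x3 at *
      generalize S i k (b f) = x4 at *
      revert x1 x2 x3 x4; decide
    let D : Finset E := univ.filter fun f => σ f + mgCd a b (fun z => t i z + l z) f = 1
    have hDmem : ∀ f, f ∈ D ↔ σ f + mgCd a b (fun z => t i z + l z) f = 1 := fun f => by simp [D]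
    have hDl : ∀ f, mgCd a b l f = 1 ↔ ¬ (f ∈ D ↔ f ∈ B i) := by
      intro f
      rw [hDmem, ht i f, mgCd_add]
      generalize mgCd a b l f = x1
      generalize mgCd a b (t i) f = x2
      generalize σ f = x3
      revert x1 x2 x3; decide
    have hDB : D ∈ mgB a b σ := ⟨_, hDmem⟩
    rcases h6 i k hik D hDB (by
      intro f hf
      rw [mem_union]
      by_contra hno
      push Not at hno
      have h1 := (hDl f).2 (by tauto)
      have h2 := (hScd i k f).1 (hsub f h1)
      tauto) with h | h
    · refine mgPath_L1 (hpath i) L huL hvL (fun f hf => ?_) x hx hxL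
      rw [← hl, ← hl]
      apply hcr
      rw [Ne, hDl, h]; tauto
    · refine mgPath_L1 (hpath k) {z | S i k z + l z = 1} ?_ ?_ (fun f hf => ?_) y hy ?_
      · have : l u = 0 := by simp [l, huL]
        simp [hSu, this]
      · have : l v = 0 := by simp [l, hvL]
        simp [hSv, this]
      · apply hcr (fun z => S i k z + l z)
        rw [mgCd_add, Ne, z2_add_eq_one, not_not]
        have h1 := hDl f
        have h2 := hScd i k f
        rw [h] at h1
        have : mgCd a b l f = 1 ↔ mgCd a b (S i k) f = 1 := by rw [h1, h2]; tauto
        generalize mgCd a b l f = x1 at *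
        generalize mgCd a b (S i k) f = x2 at *
        clear h1 h2
        revert x1 x2; decide
      · have : l y = 0 := by simp [l, hyL]
        simp [hyS, this]
  -- roots
  obtain ⟨x0, hx0, hx01, hx02⟩ := hmeet 0 1 2 (by decide) (by decide)
  obtain ⟨x1, hx1, hx10, hx12⟩ := hmeet 1 0 2 (by decide) (by decide)
  obtain ⟨x2, hx2, hx20, hx21⟩ := hmeet 2 0 1 (by decide) (by decide)
  have hSsymm : ∀ i k x, S i k x = S k i x := by intro i k x; simp only [S]; ring
  obtain ⟨L2, c2, s2, m20, m21⟩ := hlink 0 1 (by decide) x0 hx0 hx01 x1 hx1 (by rw [hSsymm]; exact hx10)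
  obtain ⟨L1, c1, s1, m10, m12⟩ := hlink 0 2 (by decide) x0 hx0 hx02 x2 hx2 (by rw [hSsymm]; exact hx20)
  obtain ⟨L0, c0, s0, m01, m02⟩ := hlink 1 2 (by decide) x1 hx1 hx12 x2 hx2 (by rw [hSsymm]; exact hx21)
  have hZ : ∀ i k (L : Set W), (∀ z ∈ L, S i k z = 1) → L ⊆ {u, v}ᶜ := by
    rintro i k L hL z hz (rfl | rfl)
    · have := hL _ hz; rw [hSu] at this; exact absurd this (by decide)
    · have := hL _ hz; rw [hSv] at this; exact absurd this (by decide)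
  have hIZ : ∀ i, mgI a b u v (P i) ⊆ {u, v}ᶜ := by
    rintro i z hz (rfl | rfl)
    · exact hz.1 rfl
    · exact hz.2.1 rfl
  have hLI : ∀ i j k (L : Set W), i ≠ j → i ≠ k → (∀ z ∈ L, S j k z = 1) → Disjoint L (mgI a b u v (P i)) := by
    intro i j k L hij hik hL
    rw [Set.disjoint_left]
    intro z hz hzI
    have h1 := hL z hz
    rw [hSI i j k hij hik z hzI] at h1
    exact absurd h1 (by decide)
  obtain ⟨X₁, X₂, X₃, k1, k2, k3, d12, d13, d23, i1, i2, i3, z1, z2, z3, r12, r13, r23⟩ :=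
    cn_rooted (mgR_symm a b) (Z := {u, v}ᶜ) (mgPath_conn (hpath 0)) (mgPath_conn (hpath 1)) (mgPath_conn (hpath 2))
      (hIdis 0 1 (by decide)) (hIdis 0 2 (by decide)) (hIdis 1 2 (by decide)) c0 c1 c2
      (hLI 0 1 2 L0 (by decide) (by decide) s0) (hLI 1 0 2 L1 (by decide) (by decide) s1) (hLI 2 0 1 L2 (by decide) (by decide) s2)
      (by
        intro x a0 a1 a2
        have := hS3 0 1 2 x
        rw [s1 x a1, s0 x a0, s2 x a2] at this
        exact absurd this (by decide))
      ⟨x1, m01, hx1⟩ ⟨x2, m02, hx2⟩ ⟨x0, m10, hx0⟩ ⟨x2, m12, hx2⟩ ⟨x0, m20, hx0⟩ ⟨x1, m21, hx1⟩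
      (hIZ 0) (hIZ 1) (hIZ 2) (hZ _ _ _ s0) (hZ _ _ _ s1) (hZ _ _ _ s2)
  have hdis : ∀ w, (w = u ∨ w = v) → ∀ X : Set W, X ⊆ {u, v}ᶜ → Disjoint {w} X := by
    intro w hw X hX
    rw [Set.disjoint_singleton_left]
    intro hh
    exact hX hh (by rcases hw with rfl | rfl <;> simp)
  have hadj : ∀ w, (w = u ∨ w = v) → ∀ i (X : Set W), mgI a b u v (P i) ⊆ X → ∃ x ∈ ({w} : Set W), ∃ y ∈ X, mgR a b x y := by
    intro w hw i X hX
    obtain ⟨f, hf, x, hx, hh⟩ := mgPath_end (hpath i) w hw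
    exact ⟨w, rfl, x, hX hx, f, hh⟩
  exact cnK5_of (mgR_symm a b) (cnConn_singleton _ u) (cnConn_singleton _ v) k1 k2 k3
    (by simpa using huv) (hdis u (Or.inl rfl) _ z1) (hdis u (Or.inl rfl) _ z2) (hdis u (Or.inl rfl) _ z3)
    (hdis v (Or.inr rfl) _ z1) (hdis v (Or.inr rfl) _ z2) (hdis v (Or.inr rfl) _ z3) d12 d13 d23
    ⟨u, rfl, v, rfl, e, Or.inl ⟨hu.symm, hv.symm⟩⟩
    (hadj u (Or.inl rfl) 0 _ i1) (hadj u (Or.inl rfl) 1 _ i2) (hadj u (Or.inl rfl) 2 _ i3)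
    (hadj v (Or.inr rfl) 0 _ i1) (hadj v (Or.inr rfl) 1 _ i2) (hadj v (Or.inr rfl) 2 _ i3) r12 r13 r23

end Multi

set_option linter.unusedSectionVars false

section Ideal

def mgP {W E : Type} (a b : E → W) (σ : E → ZMod 2) (y : E → ℚ) : Prop :=
  ∃ (I : Type) (_ : Fintype I) (l : I → ℚ) (s : I → W → ZMod 2), (∀ i, 0 ≤ l i) ∧ ∑ i, l i = 1 ∧
    ∀ f, ∑ i, l i * (if σ f + mgCd a b (s i) f = 1 then 1 else 0) ≤ y f

variable {W E : Type} [Fintype E] [DecidableEq E]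

theorem mgP_of_lhDom {a b : E → W} {σ : E → ZMod 2} {y : E → ℚ} (h : lhDom (mgB a b σ) y) :
    mgP a b σ y := by
  classical
  obtain ⟨l, h1, h2, h3, h4⟩ := h
  have hch : ∀ B : Finset E, ∃ s : W → ZMod 2, B ∈ mgB a b σ → ∀ f, f ∈ B ↔ σ f + mgCd a b s f = 1 := by
    intro B
    by_cases h : B ∈ mgB a b σ
    · obtain ⟨s, hs⟩ := h
      exact ⟨s, fun _ => hs⟩
    · exact ⟨fun _ => 0, fun hh => absurd hh h⟩
  choose s hs using hch
  refine ⟨Finset E, inferInstance, l, s, h1, h3, fun f => ?_⟩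
  refine le_trans (le_of_eq ?_) (h4 f)
  refine sum_congr rfl fun B _ => ?_
  by_cases hl : l B = 0
  · simp [hl]
  · have hB := h2 B hl
    congr 1
    have := hs B hB f
    by_cases hf : f ∈ B
    · rw [if_pos (this.1 hf), if_pos hf]
    · rw [if_neg (fun hh => hf (this.2 hh)), if_neg hf]

theorem mg_push {I : Type} [Fintype I] (a b : E → W) (σ : E → ZMod 2) (l : I → ℚ) (s : I → W → ZMod 2)
    (h0 : ∀ i, 0 ≤ l i) (h1 : ∑ i, l i = 1) :
    ∃ l' : Finset E → ℚ, (∀ B, 0 ≤ l' B) ∧ (∀ B, l' B ≠ 0 → B ∈ mgB a b σ) ∧ ∑ B, l' B = 1 ∧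
      ∀ f, ∑ B, l' B * (if f ∈ B then 1 else 0)
        = ∑ i, l i * (if σ f + mgCd a b (s i) f = 1 then 1 else 0) := by
  classical
  let bo : I → Finset E := fun i => univ.filter fun f => σ f + mgCd a b (s i) f = 1
  refine ⟨fun B => ∑ i, if bo i = B then l i else 0, fun B => ?_, fun B hB => ?_, ?_, fun f => ?_⟩
  · exact sum_nonneg fun i _ => by split_ifs <;> simp [h0]
  · obtain ⟨i, _, hi⟩ := exists_ne_zero_of_sum_ne_zero hB
    have : bo i = B := by
      by_contra hh
      simp [hh] at hi
    exact ⟨s i, fun f => by simp [← this, bo]⟩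
  · rw [sum_comm]; simpa using h1
  · simp_rw [sum_mul]
    rw [sum_comm]
    refine sum_congr rfl fun i _ => ?_
    simp only [ite_mul, zero_mul, sum_ite_eq, mem_univ, if_true]
    simp [bo]

theorem cnK5_contract [DecidableEq W] {a b : E → W} {j : E} {π : W → W} (hπ : ∀ x, π x = if x = b j then a j else x)
    (huv : a j ≠ b j)
    (h : cnK5 (mgR (fun f : {f // f ≠ j} => π (a f)) (fun f : {f // f ≠ j} => π (b f)))) :
    cnK5 (mgR a b) := by
  obtain ⟨X, hc, hd, ha⟩ := h
  have hpv : ∀ x, π x ≠ b j := by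
    intro x; rw [hπ]; split_ifs with h
    · exact huv
    · exact h
  have hiso : ∀ y, ¬ mgR (fun f : {f // f ≠ j} => π (a f)) (fun f : {f // f ≠ j} => π (b f)) (b j) y := by
    rintro y ⟨f, ⟨h, _⟩ | ⟨_, h⟩⟩ <;> exact hpv _ h
  have hv : ∀ i, b j ∉ X i := by
    intro i hi
    by_cases hs : (X i \ {b j}).Nonempty
    · obtain ⟨x, hx, y, _, hr⟩ := (hc i).2 {b j} (by simpa using hi) ⟨_, rfl⟩ hs
      rw [Set.mem_singleton_iff] at hx
      subst hx
      exact hiso _ hr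
    · obtain ⟨k, hk⟩ : ∃ k, i ≠ k := by
        by_cases h : i = 0
        · exact ⟨1, by rw [h]; decide⟩
        · exact ⟨0, h⟩
      obtain ⟨x, hx, y, _, hr⟩ := ha i k hk
      have : x = b j := by
        by_contra hh; exact hs ⟨x, hx, hh⟩
      exact hiso y (this ▸ hr)
  have hfix : ∀ i, ∀ x ∈ X i, π x = x := by
    intro i x hx
    rw [hπ, if_neg]
    rintro rfl; exact hv i hx
  have hR : ∀ x y, mgR (fun f : {f // f ≠ j} => π (a f)) (fun f : {f // f ≠ j} => π (b f)) x y →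
      ∃ x' y', π x' = x ∧ π y' = y ∧ mgR a b x' y' := by
    rintro x y ⟨f, ⟨h1, h2⟩ | ⟨h1, h2⟩⟩
    · exact ⟨a f, b f, h1, h2, f, Or.inl ⟨rfl, rfl⟩⟩
    · exact ⟨b f, a f, h2, h1, f, Or.inr ⟨rfl, rfl⟩⟩
  refine ⟨fun i => π ⁻¹' X i, fun i => ⟨?_, ?_⟩, fun i k hik => (hd i k hik).preimage π, fun i k hik => ?_⟩
  · obtain ⟨x, hx⟩ := (hc i).1
    exact ⟨x, by rw [Set.mem_preimage, hfix i x hx]; exact hx⟩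
  · rintro P hP ⟨p, hp⟩ ⟨q, hq, hqP⟩
    by_cases hsep : ∀ x, π x ∈ X i → (x ∈ P ↔ π x ∈ P)
    · obtain ⟨x, hx, y, hy, hr⟩ := (hc i).2 (X i ∩ P) Set.inter_subset_left
        ⟨π p, hP hp, (hsep p (hP hp)).1 hp⟩ ⟨π q, hq, fun hh => hqP ((hsep q hq).2 hh.2)⟩
      obtain ⟨x', y', rfl, rfl, hr2⟩ := hR x y hr
      exact ⟨x', (hsep x' hx.1).2 hx.2, y', ⟨hy.1, fun hh => hy.2 ⟨hy.1, (hsep y' hy.1).1 hh⟩⟩, hr2⟩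
    · push Not at hsep
      obtain ⟨x, hx, hne⟩ := hsep
      have hxv : x = b j := by
        by_contra hh
        have : π x = x := by rw [hπ, if_neg hh]
        rw [this] at hne
        tauto
      subst hxv
      have hpu : π (b j) = a j := by rw [hπ, if_pos rfl]
      have hpu' : π (a j) = a j := by rw [hπ, if_neg huv]
      rw [hpu] at hne hx
      rcases hne with ⟨h1, h2⟩ | ⟨h1, h2⟩
      · exact ⟨b j, h1, a j, ⟨by rw [Set.mem_preimage, hpu']; exact hx, h2⟩, j, Or.inr ⟨rfl, rfl⟩⟩
      · exact ⟨a j, h2, b j, ⟨by rw [Set.mem_preimage, hpu]; exact hx, h1⟩, j, Or.inl ⟨rfl, rfl⟩⟩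
  · obtain ⟨x, hx, y, hy, hr⟩ := ha i k hik
    obtain ⟨x', y', rfl, rfl, hr2⟩ := hR x y hr
    exact ⟨x', hx, y', hy, hr2⟩

theorem cnK5_mono {r r' : W → W → Prop} (h : ∀ x y, r x y → r' x y) (hk : cnK5 r) : cnK5 r' := by
  obtain ⟨X, hc, hd, ha⟩ := hk
  refine ⟨X, fun i => ⟨(hc i).1, fun P hP h1 h2 => ?_⟩, hd, fun i k hik => ?_⟩
  · obtain ⟨x, hx, y, hy, hr⟩ := (hc i).2 P hP h1 h2
    exact ⟨x, hx, y, hy, h _ _ hr⟩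
  · obtain ⟨x, hx, y, hy, hr⟩ := ha i k hik
    exact ⟨x, hx, y, hy, h _ _ hr⟩

theorem mg_ideal_aux [Finite W] (n : ℕ) : ∀ (E : Type) [Fintype E] [DecidableEq E], Fintype.card E = n →
    ∀ (a b : E → W), ¬ cnK5 (mgR a b) → ∀ σ y, lhQ (mgA a b σ) y → lhDom (mgB a b σ) y := by
  classical
  induction n using Nat.strong_induction_on with
  | _ n ih =>
  intro E _ _ hn a b hK σ y hQ
  by_contra hD
  have hlt : ∀ j : E, Fintype.card {f // f ≠ j} < n := by
    intro j; rw [← hn]; exact Fintype.card_subtype_lt (x := j) (by simp)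
  have hdel : ∀ j, lhDel (mgA a b σ) (mgB a b σ) j := by
    intro j y hy0 hy
    have hK' : ¬ cnK5 (mgR (fun f : {f // f ≠ j} => a f) (fun f : {f // f ≠ j} => b f)) := by
      intro hh
      refine hK (cnK5_mono ?_ hh)
      rintro x y ⟨f, hf⟩
      exact ⟨f, hf⟩
    have := ih _ (hlt j) {f // f ≠ j} rfl (fun f => a f) (fun f => b f) hK' (fun f => σ f) (fun f => y f)
      ⟨fun f => hy0 f, fun C hC => ?_⟩
    · obtain ⟨I, _, l, s, h1, h2, h3⟩ := mgP_of_lhDom this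
      obtain ⟨l', g1, g2, g3, g4⟩ := mg_push a b σ l s h1 h2
      exact ⟨l', g1, g2, g3, fun f hf => by rw [g4]; exact h3 ⟨f, hf⟩⟩
    · have := hy (C.map (Function.Embedding.subtype _)) ⟨fun s => ?_, ?_⟩ (by simp)
      · simpa [sum_map] using this
      · rw [sum_map]; exact hC.1 s
      · simpa [sum_map] using hC.2
  have hcon : ∀ j, lhCon (mgA a b σ) (mgB a b σ) j := by
    intro j y hy hyj
    by_cases huv : a j = b j
    · have hσ : σ j = 0 := by
        by_contra hh
        have := hy.2 {j} ⟨fun s => by simp [mgCd, huv, z2_add_self], by simpa using z2_ne_zero.1 hh⟩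
        simp [hyj] at this
        linarith
      obtain ⟨l', g1, g2, g3, g4⟩ := hdel j y hy.1 (fun C hC _ => hy.2 C hC)
      refine ⟨l', g1, g2, g3, fun f => ?_⟩
      by_cases hf : f = j
      · subst hf
        rw [hyj]
        refine le_of_eq (sum_eq_zero fun B _ => ?_)
        by_cases hl : l' B = 0
        · simp [hl]
        · obtain ⟨s, hs⟩ := g2 B hl
          have : f ∉ B := by
            rw [hs, hσ, mgCd, huv, z2_add_self]; decide
          simp [this]
      · exact g4 f hf
    · let r : W → ZMod 2 := fun x => if x = b j then σ j else 0
      let π : W → W := fun x => if x = b j then a j else x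
      have hrj : mgCd a b r j = σ j := by simp [mgCd, r, huv]
      have hdec : ∀ (s : W → ZMod 2) f, mgCd a b s f = mgCd a b (fun x => s (π x)) f +
          (s (a j) + s (b j)) * mgCd a b (fun x => if x = b j then 1 else 0) f := by
        intro s f
        have key : ∀ x, s x = s (π x) + (s (a j) + s (b j)) * (if x = b j then 1 else 0) := by
          intro x
          by_cases hx : x = b j
          · simp only [π, hx, if_true, mul_one, ← add_assoc, z2_add_self, zero_add]
          · simp [π, hx]
        simp only [mgCd]
        conv_lhs => rw [key (a f), key (b f)]
        ring
      have hK' : ¬ cnK5 (mgR (fun f : {f // f ≠ j} => π (a f)) (fun f : {f // f ≠ j} => π (b f))) :=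
        fun hh => hK (cnK5_contract (fun x => rfl) huv hh)
      have := ih _ (hlt j) {f // f ≠ j} rfl (fun f => π (a f)) (fun f => π (b f)) hK'
        (fun f => σ f + mgCd a b r f) (fun f => y f) ⟨fun f => hy.1 f, fun C hC => ?_⟩
      · obtain ⟨I, _, l, s, h1, h2, h3⟩ := mgP_of_lhDom this
        obtain ⟨l', g1, g2, g3, g4⟩ := mg_push a b σ l (fun i x => r x + s i (π x)) h1 h2
        refine ⟨l', g1, g2, g3, fun f => ?_⟩
        rw [g4]
        by_cases hf : f = j
        · subst hf
          rw [hyj]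
          refine le_of_eq (sum_eq_zero fun i _ => ?_)
          rw [mgCd_add, hrj, if_neg, mul_zero]
          rw [← add_assoc, z2_add_self, zero_add]
          simp [mgCd, π, huv, z2_add_self]
        · refine le_trans (le_of_eq ?_) (h3 ⟨f, hf⟩)
          refine sum_congr rfl fun i _ => ?_
          rw [mgCd_add, ← add_assoc]
          rfl
      · set D := C.map (Function.Embedding.subtype _) with hDdef
        have hjD : j ∉ D := by simp [hDdef]
        have e1 : ∀ s, ∑ f ∈ D, mgCd a b s f =
            (s (a j) + s (b j)) * ∑ f ∈ D, mgCd a b (fun x => if x = b j then 1 else 0) f := by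
          intro s
          rw [sum_congr rfl fun f _ => hdec s f, sum_add_distrib, ← mul_sum]
          have := hC.1 s
          have e : ∑ f ∈ D, mgCd a b (fun x => s (π x)) f = 0 := by
            rw [← this, hDdef, sum_map]; rfl
          rw [e, zero_add]
        have e2 : ∑ f ∈ D, σ f + ∑ f ∈ D, mgCd a b r f = 1 := by
          rw [← sum_add_distrib, ← hC.2, hDdef, sum_map]; rfl
        have e3 : ∑ f ∈ D, y f = ∑ f ∈ C, y f := by rw [hDdef, sum_map]; rfl
        rw [← e3]
        rcases z2_cases (∑ f ∈ D, mgCd a b (fun x => if x = b j then 1 else 0) f) with h0 | h0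
        · refine hy.2 D ⟨fun s => by rw [e1, h0, mul_zero], ?_⟩
          rw [← e2, e1 r, h0, mul_zero, add_zero]
        · have := hy.2 (insert j D) ⟨fun s => by
            rw [sum_insert hjD, e1, h0, mul_one]; exact z2_add_self _, ?_⟩
          · rwa [sum_insert hjD, hyj, zero_add] at this
          · rw [sum_insert hjD, ← e2, e1 r, h0, mul_one, add_comm, ← hrj]; rfl
  obtain ⟨e, C, B, h⟩ := lh_structure (mgA a b σ) (mgB a b σ) (mg_odd a b σ) (mgA3 a b σ) (mgB3 a b σ)
    (mgB_nonempty a b σ) hdel hcon ⟨y, hQ, hD⟩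
  exact hK (mg_conf_K5 a b σ e C B h)

theorem mg_ideal [Finite W] (a b : E → W) (hK : ¬ cnK5 (mgR a b)) (σ : E → ZMod 2) (y : E → ℚ)
    (h : lhQ (mgA a b σ) y) : mgP a b σ y :=
  mgP_of_lhDom (mg_ideal_aux _ E rfl a b hK σ y h)

end Ideal

set_option linter.unusedSectionVars false

section BM
variable {W E : Type} [Fintype E] [DecidableEq E]

theorem sum_prod_bool {M : Type} [AddCommMonoid M] (C : Finset (E × Bool)) (g : E × Bool → M) :
    ∑ f ∈ C, g f = ∑ f ∈ univ.filter (fun f => (f, false) ∈ C), g (f, false)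
      + ∑ f ∈ univ.filter (fun f => (f, true) ∈ C), g (f, true) := by
  have : ∑ f ∈ C, g f = ∑ f : E × Bool, if f ∈ C then g f else 0 := by simp
  rw [this, Fintype.sum_prod_type, sum_filter, sum_filter, ← sum_add_distrib]
  refine sum_congr rfl fun f _ => ?_
  rw [Fintype.sum_bool, add_comm]

theorem mg_bm [Finite W] (a b : E → W) (hK : ¬ cnK5 (mgR a b)) (z : E → ℚ) (h0 : ∀ f, 0 ≤ z f)
    (h1 : ∀ f, z f ≤ 1)
    (h : ∀ F₀ F₁ : Finset E, Disjoint F₀ F₁ → mgCyc a b (F₀ ∪ F₁) → Odd F₁.card →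
      1 ≤ ∑ f ∈ F₀, z f + ∑ f ∈ F₁, (1 - z f)) :
    ∃ (I : Type) (_ : Fintype I) (l : I → ℚ) (s : I → W → ZMod 2), (∀ i, 0 ≤ l i) ∧ ∑ i, l i = 1 ∧
      ∀ f, ∑ i, l i * (if mgCd a b (s i) f = 1 then 1 else 0) = z f := by
  let a' : E × Bool → W := fun f => a f.1
  let b' : E × Bool → W := fun f => b f.1
  let σ : E × Bool → ZMod 2 := fun f => if f.2 then 1 else 0
  let y : E × Bool → ℚ := fun f => if f.2 then 1 - z f.1 else z f.1
  have hK' : ¬ cnK5 (mgR a' b') := by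
    intro hh
    refine hK (cnK5_mono ?_ hh)
    rintro p q ⟨f, hf⟩
    exact ⟨f.1, hf⟩
  have hy0 : ∀ f, 0 ≤ y f := by
    rintro ⟨f, _ | _⟩
    · simpa [y] using h0 f
    · simpa [y] using h1 f
  obtain ⟨I, _, l, s, g1, g2, g3⟩ := mg_ideal a' b' hK' σ y ⟨hy0, fun C hC => by
    set F₀ := univ.filter (fun f => (f, false) ∈ C) with hF₀
    set F₁ := univ.filter (fun f => (f, true) ∈ C) with hF₁
    have e1 : ∑ f ∈ C, y f = ∑ f ∈ F₀, z f + ∑ f ∈ F₁, (1 - z f) := by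
      rw [sum_prod_bool]; simp [y, hF₀, hF₁]
    have n0 : 0 ≤ ∑ f ∈ F₀, z f := sum_nonneg fun f _ => h0 f
    have n1 : 0 ≤ ∑ f ∈ F₁, (1 - z f) := sum_nonneg fun f _ => sub_nonneg.2 (h1 f)
    rw [e1]
    by_cases hd : Disjoint F₀ F₁
    · refine h F₀ F₁ hd (fun s => ?_) ?_
      · rw [sum_union hd]
        have := hC.1 s
        rw [sum_prod_bool] at this
        exact this
      · rw [← ZMod.natCast_eq_one_iff_odd]
        have := hC.2
        rw [sum_prod_bool] at this
        simpa [σ] using this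
    · rw [not_disjoint_iff] at hd
      obtain ⟨f, hf0, hf1⟩ := hd
      have := single_le_sum (f := z) (fun f _ => h0 f) hf0
      have := single_le_sum (f := fun f => 1 - z f) (fun f _ => sub_nonneg.2 (h1 f)) hf1
      linarith⟩
  refine ⟨I, inferInstance, l, s, g1, g2, fun f => le_antisymm ?_ ?_⟩
  · have := g3 (f, false)
    have e : ∀ i, l i * (if mgCd a b (s i) f = 1 then (1:ℚ) else 0)
        = l i * (if σ (f, false) + mgCd a' b' (s i) (f, false) = 1 then (1:ℚ) else 0) := by
      intro i
      have : mgCd a' b' (s i) (f, false) = mgCd a b (s i) f := rfl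
      rw [this]
      rcases z2_cases (mgCd a b (s i) f) with h | h <;> rw [h] <;> simp [σ]
    rw [sum_congr rfl fun i _ => e i]
    exact this
  · have := g3 (f, true)
    have e : ∀ i, l i * (if σ (f, true) + mgCd a' b' (s i) (f, true) = 1 then (1:ℚ) else 0)
        = l i - l i * (if mgCd a b (s i) f = 1 then 1 else 0) := by
      intro i
      have : mgCd a' b' (s i) (f, true) = mgCd a b (s i) f := rfl
      rw [this]
      rcases z2_cases (mgCd a b (s i) f) with h | h <;> rw [h] <;> simp [σ]
    simp only [e, sum_sub_distrib, g2] at this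
    simp only [y] at this
    simp only [if_true] at this
    linarith

end BM

theorem exists_parity (t₀ : ℚ) (h0 : 0 ≤ t₀) (p : ℤ) : ∃ t : ℤ, 0 ≤ t ∧ (2:ℤ) ∣ t - p ∧
    ((t : ℚ) ≤ t₀ ∨ t = 1) ∧ (∀ m : ℤ, (2:ℤ) ∣ m - p → (m : ℚ) ≤ t₀ → m ≤ t) ∧
    (∀ m : ℤ, (2:ℤ) ∣ m - p → t₀ ≤ m → t ≤ m) := by
  obtain ⟨t1, h1, h2, h3⟩ : ∃ t1 : ℤ, (2:ℤ) ∣ t1 - p ∧ (t1 : ℚ) ≤ t₀ ∧ t₀ < t1 + 2 := by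
    refine ⟨p + 2 * ⌊(t₀ - p) / 2⌋, ⟨⌊(t₀ - p) / 2⌋, by rw [add_sub_cancel_left]⟩, ?_, ?_⟩
    · have := Int.floor_le ((t₀ - p) / 2)
      push_cast; linarith
    · have := Int.lt_floor_add_one ((t₀ - p) / 2)
      push_cast; linarith
  have hm : ∀ m : ℤ, (2:ℤ) ∣ m - p → (m : ℚ) ≤ t₀ → m ≤ t1 := by
    intro m hm hle
    have : (m : ℚ) < t1 + 2 := lt_of_le_of_lt hle h3
    have : m < t1 + 2 := by exact_mod_cast this
    omega
  have hM : ∀ m : ℤ, t₀ ≤ m → t1 ≤ m := by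
    intro m hle
    exact_mod_cast h2.trans hle
  by_cases ht : 0 ≤ t1
  · exact ⟨t1, ht, h1, Or.inl h2, hm, fun m _ h => hM m h⟩
  · have : (0:ℚ) < t1 + 2 := lt_of_le_of_lt h0 h3
    have : (0:ℤ) < t1 + 2 := by exact_mod_cast this
    have : t1 = -1 := by omega
    subst this
    refine ⟨1, by norm_num, by omega, Or.inr rfl, fun m hp h => (hm m hp h).trans (by norm_num), fun m hp h => ?_⟩
    have : (0:ℚ) ≤ m := h0.trans h
    have : (0:ℤ) ≤ m := by exact_mod_cast this
    omega

set_option linter.unusedSectionVars false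

section Rep

theorem cutFun_mk (S : Finset V) (v w : V) : cutFun S s(v, w) = if (v ∈ S ↔ w ∈ S) then 0 else 1 := by
  simp only [cutFun, Sym2.lift_mk]
  by_cases h1 : v ∈ S <;> by_cases h2 : w ∈ S <;> simp [h1, h2]

def rpZ (G : SimpleGraph V) (x : Sym2 V → ℤ) (n : ℤ) : Prop :=
  ∃ (I : Type) (_ : Fintype I) (d : I → ℤ) (S : I → Finset V), ∑ i, d i = n ∧
    ∀ e ∈ G.edgeSet, ∑ i, d i * cutFun (S i) e = x e

def rpN (G : SimpleGraph V) (x : Sym2 V → ℤ) (n : ℤ) : Prop :=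
  ∃ (I : Type) (_ : Fintype I) (d : I → ℤ) (S : I → Finset V), (∀ i, 0 ≤ d i) ∧ ∑ i, d i = n ∧
    ∀ e ∈ G.edgeSet, ∑ i, d i * cutFun (S i) e = x e

def rpQ (G : SimpleGraph V) (x : Sym2 V → ℤ) (n : ℤ) : Prop :=
  ∃ (I : Type) (_ : Fintype I) (d : I → ℚ) (S : I → Finset V), (∀ i, 0 ≤ d i) ∧ ∑ i, d i = n ∧
    ∀ e ∈ G.edgeSet, ∑ i, d i * (cutFun (S i) e : ℚ) = x e

def xv (G : SimpleGraph V) (S : Finset V) : Option G.edgeSet → ℤ :=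
  fun o => Option.elim o 1 (fun e => cutFun S e.1)

def xr (G : SimpleGraph V) (x : Sym2 V → ℤ) (n : ℤ) : Option G.edgeSet → ℤ :=
  fun o => Option.elim o n (fun e => x e.1)

theorem sum_image_coef {I X M R : Type} [Fintype I] [DecidableEq X] [Semiring R] [AddCommMonoid M] [Module R M]
    (v : I → X) (d : I → R) (g : X → M) :
    ∑ b ∈ univ.image v, (∑ i ∈ univ.filter (fun i => v i = b), d i) • g b = ∑ i, d i • g (v i) := by
  rw [← sum_fiberwise_of_maps_to (s := univ) (t := univ.image v) (g := v) (fun i _ => mem_image_of_mem _ (mem_univ i))]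
  refine sum_congr rfl fun b _ => ?_
  rw [sum_smul]
  refine sum_congr rfl fun i hi => ?_
  rw [(mem_filter.1 hi).2]

theorem xr_eq_iffZ (G : SimpleGraph V) (x : Sym2 V → ℤ) (n : ℤ) {I : Type} [Fintype I] (d : I → ℤ) (S : I → Finset V) :
    xr G x n = ∑ i, d i • xv G (S i) ↔ ∑ i, d i = n ∧ ∀ e ∈ G.edgeSet, ∑ i, d i * cutFun (S i) e = x e := by
  constructor
  · intro h
    refine ⟨?_, fun e he => ?_⟩
    · have := congrFun h none
      simpa [xr, xv, Finset.sum_apply] using this.symm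
    · have := congrFun h (some ⟨e, he⟩)
      simpa [xr, xv, Finset.sum_apply] using this.symm
  · rintro ⟨h1, h2⟩
    funext o
    rcases o with _ | ⟨e, he⟩
    · simpa [xr, xv, Finset.sum_apply] using h1.symm
    · simpa [xr, xv, Finset.sum_apply] using (h2 e he).symm

theorem xr_eq_iffQ (G : SimpleGraph V) (x : Sym2 V → ℤ) (n : ℤ) {I : Type} [Fintype I] (d : I → ℚ) (S : I → Finset V) :
    toQ (xr G x n) = ∑ i, d i • toQ (xv G (S i)) ↔
      ∑ i, d i = n ∧ ∀ e ∈ G.edgeSet, ∑ i, d i * (cutFun (S i) e : ℚ) = x e := by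
  constructor
  · intro h
    refine ⟨?_, fun e he => ?_⟩
    · have := congrFun h none
      simpa [xr, xv, toQ, Finset.sum_apply] using this.symm
    · have := congrFun h (some ⟨e, he⟩)
      simpa [xr, xv, toQ, Finset.sum_apply] using this.symm
  · rintro ⟨h1, h2⟩
    funext o
    rcases o with _ | ⟨e, he⟩
    · simpa [xr, xv, toQ, Finset.sum_apply] using h1.symm
    · simpa [xr, xv, toQ, Finset.sum_apply] using (h2 e he).symm

theorem rp_fwd {R M : Type} [Semiring R] [AddCommMonoid M] [Module R M] (G : SimpleGraph V)
    (s : Finset (Option G.edgeSet → ℤ)) (c : (Option G.edgeSet → ℤ) → R) (hs : ↑s ⊆ XG G) (P : R → Prop)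
    (hc : ∀ b ∈ s, P (c b)) (g : (Option G.edgeSet → ℤ) → M) :
    ∃ (I : Type) (_ : Fintype I) (d : I → R) (S : I → Finset V), (∀ i, P (d i)) ∧
      ∑ b ∈ s, c b • g b = ∑ i, d i • g (xv G (S i)) := by
  have : ∀ b : s, ∃ S : Finset V, b.1 = xv G S := fun b => hs b.2
  choose S hS using this
  refine ⟨s, inferInstance, fun b => c b, S, fun b => hc b b.2, ?_⟩
  rw [← sum_coe_sort]
  refine sum_congr rfl fun b _ => ?_
  rw [← hS]

theorem mem_zSpan_iff (G : SimpleGraph V) (x : Sym2 V → ℤ) (n : ℤ) : xr G x n ∈ zSpan (XG G) ↔ rpZ G x n := by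
  classical
  constructor
  · rintro ⟨s, c, hs, hx⟩
    obtain ⟨I, _, d, S, _, h⟩ := rp_fwd G s c hs (fun _ => True) (fun _ _ => trivial) id
    exact ⟨I, inferInstance, d, S, (xr_eq_iffZ G x n d S).1 (hx.trans h)⟩
  · rintro ⟨I, _, d, S, h⟩
    refine ⟨univ.image fun i => xv G (S i), fun b => ∑ i ∈ univ.filter (fun i => xv G (S i) = b), d i, ?_, ?_⟩
    · intro b hb
      obtain ⟨i, _, rfl⟩ := mem_image.1 (mem_coe.1 hb)
      exact ⟨S i, rfl⟩
    · rw [(xr_eq_iffZ G x n d S).2 h]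
      exact (sum_image_coef (fun i => xv G (S i)) d id).symm

theorem mem_zPlus_iff (G : SimpleGraph V) (x : Sym2 V → ℤ) (n : ℤ) : xr G x n ∈ zPlus (XG G) ↔ rpN G x n := by
  classical
  constructor
  · rintro ⟨s, c, hs, hc, hx⟩
    obtain ⟨I, _, d, S, hd, h⟩ := rp_fwd G s c hs (fun r => 0 ≤ r) hc id
    exact ⟨I, inferInstance, d, S, hd, (xr_eq_iffZ G x n d S).1 (hx.trans h)⟩
  · rintro ⟨I, _, d, S, hd, h⟩
    refine ⟨univ.image fun i => xv G (S i), fun b => ∑ i ∈ univ.filter (fun i => xv G (S i) = b), d i, ?_,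
      fun b _ => sum_nonneg fun i _ => hd i, ?_⟩
    · intro b hb
      obtain ⟨i, _, rfl⟩ := mem_image.1 (mem_coe.1 hb)
      exact ⟨S i, rfl⟩
    · rw [(xr_eq_iffZ G x n d S).2 h]
      exact (sum_image_coef (fun i => xv G (S i)) d id).symm

theorem mem_qPlus_iff (G : SimpleGraph V) (x : Sym2 V → ℤ) (n : ℤ) : toQ (xr G x n) ∈ qPlus (XG G) ↔ rpQ G x n := by
  classical
  constructor
  · rintro ⟨s, c, hs, hc, hx⟩
    obtain ⟨I, _, d, S, hd, h⟩ := rp_fwd G s c hs (fun r => 0 ≤ r) hc toQ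
    exact ⟨I, inferInstance, d, S, hd, (xr_eq_iffQ G x n d S).1 (hx.trans h)⟩
  · rintro ⟨I, _, d, S, hd, h⟩
    refine ⟨univ.image fun i => xv G (S i), fun b => ∑ i ∈ univ.filter (fun i => xv G (S i) = b), d i, ?_,
      fun b _ => sum_nonneg fun i _ => hd i, ?_⟩
    · intro b hb
      obtain ⟨i, _, rfl⟩ := mem_image.1 (mem_coe.1 hb)
      exact ⟨S i, rfl⟩
    · rw [(xr_eq_iffQ G x n d S).2 h]
      exact (sum_image_coef (fun i => xv G (S i)) d toQ).symm

theorem rpN_rpZ {G : SimpleGraph V} {x : Sym2 V → ℤ} {n : ℤ} (h : rpN G x n) : rpZ G x n := by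
  obtain ⟨I, _, d, S, _, h⟩ := h
  exact ⟨I, inferInstance, d, S, h⟩

theorem rpN_rpQ {G : SimpleGraph V} {x : Sym2 V → ℤ} {n : ℤ} (h : rpN G x n) : rpQ G x n := by
  obtain ⟨I, _, d, S, h0, h1, h2⟩ := h
  refine ⟨I, inferInstance, fun i => d i, S, fun i => by beta_reduce; exact_mod_cast h0 i, by beta_reduce; exact_mod_cast h1, fun e he => ?_⟩
  beta_reduce
  exact_mod_cast h2 e he

theorem exists_xr (G : SimpleGraph V) (y : Option G.edgeSet → ℤ) : ∃ x n, y = xr G x n := by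
  classical
  refine ⟨fun e => if h : e ∈ G.edgeSet then y (some ⟨e, h⟩) else 0, y none, ?_⟩
  funext o
  rcases o with _ | ⟨e, he⟩
  · rfl
  · simp [xr, he]

theorem isNormal_iff (G : SimpleGraph V) :
    IsNormal G ↔ ∀ x n, rpZ G x n → rpQ G x n → rpN G x n := by
  constructor
  · intro h x n h1 h2
    rw [← mem_zPlus_iff, h]
    exact ⟨(mem_zSpan_iff G x n).2 h1, (mem_qPlus_iff G x n).2 h2⟩
  · intro h
    ext y
    obtain ⟨x, n, rfl⟩ := exists_xr G y
    rw [mem_zPlus_iff, Set.mem_inter_iff, mem_zSpan_iff, Set.mem_preimage, mem_qPlus_iff]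
    exact ⟨fun hh => ⟨rpN_rpZ hh, rpN_rpQ hh⟩, fun hh => h x n hh.1 hh.2⟩

end Rep

set_option linter.unusedSectionVars false

section Core

def iv (z : ZMod 2) : ℤ := if z = 1 then 1 else 0

theorem iv_cast (z : ZMod 2) : (iv z : ZMod 2) = z := by
  rcases z2_cases z with h | h <;> rw [h] <;> simp [iv]

theorem iv_nonneg (z : ZMod 2) : 0 ≤ iv z := by unfold iv; split_ifs <;> norm_num
theorem iv_le (z : ZMod 2) : iv z ≤ 1 := by unfold iv; split_ifs <;> norm_num

variable {W E : Type} [Fintype E] [DecidableEq E]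

theorem inner_odd (a b : E → W) (F₀ F₁ : Finset E) (hd : Disjoint F₀ F₁) (hc : mgCyc a b (F₀ ∪ F₁))
    (ho : Odd F₁.card) (s : W → ZMod 2) :
    Odd (∑ f ∈ F₀, iv (mgCd a b s f) + ∑ f ∈ F₁, (1 - iv (mgCd a b s f))) ∧
    1 ≤ ∑ f ∈ F₀, iv (mgCd a b s f) + ∑ f ∈ F₁, (1 - iv (mgCd a b s f)) := by
  have h1 : Odd (∑ f ∈ F₀, iv (mgCd a b s f) + ∑ f ∈ F₁, (1 - iv (mgCd a b s f))) := by
    rw [← ZMod.intCast_eq_one_iff_odd]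
    push_cast
    simp only [iv_cast]
    have := hc s
    rw [sum_union hd] at this
    have hcard := ZMod.natCast_eq_one_iff_odd.2 ho
    rw [sum_sub_distrib]
    simp only [sum_const, nsmul_eq_mul, mul_one]
    rw [z2_add_eq_zero.1 this, hcard]
    ring
  refine ⟨h1, ?_⟩
  have h2 : 0 ≤ ∑ f ∈ F₀, iv (mgCd a b s f) := sum_nonneg fun f _ => iv_nonneg _
  have h3 : 0 ≤ ∑ f ∈ F₁, (1 - iv (mgCd a b s f)) := sum_nonneg fun f _ => sub_nonneg.2 (iv_le _)
  obtain ⟨k, hk⟩ := h1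
  omega

theorem wt_swap {R I : Type} [CommRing R] [Fintype I] (F₀ F₁ : Finset E) (d : I → R) (n : R) (hn : ∑ i, d i = n)
    (g : I → E → R) :
    ∑ f ∈ F₀, (∑ i, d i * g i f) + ∑ f ∈ F₁, (n - ∑ i, d i * g i f)
      = ∑ i, d i * (∑ f ∈ F₀, g i f + ∑ f ∈ F₁, (1 - g i f)) := by
  have e2 : ∀ f, n - ∑ i, d i * g i f = ∑ i, d i * (1 - g i f) := by
    intro f; rw [← hn, ← sum_sub_distrib]; exact sum_congr rfl fun i _ => by ring
  simp only [e2]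
  rw [sum_comm, sum_comm (s := F₁), ← sum_add_distrib]
  refine sum_congr rfl fun i _ => ?_
  rw [mul_add, mul_sum, mul_sum]

theorem L_shift (F₀ F₁ : Finset (Option E)) (P h : Option E → ℚ) (n : ℚ) (hh : ∀ f, h (some f) = P (some f)) :
    ∑ f ∈ F₀, h f + ∑ f ∈ F₁, (n - h f) = ∑ f ∈ F₀, P f + ∑ f ∈ F₁, (n - P f)
      + (if none ∈ F₀ then h none - P none else 0) - (if none ∈ F₁ then h none - P none else 0) := by
  have e : ∀ f, h f = P f + if none = f then h none - P none else 0 := by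
    rintro (_ | f)
    · simp
    · simp [hh]
  have e2 : ∀ f, n - h f = (n - P f) - if none = f then h none - P none else 0 := by
    intro f; rw [e f]; ring
  rw [sum_congr rfl fun f _ => e f, sum_congr (s₁ := F₁) rfl fun f _ => e2 f, sum_add_distrib, sum_sub_distrib,
    sum_ite_eq, sum_ite_eq]
  ring

theorem lift_core [Finite W] (a b : Option E → W) (hK : ¬ cnK5 (mgR a b)) {I J : Type} [Fintype I] [Fintype J]
    (d : I → ℤ) (φ : I → W → ZMod 2) (c : J → ℚ) (ψ : J → W → ZMod 2) (n : ℤ) (hn : 0 < n)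
    (hd : ∑ i, d i = n) (hc : ∑ j, c j = n) (hc0 : ∀ j, 0 ≤ c j)
    (hdc : ∀ f : E, ((∑ i, d i * iv (mgCd a b (φ i) (some f)) : ℤ) : ℚ) = ∑ j, c j * (iv (mgCd a b (ψ j) (some f)) : ℚ)) :
    ∃ t : ℤ, (2:ℤ) ∣ t - ∑ i, d i * iv (mgCd a b (φ i) none) ∧
    ∃ (K : Type) (_ : Fintype K) (l : K → ℚ) (s : K → W → ZMod 2), (∀ i, 0 ≤ l i) ∧ ∑ i, l i = n ∧
      (∀ f : E, ∑ k, l k * (iv (mgCd a b (s k) (some f)) : ℚ) = ((∑ i, d i * iv (mgCd a b (φ i) (some f)) : ℤ) : ℚ)) ∧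
      ∑ k, l k * (iv (mgCd a b (s k) none) : ℚ) = t := by
  have hnQ : (0:ℚ) < n := by exact_mod_cast hn
  let P : Option E → ℤ := fun f => ∑ i, d i * iv (mgCd a b (φ i) f)
  let Q : Option E → ℚ := fun f => ∑ j, c j * (iv (mgCd a b (ψ j) f) : ℚ)
  have hPQ : ∀ f, Q (some f) = (P (some f) : ℚ) := fun f => (hdc f).symm
  have hQ0 : ∀ f, 0 ≤ Q f := fun f => sum_nonneg fun j _ => mul_nonneg (hc0 j) (by exact_mod_cast iv_nonneg _)
  have hQn : ∀ f, Q f ≤ n := by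
    intro f; rw [← hc]
    refine sum_le_sum fun j _ => mul_le_of_le_one_right (hc0 j) (by exact_mod_cast iv_le _)
  obtain ⟨t, ht0, ht2, ht3, ht4, ht5⟩ := exists_parity (Q none) (hQ0 none) (P none)
  have htn : t ≤ n := by
    rcases ht3 with h | h
    · exact_mod_cast h.trans (hQn none)
    · omega
  refine ⟨t, ht2, ?_⟩
  let zz : Option E → ℚ := fun f => Option.elim f (t : ℚ) (fun f => (P (some f) : ℚ))
  have hzP : ∀ f, zz (some f) = P (some f) := fun f => rfl
  have hz0 : ∀ f, 0 ≤ zz f := by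
    rintro (_ | f)
    · show (0:ℚ) ≤ t
      exact_mod_cast ht0
    · rw [hzP, ← hPQ]; exact hQ0 _
  have hzn : ∀ f, zz f ≤ n := by
    rintro (_ | f)
    · show (t:ℚ) ≤ n
      exact_mod_cast htn
    · rw [hzP, ← hPQ]; exact hQn _
  obtain ⟨K, _, l, s, l0, l1, l2⟩ := mg_bm a b hK (fun f => zz f / n) (fun f => div_nonneg (hz0 f) hnQ.le)
    (fun f => (div_le_one hnQ).2 (hzn f)) (by
    intro F₀ F₁ hdis hcyc hodd
    have e : ∑ f ∈ F₀, zz f / n + ∑ f ∈ F₁, (1 - zz f / n) = (∑ f ∈ F₀, zz f + ∑ f ∈ F₁, (n - zz f)) / n := by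
      rw [add_div, sum_div, sum_div]
      congr 1
      refine sum_congr rfl fun f _ => ?_
      field_simp
    rw [e, le_div_iff₀ hnQ, one_mul]
    have hQL : (n:ℚ) ≤ ∑ f ∈ F₀, Q f + ∑ f ∈ F₁, (n - Q f) := by
      have := wt_swap F₀ F₁ c (n : ℚ) hc (fun j f => (iv (mgCd a b (ψ j) f) : ℚ))
      rw [this, ← hc]
      refine sum_le_sum fun j _ => le_mul_of_one_le_right (hc0 j) ?_
      exact_mod_cast (inner_odd a b F₀ F₁ hdis hcyc hodd (ψ j)).2
    have hPL : (2:ℤ) ∣ (∑ f ∈ F₀, P f + ∑ f ∈ F₁, (n - P f)) - n := by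
      have := wt_swap F₀ F₁ d n hd (fun j f => iv (mgCd a b (φ j) f))
      rw [this, ← hd, ← sum_sub_distrib]
      refine dvd_sum fun i _ => ?_
      obtain ⟨k, hk⟩ := (inner_odd a b F₀ F₁ hdis hcyc hodd (φ i)).1
      rw [hk]
      exact ⟨d i * k, by ring⟩
    have sz := L_shift F₀ F₁ (fun f => (P f : ℚ)) zz n (fun f => hzP f)
    have sQ := L_shift F₀ F₁ (fun f => (P f : ℚ)) Q n (fun f => hPQ f)
    have hL : ∑ f ∈ F₀, (P f : ℚ) + ∑ f ∈ F₁, ((n : ℚ) - P f) = ((∑ f ∈ F₀, P f + ∑ f ∈ F₁, (n - P f) : ℤ) : ℚ) := by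
      push_cast; rfl
    rw [hL] at sz sQ
    set LP := ∑ f ∈ F₀, P f + ∑ f ∈ F₁, (n - P f) with hLP
    have hzn : zz none = t := rfl
    by_cases h0 : none ∈ F₀
    · have h1 : none ∉ F₁ := fun hh => (disjoint_left.1 hdis h0 hh)
      simp only [h0, h1, if_true, if_false, hzn] at sz sQ
      have := ht4 (n - LP + P none) (by omega) (by push_cast; linarith)
      have : ((n - LP + P none : ℤ) : ℚ) ≤ t := by exact_mod_cast this
      push_cast at this
      rw [sz]; linarith
    · by_cases h1 : none ∈ F₁
      · simp only [h0, h1, if_true, if_false, hzn] at sz sQ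
        have := ht5 (LP - n + P none) (by omega) (by push_cast; linarith)
        have : (t : ℚ) ≤ ((LP - n + P none : ℤ) : ℚ) := by exact_mod_cast this
        push_cast at this
        rw [sz]; linarith
      · simp only [h0, h1, if_false] at sz sQ
        rw [sz]; linarith)
  have key : ∀ f, ∑ k, (n * l k) * (iv (mgCd a b (s k) f) : ℚ) = zz f := by
    intro f
    have := l2 f
    rw [eq_div_iff hnQ.ne'] at this
    rw [← this, sum_mul]
    refine sum_congr rfl fun k _ => ?_
    simp only [iv]
    push_cast
    ring
  exact ⟨K, inferInstance, fun k => n * l k, s, fun k => mul_nonneg hnQ.le (l0 k), by rw [← mul_sum, l1, mul_one],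
    fun f => key (some f), key none⟩

end Core

set_option linter.unusedSectionVars false

section Quot

def qp (T : Finset V) (v : V) : Option T := if h : v ∈ T then some ⟨v, h⟩ else none

def qR (G : SimpleGraph V) (T : Finset V) (p q : Option T) : Prop :=
  ∃ v w, G.Adj v w ∧ qp T v = p ∧ qp T w = q

theorem cut_of_pot (S : Finset V) (g : V → ZMod 2) (c : ZMod 2) (h : ∀ v, v ∈ S ↔ g v ≠ c) (v w : V) :
    cutFun S s(v, w) = iv (g v + g w) := by
  rw [cutFun_mk]
  simp only [h]
  clear h
  generalize g v = x
  generalize g w = y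
  revert x y c
  unfold iv
  decide

theorem cut_four (u v : V) (hne : u ≠ v) (p q : V) (hpq : p ≠ q) (h : s(p, q) ≠ s(u, v)) :
    cutFun {u} s(p, q) + cutFun {v} s(p, q) = cutFun {u, v} s(p, q) := by
  simp only [ne_eq, Sym2.eq_iff, not_or, not_and] at h
  simp only [cutFun_mk, mem_singleton, mem_insert]
  by_cases a1 : p = u
  · subst a1
    have := h.1 rfl
    simp [hne, hpq.symm, this]
  · by_cases a2 : p = v
    · subst a2
      have := h.2 rfl
      simp [hne.symm, hpq.symm, this]
    · by_cases a3 : q = u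
      · subst a3; simp [a1, a2, hne]
      · simp [a1, a2, a3]

theorem lift_main (G : SimpleGraph V) (hN : ∀ x n, rpZ G x n → rpQ G x n → rpN G x n)
    (hT : ∀ T₀ : Finset V, ∃ T, T₀ ⊆ T ∧ ¬ cnK5 (qR G T)) (u v : V) (huv : G.Adj u v) (x : Sym2 V → ℤ) (n : ℤ)
    (h1 : rpZ (G.deleteEdges {s(u, v)}) x n) (h2 : rpQ (G.deleteEdges {s(u, v)}) x n) :
    rpN (G.deleteEdges {s(u, v)}) x n := by
  classical
  obtain ⟨I, _, d, S, hd, hdx⟩ := h1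
  obtain ⟨J, _, c, S', hc0, hc, hcx⟩ := h2
  have hn0 : 0 ≤ n := by
    have : (0:ℚ) ≤ n := by rw [← hc]; exact sum_nonneg fun j _ => hc0 j
    exact_mod_cast this
  rcases hn0.eq_or_lt with hn | hn
  · have hcz : ∀ j, c j = 0 := by
      rw [← hn] at hc
      have := (sum_eq_zero_iff_of_nonneg (fun j _ => hc0 j)).1 (hc.trans (by simp))
      exact fun j => this j (mem_univ j)
    refine ⟨Empty, inferInstance, fun _ => 0, fun _ => ∅, fun _ => le_rfl, by simp [← hn], fun e he => ?_⟩
    have := hcx e he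
    simp only [hcz, zero_mul, sum_const_zero] at this
    have : x e = 0 := by exact_mod_cast this.symm
    simp [this]
  obtain ⟨T, hT0, hK⟩ := hT ((univ.biUnion S ∪ univ.biUnion S') ∪ {u, v})
  have hS : ∀ i, S i ⊆ T := fun i => (subset_biUnion_of_mem S (mem_univ i)).trans
    (subset_union_left.trans (subset_union_left.trans hT0))
  have hS' : ∀ i, S' i ⊆ T := fun i => (subset_biUnion_of_mem S' (mem_univ i)).trans
    (subset_union_right.trans (subset_union_left.trans hT0))
  have huT : u ∈ T := hT0 (by simp)
  have hvT : v ∈ T := hT0 (by simp)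
  let φ : Finset V → Option T → ZMod 2 := fun S o => o.elim 0 (fun t => if t.1 ∈ S then 1 else 0)
  have hφ : ∀ S : Finset V, S ⊆ T → ∀ v, v ∈ S ↔ φ S (qp T v) ≠ 0 := by
    intro S hS v
    by_cases hv : v ∈ T
    · simp [qp, hv, φ]
    · have : v ∉ S := fun h => hv (hS h)
      simp [qp, hv, φ, this]
  let E1 := {p : Option T × Option T // ∃ x y, G.Adj x y ∧ s(x, y) ≠ s(u, v) ∧ qp T x = p.1 ∧ qp T y = p.2}
  let a : Option E1 → Option T := fun f => f.elim (qp T u) (fun p => p.1.1)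
  let b : Option E1 → Option T := fun f => f.elim (qp T v) (fun p => p.1.2)
  have hab : ∀ f, ∃ x y, G.Adj x y ∧ a f = qp T x ∧ b f = qp T y := by
    rintro (_ | ⟨p, x, y, h1, h2, h3, h4⟩)
    · exact ⟨u, v, huv, rfl, rfl⟩
    · exact ⟨x, y, h1, h3.symm, h4.symm⟩
  have hK' : ¬ cnK5 (mgR a b) := by
    intro hh
    refine hK (cnK5_mono ?_ hh)
    rintro p q ⟨f, hf⟩
    obtain ⟨x, y, h1, h2, h3⟩ := hab f
    rw [h2, h3] at hf
    rcases hf with ⟨h4, h5⟩ | ⟨h4, h5⟩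
    · exact ⟨x, y, h1, h4, h5⟩
    · exact ⟨y, x, h1.symm, h5, h4⟩
  have hedge : ∀ x y, s(x, y) ∈ (G.deleteEdges {s(u, v)}).edgeSet → ∃ f : E1, a (some f) = qp T x ∧ b (some f) = qp T y := by
    intro x y h
    rw [SimpleGraph.edgeSet_deleteEdges] at h
    exact ⟨⟨(qp T x, qp T y), x, y, h.1, h.2, rfl, rfl⟩, rfl, rfl⟩
  obtain ⟨t, ht2, K, _, l, s, l0, l1, l2, l3⟩ := lift_core a b hK' d (fun i => φ (S i)) c (fun j => φ (S' j)) n hn hd hc hc0 (by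
    rintro ⟨p, x, y, h1, h2, h3, h4⟩
    have he : s(x, y) ∈ (G.deleteEdges {s(u, v)}).edgeSet := by
      rw [SimpleGraph.edgeSet_deleteEdges]; exact ⟨h1, h2⟩
    have e1 := hdx _ he
    have e2 := hcx _ he
    simp only [cut_of_pot _ _ 0 (hφ _ (hS _))] at e1
    simp only [cut_of_pot _ _ 0 (hφ _ (hS' _))] at e2
    rw [h3, h4] at e1 e2
    exact (congrArg _ e1).trans e2.symm)
  obtain ⟨k, hk⟩ := ht2
  let X : Sym2 V → ℤ := fun e => if e = s(u, v) then t else x e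
  have hX : ∀ e ∈ (G.deleteEdges {s(u, v)}).edgeSet, X e = x e := by
    intro e he
    rw [SimpleGraph.edgeSet_deleteEdges] at he
    exact if_neg he.2
  have hXe : X s(u, v) = t := if_pos rfl
  have hGe : ∀ e ∈ G.edgeSet, e ≠ s(u, v) → e ∈ (G.deleteEdges {s(u, v)}).edgeSet := by
    intro e he hne
    rw [SimpleGraph.edgeSet_deleteEdges]; exact ⟨he, hne⟩
  have hne : u ≠ v := huv.ne
  have hZ : rpZ G X n := by
    refine ⟨I ⊕ Fin 4, inferInstance, Sum.elim d ![k, k, -k, -k], Sum.elim S ![{u}, {v}, {u, v}, ∅], ?_, fun e he => ?_⟩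
    · simp [Fintype.sum_sum_type, hd, Fin.sum_univ_four]
    · rw [Fintype.sum_sum_type]
      simp only [Sum.elim_inl, Sum.elim_inr, Fin.sum_univ_four]
      by_cases hee : e = s(u, v)
      · subst hee
        rw [hXe]
        have e1 : ∑ i, d i * cutFun (S i) s(u, v) = ∑ i, d i * iv (mgCd a b (φ (S i)) none) := by
          refine sum_congr rfl fun i _ => ?_
          rw [cut_of_pot _ _ 0 (hφ _ (hS i))]; rfl
        rw [e1]
        simp [cutFun_mk, hne, hne.symm]
        linarith
      · rw [hdx e (hGe e he hee), hX e (hGe e he hee)]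
        induction e using Sym2.ind with
        | _ p q =>
        have hpq : p ≠ q := G.ne_of_adj he
        have h3 := cut_four u v hne p q hpq hee
        have h4 : cutFun (∅ : Finset V) s(p, q) = 0 := by simp [cutFun_mk]
        have e5 : ∀ i, (![k, k, -k, -k] i : ℤ) * cutFun (![{u}, {v}, {u, v}, ∅] i) s(p, q) =
          ![k * cutFun {u} s(p, q), k * cutFun {v} s(p, q), -k * cutFun {u, v} s(p, q), -k * cutFun ∅ s(p, q)] i := by
          intro i; fin_cases i <;> rfl
        simp only [e5]
        show x s(p, q) + (k * cutFun {u} s(p, q) + k * cutFun {v} s(p, q) + -k * cutFun {u, v} s(p, q) + -k * cutFun ∅ s(p, q)) = x s(p, q)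
        rw [h4, ← h3]
        ring
  have hQ : rpQ G X n := by
    refine ⟨K, inferInstance, l, fun i => T.filter fun w => s i (qp T w) ≠ s i none, l0, l1, fun e he => ?_⟩
    have hm : ∀ i w, w ∈ (T.filter fun w => s i (qp T w) ≠ s i none) ↔ s i (qp T w) ≠ s i none := by
      intro i w
      rw [mem_filter]
      refine ⟨fun h => h.2, fun h => ⟨?_, h⟩⟩
      by_contra hw
      exact h (by simp [qp, hw])
    by_cases hee : e = s(u, v)
    · subst hee
      rw [hXe, ← l3]
      refine sum_congr rfl fun i _ => ?_
      rw [cut_of_pot _ _ _ (hm i)]; rfl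
    · have he' := hGe e he hee
      rw [hX e he', ← hdx e he']
      induction e using Sym2.ind with
      | _ p q =>
      obtain ⟨f, f1, f2⟩ := hedge p q he'
      have e1 := l2 f
      simp only [mgCd, f1, f2] at e1
      simp only [cut_of_pot _ _ _ (hm _), cut_of_pot _ _ 0 (hφ _ (hS _))]
      exact e1
  obtain ⟨M, _, m, R, m0, m1, m2⟩ := hN X n hZ hQ
  refine ⟨M, inferInstance, m, R, m0, m1, fun e he => ?_⟩
  rw [← hX e he]
  refine m2 e ?_
  rw [SimpleGraph.edgeSet_deleteEdges] at he
  exact he.1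

end Quot


def pat5 : Fin 5 → Bool × Bool × Bool × Bool → Bool
  | 0, _ => false
  | 1, p => p.1
  | 2, p => p.2.1
  | 3, p => p.2.2.1
  | 4, p => p.2.2.2

theorem no_five_aux (N : Bool × Bool × Bool × Bool → ℤ) (h0 : ∀ p, 0 ≤ N p) (h1 : ∑ p, N p = 4)
    (h : ∀ i j : Fin 5, i ≠ j → ∑ p, N p * (if pat5 i p = pat5 j p then 0 else 1) = 2) : False := by
  have e01 := h 0 1 (by decide)
  have e02 := h 0 2 (by decide)
  have e03 := h 0 3 (by decide)
  have e04 := h 0 4 (by decide)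
  have e12 := h 1 2 (by decide)
  have e13 := h 1 3 (by decide)
  have e14 := h 1 4 (by decide)
  have e23 := h 2 3 (by decide)
  have e24 := h 2 4 (by decide)
  have e34 := h 3 4 (by decide)
  simp only [Fintype.sum_prod_type, Fintype.sum_bool, pat5] at *
  norm_num at *
  clear h
  have c1 : N (false, false, false, false) = 0 ∨ N (false, false, false, false) = 1 := by omega
  have c2 : N (true, false, false, false) = 0 ∨ N (true, false, false, false) = 1 := by omega
  have c3 : N (false, true, false, false) = 0 ∨ N (false, true, false, false) = 1 := by omega
  rcases c1 with c1 | c1 <;> rcases c2 with c2 | c2 <;> rcases c3 with c3 | c3 <;> omega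

theorem sum32 : ∀ i j : Fin 5, ∑ g : Fin 5 → ZMod 2, iv (g i + g j) = if i = j then 0 else 16 := by
  decide +kernel

def dwt (g : Fin 5 → ZMod 2) : ℤ :=
  let c := (univ.filter fun i => g i = 1).card
  if c = 0 then -6 else if c = 1 then 4 else if c = 2 then -1 else 0

theorem sum32d : ∀ i j : Fin 5, ∑ g : Fin 5 → ZMod 2, dwt g * iv (g i + g j) = if i = j then 0 else 2 := by
  decide +kernel
theorem sum32n : ∑ g : Fin 5 → ZMod 2, dwt g = 4 := by
  decide +kernel

set_option linter.unusedSectionVars false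

theorem no_five {M : Type} [Fintype M] (m : M → ℤ) (h0 : ∀ k, 0 ≤ m k) (h1 : ∑ k, m k = 4)
    (g : M → Fin 5 → ZMod 2)
    (h : ∀ i j : Fin 5, i ≠ j → ∑ k, m k * (if g k i = g k j then 0 else 1) = 2) : False := by
  let pat : M → Bool × Bool × Bool × Bool := fun k =>
    (decide (g k 1 ≠ g k 0), decide (g k 2 ≠ g k 0), decide (g k 3 ≠ g k 0), decide (g k 4 ≠ g k 0))
  have hpat : ∀ k i, pat5 i (pat k) = decide (g k i ≠ g k 0) := by
    intro k i; fin_cases i <;> simp [pat5, pat]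
  have hsum : ∀ F : Bool × Bool × Bool × Bool → ℤ,
      ∑ p, (∑ k ∈ univ.filter (fun k => pat k = p), m k) * F p = ∑ k, m k * F (pat k) := by
    intro F
    rw [← sum_fiberwise_of_maps_to (s := univ) (t := univ) (g := pat) (fun i _ => mem_univ _)]
    refine sum_congr rfl fun p _ => ?_
    rw [sum_mul]
    refine sum_congr rfl fun k hk => ?_
    rw [(mem_filter.1 hk).2]
  refine no_five_aux (fun p => ∑ k ∈ univ.filter (fun k => pat k = p), m k)
    (fun p => sum_nonneg fun k _ => h0 k) ?_ ?_
  · have := hsum (fun _ => 1)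
    simp only [mul_one] at this
    rw [this, h1]
  · intro i j hij
    rw [hsum (fun p => if pat5 i p = pat5 j p then 0 else 1), ← h i j hij]
    refine sum_congr rfl fun k _ => ?_
    rw [hpat, hpat]
    congr 1
    generalize g k i = x
    generalize g k j = y
    generalize g k 0 = z
    revert x y z
    decide

section Good

def rch (G : SimpleGraph V) (T : Finset V) (v : V) : Set V :=
  {w | Relation.TransGen (fun a b => G.Adj a b ∧ b ∉ T) v w}

theorem rch_notMem {G : SimpleGraph V} {T : Finset V} {v w : V} (h : w ∈ rch G T v) : w ∉ T := by
  cases h with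
  | single h => exact h.2
  | tail _ h => exact h.2

theorem exists_good (G : SimpleGraph V) (T₀ : Finset V) : ∃ T, T₀ ⊆ T ∧
    ∀ v ∈ T, (rch G T v).Finite → ∀ w, G.Adj v w → w ∈ T := by
  classical
  let Y : Set V := ⋃ v ∈ {v | v ∈ T₀ ∧ (rch G T₀ v).Finite}, rch G T₀ v
  have hY : Y.Finite := by
    refine Set.Finite.biUnion (T₀.finite_toSet.subset fun v hv => hv.1) fun v hv => hv.2
  have hYm : ∀ w, w ∈ Y ↔ ∃ v, (v ∈ T₀ ∧ (rch G T₀ v).Finite) ∧ w ∈ rch G T₀ v := by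
    intro w; simp only [Y, Set.mem_iUnion, Set.mem_setOf_eq, exists_prop]
  have hm : ∀ w, w ∈ T₀ ∪ hY.toFinset ↔ w ∈ T₀ ∨ w ∈ Y := by intro w; simp
  have hstep : ∀ b c, b ∈ Y → G.Adj b c → c ∉ T₀ → c ∈ Y := by
    intro b c hb hbc hc
    obtain ⟨v, hv, hw⟩ := (hYm b).1 hb
    exact (hYm c).2 ⟨v, hv, Relation.TransGen.tail hw ⟨hbc, hc⟩⟩
  refine ⟨T₀ ∪ hY.toFinset, subset_union_left, fun v hv hfin w hvw => ?_⟩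
  by_contra hw
  rw [hm] at hv hw
  push Not at hw
  by_cases hvY : v ∈ Y
  · exact hw.2 (hstep v w hvY hvw hw.1)
  have hv0 : v ∈ T₀ := by tauto
  by_cases hf : (rch G T₀ v).Finite
  · exact hw.2 ((hYm w).2 ⟨v, ⟨hv0, hf⟩, Relation.TransGen.single ⟨hvw, hw.1⟩⟩)
  · apply hf
    refine (hfin.union hY).subset fun z hz => ?_
    by_cases hzY : z ∈ Y
    · exact Or.inr hzY
    left
    have hz' : Relation.TransGen (fun a b => G.Adj a b ∧ b ∉ T₀) v z := hz
    clear hz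
    induction hz' with
    | single h => exact Relation.TransGen.single ⟨h.1, by rw [hm]; exact fun hh => hh.elim h.2 hzY⟩
    | tail h1 h ih =>
      have hbY : _ ∉ Y := fun hb => hzY (hstep _ _ hb h.1 h.2)
      exact Relation.TransGen.tail (ih hbY) ⟨h.1, by rw [hm]; exact fun hh => hh.elim h.2 hzY⟩

theorem good_noK5 (G : SimpleGraph V) (hN : ∀ x n, rpZ G x n → rpQ G x n → rpN G x n) (T : Finset V)
    (hgood : ∀ v ∈ T, (rch G T v).Finite → ∀ w, G.Adj v w → w ∈ T) : ¬ cnK5 (qR G T) := by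
  classical
  rintro ⟨X, hc, hdis, hadj⟩
  have hlab : ∃ lab : Option T → Fin 5, ∀ i, ∀ o ∈ X i, lab o = i := by
    refine ⟨fun o => if h : ∃ i, o ∈ X i then h.choose else 0, fun i o ho => ?_⟩
    have h : ∃ i, o ∈ X i := ⟨i, ho⟩
    beta_reduce
    rw [dif_pos h]
    by_contra hne
    exact Set.disjoint_left.1 (hdis _ _ hne) h.choose_spec ho
  obtain ⟨lab, hlab⟩ := hlab
  let x : Sym2 V → ℤ := Sym2.lift ⟨fun v w => if lab (qp T v) = lab (qp T w) then 0 else 2, fun v w => by simp only [eq_comm]⟩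
  have hx : ∀ v w, x s(v, w) = if lab (qp T v) = lab (qp T w) then 0 else 2 := fun v w => rfl
  let Sg : (Fin 5 → ZMod 2) → Finset V := fun g => T.filter fun v => g (lab (qp T v)) ≠ g (lab none)
  have hSg : ∀ g v w, cutFun (Sg g) s(v, w) = iv (g (lab (qp T v)) + g (lab (qp T w))) := by
    intro g v w
    refine cut_of_pot (Sg g) (fun v => g (lab (qp T v))) (g (lab none)) (fun v => ?_) v w
    rw [mem_filter]
    refine ⟨fun h => h.2, fun h => ⟨?_, h⟩⟩
    by_contra hv
    exact h (by simp [qp, hv])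
  have hZ : rpZ G x 4 := by
    refine ⟨Fin 5 → ZMod 2, inferInstance, dwt, Sg, sum32n, fun e _ => ?_⟩
    induction e using Sym2.ind with
    | _ v w =>
    rw [hx, ← sum32d]
    exact sum_congr rfl fun g _ => by rw [hSg]
  have hQ : rpQ G x 4 := by
    refine ⟨Fin 5 → ZMod 2, inferInstance, fun _ => 1 / 8, Sg, fun _ => by norm_num, ?_, fun e _ => ?_⟩
    · simp only [sum_const, card_univ, Fintype.card_pi, ZMod.card, prod_const, Fintype.card_fin]
      norm_num
    induction e using Sym2.ind with
    | _ v w =>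
    rw [hx, ← mul_sum]
    simp only [hSg]
    have := sum32 (lab (qp T v)) (lab (qp T w))
    rw [← Int.cast_sum, this]
    split_ifs <;> norm_num
  obtain ⟨M, _, m, R, m0, m1, m2⟩ := hN x 4 hZ hQ
  let sk : M → Option T → ZMod 2 := fun k o => o.elim 0 (fun t => if t.1 ∈ R k then 1 else 0)
  have hskT : ∀ k v, v ∈ T → (v ∈ R k ↔ sk k (qp T v) = 1) := by
    intro k v hv; simp [sk, qp, hv]
  have hcutiv : ∀ k v w, (v ∈ R k ↔ sk k (qp T v) = 1) → (w ∈ R k ↔ sk k (qp T w) = 1) →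
      cutFun (R k) s(v, w) = iv (sk k (qp T v) + sk k (qp T w)) := by
    intro k v w h1 h2
    rw [cutFun_mk]
    simp only [h1, h2]
    clear h1 h2
    generalize sk k (qp T v) = a
    generalize sk k (qp T w) = b
    revert a b; unfold iv; decide
  have hout : ∀ v ∈ T, ∀ w, G.Adj v w → w ∉ T → ∃ w₁, G.Adj v w₁ ∧ w₁ ∉ T ∧ ∀ k, m k ≠ 0 → w₁ ∉ R k := by
    intro v hv w hvw hw
    have hinf : (rch G T v).Infinite := fun hf => hw (hgood v hv hf w hvw)
    obtain ⟨z, hz, hzR⟩ := hinf.exists_notMem_finset (univ.biUnion R)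
    have hzR' : ∀ k, m k ≠ 0 → z ∉ R k := fun k _ hh => hzR (mem_biUnion.2 ⟨k, mem_univ _, hh⟩)
    have hz' : Relation.TransGen (fun a b => G.Adj a b ∧ b ∉ T) v z := hz
    clear hz hzR
    induction hz' with
    | single h => exact ⟨_, h.1, h.2, hzR'⟩
    | @tail b c h1 h ih =>
      refine ih fun k hk hb => hzR' k hk ?_
      have hbT : b ∉ T := rch_notMem (v := v) (G := G) h1
      have e := m2 s(b, c) h.1
      rw [hx] at e
      simp only [qp, hbT, h.2, dif_neg, not_false_eq_true, if_true] at e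
      have hnn : ∀ k ∈ (univ : Finset M), 0 ≤ m k * cutFun (R k) s(b, c) := by
        intro k _
        refine mul_nonneg (m0 k) ?_
        rw [cutFun_mk]; split_ifs <;> norm_num
      have := (sum_eq_zero_iff_of_nonneg hnn).1 e k (mem_univ k)
      rw [cutFun_mk] at this
      by_contra hcR
      simp [hb, hcR, hk] at this
  have hF1 : ∀ v w, G.Adj v w → v ∈ T → ∑ k, m k * iv (sk k (qp T v) + sk k (qp T w))
      = if lab (qp T v) = lab (qp T w) then 0 else 2 := by
    intro v w hvw hv
    by_cases hw : w ∈ T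
    · rw [← hx, ← m2 s(v, w) hvw]
      exact sum_congr rfl fun k _ => by rw [hcutiv k v w (hskT k v hv) (hskT k w hw)]
    · obtain ⟨w₁, h1, h2, h3⟩ := hout v hv w hvw hw
      have e : qp T w = qp T w₁ := by simp [qp, hw, h2]
      rw [e, ← hx, ← m2 s(v, w₁) h1]
      refine sum_congr rfl fun k _ => ?_
      by_cases hk : m k = 0
      · simp [hk]
      · rw [hcutiv k v w₁ (hskT k v hv)]
        simp [h3 k hk, sk, qp, h2]
  have hF : ∀ p q, qR G T p q → ∑ k, m k * iv (sk k p + sk k q) = if lab p = lab q then 0 else 2 := by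
    rintro p q ⟨v, w, hvw, rfl, rfl⟩
    by_cases hv : v ∈ T
    · exact hF1 v w hvw hv
    by_cases hw : w ∈ T
    · have := hF1 w v hvw.symm hw
      simp only [add_comm, eq_comm] at this ⊢
      exact this
    · have : qp T v = qp T w := by simp [qp, hv, hw]
      rw [this]
      simp [z2_add_self, iv]
  have hconst : ∀ i, ∀ k, m k ≠ 0 → ∀ p ∈ X i, ∀ q ∈ X i, sk k p = sk k q := by
    intro i k hk p hp q hq
    by_contra hne
    obtain ⟨o, ho, o', ho', hr⟩ := (hc i).2 {o | o ∈ X i ∧ sk k o = sk k p} (fun o ho => ho.1) ⟨p, hp, rfl⟩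
      ⟨q, hq, fun hh => hne hh.2.symm⟩
    have e := hF o o' hr
    rw [hlab i o ho.1, hlab i o' ho'.1, if_pos rfl] at e
    have := (sum_eq_zero_iff_of_nonneg (fun k _ => mul_nonneg (m0 k) (iv_nonneg _))).1 e k (mem_univ k)
    have h3 : iv (sk k o + sk k o') = 0 := by
      rcases mul_eq_zero.1 this with h | h
      · exact absurd h hk
      · exact h
    have h4 : sk k o = sk k o' := by
      rw [← z2_add_eq_zero]
      rw [← z2_ne_one]
      intro h5
      rw [h5] at h3
      simp [iv] at h3
    exact ho'.2 ⟨ho'.1, h4 ▸ ho.2⟩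
  choose o ho using fun i => (hc i).1
  refine no_five m m0 m1 (fun k i => sk k (o i)) fun i j hij => ?_
  obtain ⟨p, hp, q, hq, hr⟩ := hadj i j hij
  have e := hF p q hr
  rw [hlab i p hp, hlab j q hq, if_neg hij] at e
  rw [← e]
  refine sum_congr rfl fun k _ => ?_
  by_cases hk : m k = 0
  · simp [hk]
  · rw [hconst i k hk p hp _ (ho i), hconst j k hk q hq _ (ho j)]
    congr 1
    beta_reduce
    generalize sk k (o i) = a
    generalize sk k (o j) = b
    revert a b; unfold iv; decide

end Good

theorem stmt4 (G : SimpleGraph V) (hK5 : ¬ IsMinor (⊤ : SimpleGraph (Fin 5)) G)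
    (hG : IsNormal G) (e₀ : Sym2 V) : IsNormal (G.deleteEdges {e₀}) := by
  by_cases he : e₀ ∈ G.edgeSet
  · rw [isNormal_iff] at hG ⊢
    intro x n h1 h2
    induction e₀ using Sym2.ind with
    | _ u v =>
    refine lift_main G hG (fun T₀ => ?_) u v he x n h1 h2
    obtain ⟨T, hT, hg⟩ := exists_good G T₀
    exact ⟨T, hT, good_noK5 G hG T hg⟩
  · have : G.deleteEdges {e₀} = G := by
      rw [SimpleGraph.deleteEdges_eq_self]
      exact Set.disjoint_singleton_right.2 he
    rwa [this]
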